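/- Under Assumptions A1–A4, for fixed t ∈ (0,1), 0 ≤ r_2 < r_1 < 1, and any α > 0, β > 0, λ > 0, as n → ∞, E[ Θ(α, β, λ; U_{⌊nt⌋}, Ṽ_{⌊nt⌋}(r_1, r_2), S_n) e^{−S_n}; L_n ≥ 0 ] / E[e^{−S_n}; L_n ≥ 0] converges to ⨌ Θ*(α, β, λ; u, v, −z) P⁺(B⁺ ∈ du) P_z⁻(V_∞(r_1, r_2) ∈ dv) ν_1(dz), where: θ(α,β,λ; u,v,x) := l(v)/(e^{−x}α + (λα e^{−x} l(u_1) + l(u_2) l(v))(β + α κ(u_3))) for u = (u_1,u_2,u_3), Θ is the product of θ over v = (v_1,v_2), θ*(α,β,λ; u,v,x) := l(v)/(α e^{−x} + (λα e^{−x} + l(v))(β + α κ(u))), Θ* is the product of θ* over (v_1,v_2); U_{⌊nt⌋} = ((1 − exp(−λα e^{−S_{⌊nt⌋}}))/(λα e^{−S_{⌊nt⌋}}), exp(−λα e^{−S_{⌊nt⌋}}), b_{⌊nt⌋}); Ṽ_{⌊nt⌋}(r) := (1 − f_{⌊nt⌋,n}(r)) e^{S_{⌊nt⌋} − S_n}; V_∞(r)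 := 1/(B⁻ + (1 − r)^{−1}); and ν_1(dz) = c_{21} e^{z} v(z) 1{z < 0} dz. -/

import Mathlib

open MeasureTheory ProbabilityTheory Filter Set Topology

noncomputable section

namespace BPREpaper

variable {Ω : Type*} [MeasurableSpace Ω]

/-- The random walk `S n = X 1 + ... + X n` (increments indexed from `1`, `S 0 = 0`). -/
def walk (X : ℕ → Ω → ℝ) (n : ℕ) (ω : Ω) : ℝ := ∑ i ∈ Finset.Icc 1 n, X i ω

/-- `Mwalk X n = max (S 1, ..., S n)` for `n ≥ 1` (junk value `0` for `n = 0`). -/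
def Mwalk (X : ℕ → Ω → ℝ) : ℕ → Ω → ℝ
  | 0, _ => 0
  | n + 1, ω =>
      (Finset.Icc 1 (n + 1)).sup' (Finset.nonempty_Icc.mpr (by omega)) fun i => walk X i ω

/-- `Lwalk X n = min (S 1, ..., S n)` for `n ≥ 1` (junk value `0` for `n = 0`). -/
def Lwalk (X : ℕ → Ω → ℝ) : ℕ → Ω → ℝ
  | 0, _ => 0
  | n + 1, ω =>
      (Finset.Icc 1 (n + 1)).inf' (Finset.nonempty_Icc.mpr (by omega)) fun i => walk X i ω

/-- minimum of `S 0, S 1, ..., S n`. -/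
def minWalk (X : ℕ → Ω → ℝ) (n : ℕ) (ω : Ω) : ℝ :=
  (Finset.range (n + 1)).inf' (by simp) fun i => walk X i ω

/-- `τ(n)`: the first moment at which the minimum of `S 0, ..., S n` is attained. -/
def tauWalk (X : ℕ → Ω → ℝ) (n : ℕ) (ω : Ω) : ℕ :=
  sInf {i : ℕ | walk X i ω = minWalk X n ω}

/-- The renewal function `u(x) = 1 + ∑_{k ≥ 1} P(-S_k ≤ x, M_k < 0)` for `x ≥ 0`,
`u(x) = 0` for `x < 0`. -/
def uFun (μ : Measure Ω) (X : ℕ → Ω → ℝ) (x : ℝ) : ℝ :=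
  if 0 ≤ x then
    1 + ∑' k : ℕ, (μ {ω | -walk X (k + 1) ω ≤ x ∧ Mwalk X (k + 1) ω < 0}).toReal
  else 0

/-- The renewal function `v(x) = 1 + ∑_{k ≥ 1} P(-S_k > x, L_k ≥ 0)` for `x ≤ 0`,
`v(x) = 0` for `x > 0`. -/
def vFun (μ : Measure Ω) (X : ℕ → Ω → ℝ) (x : ℝ) : ℝ :=
  if x ≤ 0 then
    1 + ∑' k : ℕ, (μ {ω | x < -walk X (k + 1) ω ∧ 0 ≤ Lwalk X (k + 1) ω}).toReal
  else 0

/-- The event `{∀ 1 ≤ i ≤ n, x + S_i ≥ 0} = {L_n ≥ 0}` for the walk started at `x`. -/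
def posSet (X : ℕ → Ω → ℝ) (x : ℝ) (n : ℕ) : Set Ω :=
  {ω | ∀ i ∈ Finset.Icc 1 n, 0 ≤ x + walk X i ω}

/-- The event `{∀ 1 ≤ i ≤ n, x + S_i < 0} = {M_n < 0}` for the walk started at `x`. -/
def negSet (X : ℕ → Ω → ℝ) (x : ℝ) (n : ℕ) : Set Ω :=
  {ω | ∀ i ∈ Finset.Icc 1 n, x + walk X i ω < 0}

/-- A distribution on `ℝ` is non-lattice: it is not concentrated on any arithmetic
progression `a + hℤ`. -/
def NonLattice (ν : Measure ℝ) : Prop :=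
  ¬ ∃ a h : ℝ, ν {x | ∃ k : ℤ, x = a + k * h} = 1

/-- `ν` is an `α`-stable law on `ℝ`. -/
def IsStableLaw (α : ℝ) (ν : Measure ℝ) : Prop :=
  ∀ a b : ℝ, 0 < a → 0 < b → ∃ c d : ℝ, 0 < c ∧ a ^ α + b ^ α = c ^ α ∧
    ((ν.map (fun x => a * x)).prod (ν.map (fun x => b * x))).map (fun p : ℝ × ℝ => p.1 + p.2)
      = ν.map (fun x => c * x + d)

/-- Weak convergence of a sequence of laws on `ℝ`, tested against bounded continuous
functions. -/
def WeakTendsto (μs : ℕ → Measure ℝ) (ν : Measure ℝ) : Prop :=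
  ∀ g : BoundedContinuousFunction ℝ ℝ,
    Tendsto (fun n => ∫ x, g x ∂(μs n)) atTop (𝓝 (∫ x, g x ∂ν))

/-- Assumption A4: there are norming constants `c n → ∞` such that `S n / c n` converges in
distribution to an `α`-stable law concentrated neither on `[0,∞)` nor on `(-∞,0]`; the
increment distribution is non-lattice. -/
def AssumptionA4 (μ : Measure Ω) (X : ℕ → Ω → ℝ) (c : ℕ → ℝ) : Prop :=
  Tendsto c atTop atTop ∧ NonLattice (μ.map (X 1)) ∧
    ∃ (α : ℝ) (ν : Measure ℝ), IsProbabilityMeasure ν ∧ IsStableLaw α ν ∧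
      0 < ν (Set.Iio 0) ∧ 0 < ν (Set.Ioi 0) ∧
      WeakTendsto (fun n => μ.map fun ω => walk X n ω / c n) ν

/-- A family of random elements indexed by `ι` which is i.i.d. (the common distribution
being that of the element with index `i0`). -/
def IIDfam {ι : Type*} {E : Type*} [MeasurableSpace E] (μ : Measure Ω) (Q : ι → Ω → E)
    (i0 : ι) : Prop :=
  (∀ i, Measurable (Q i)) ∧ iIndepFun Q μ ∧
    ∀ i, IdentDistrib (Q i) (Q i0) μ μ

/-- An i.i.d. sequence indexed by `ℕ` (indices from `1` are the relevant ones). -/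
def IIDseq {E : Type*} [MeasurableSpace E] (μ : Measure Ω) (Q : ℕ → Ω → E) : Prop :=
  IIDfam μ Q 1

/-- `P` is the h-transform measure `P_x⁺`: for every `n` and every bounded
`F n`-measurable `g`, `E_P[g] = u(x)⁻¹ E_x[g · u(S_n); L_n ≥ 0]`. -/
def IsPplus (μ : Measure Ω) (X : ℕ → Ω → ℝ) (F : ℕ → MeasurableSpace Ω) (x : ℝ)
    (P : Measure Ω) : Prop :=
  IsProbabilityMeasure P ∧
    ∀ (n : ℕ) (g : Ω → ℝ), Measurable[F n] g → (∃ C, ∀ ω, |g ω| ≤ C) →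
      ∫ ω, g ω ∂P =
        (uFun μ X x)⁻¹ * ∫ ω in posSet X x n, g ω * uFun μ X (x + walk X n ω) ∂μ

/-- `P` is the h-transform measure `P_x⁻`: for every `n` and every bounded
`F n`-measurable `g`, `E_P[g] = v(x)⁻¹ E_x[g · v(S_n); M_n < 0]`. -/
def IsPminus (μ : Measure Ω) (X : ℕ → Ω → ℝ) (F : ℕ → MeasurableSpace Ω) (x : ℝ)
    (P : Measure Ω) : Prop :=
  IsProbabilityMeasure P ∧
    ∀ (n : ℕ) (g : Ω → ℝ), Measurable[F n] g → (∃ C, ∀ ω, |g ω| ≤ C) →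
      ∫ ω, g ω ∂P =
        (vFun μ X x)⁻¹ * ∫ ω in negSet X x n, g ω * vFun μ X (x + walk X n ω) ∂μ

/-- The filtration generated by the environment `Q 1, ..., Q n`. -/
def envFiltration {E : Type*} [MeasurableSpace E] (Q : ℕ → Ω → E) (n : ℕ) :
    MeasurableSpace Ω :=
  ⨆ i ∈ Finset.Icc 1 n, MeasurableSpace.comap (Q i) inferInstance

/-- The σ-algebra generated by the whole environment `Q 1, Q 2, ...`. -/
def envSigma {E : Type*} [MeasurableSpace E] (Q : ℕ → Ω → E) : MeasurableSpace Ω :=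
  ⨆ i, MeasurableSpace.comap (Q (i + 1)) inferInstance

/-- Probability generating function of the (random) offspring law `Q n`. -/
def pgf (Q : ℕ → Ω → Measure ℕ) (n : ℕ) (ω : Ω) (s : ℝ) : ℝ :=
  ∑' i : ℕ, (Q n ω {i}).toReal * s ^ i

/-- Mean `m(Q_n)` of the offspring law `Q n`. -/
def meanQ (Q : ℕ → Ω → Measure ℕ) (n : ℕ) (ω : Ω) : ℝ :=
  ∑' i : ℕ, (i : ℝ) * (Q n ω {i}).toReal

/-- `X_n = log f_n'(1)`, the increments of the associated random walk. -/
def Xenv (Q : ℕ → Ω → Measure ℕ) (n : ℕ) (ω : Ω) : ℝ := Real.log (meanQ Q n ω)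

/-- `η_n = f_n''(1) / (2 f_n'(1)^2)`. -/
def etaEnv (Q : ℕ → Ω → Measure ℕ) (n : ℕ) (ω : Ω) : ℝ :=
  (∑' i : ℕ, ((i : ℝ) * ((i : ℝ) - 1)) * (Q n ω {i}).toReal) / (2 * meanQ Q n ω ^ 2)

/-- The associated random walk `S_n = X_1 + ... + X_n`. -/
def Senv (Q : ℕ → Ω → Measure ℕ) : ℕ → Ω → ℝ := walk (Xenv Q)

/-- The composition `f_{j,n}(s) = f_{j+1}(f_{j+2}(⋯ f_n(s) ⋯))`, with `f_{j,n} = id` for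
`n ≤ j`. -/
def pgfComp (Q : ℕ → Ω → Measure ℕ) (j : ℕ) : ℕ → Ω → ℝ → ℝ
  | 0, _, s => s
  | n + 1, ω, s => if n + 1 ≤ j then s else pgfComp Q j n ω (pgf Q (n + 1) ω s)

/-- `b_n = ∑_{i=0}^{n-1} η_{i+1} e^{-S_i}`. -/
def bEnv (Q : ℕ → Ω → Measure ℕ) (n : ℕ) (ω : Ω) : ℝ :=
  ∑ i ∈ Finset.range n, etaEnv Q (i + 1) ω * Real.exp (-(Senv Q i ω))

/-- `B⁺ = ∑_{i=0}^∞ η_{i+1} e^{-S_i}`. -/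
def Bplus (Q : ℕ → Ω → Measure ℕ) (ω : Ω) : ℝ :=
  ∑' i : ℕ, etaEnv Q (i + 1) ω * Real.exp (-(Senv Q i ω))

/-- `B⁻ = ∑_{i=1}^∞ η_i e^{S_i}`. -/
def Bminus (Q : ℕ → Ω → Measure ℕ) (ω : Ω) : ℝ :=
  ∑' i : ℕ, etaEnv Q (i + 1) ω * Real.exp (Senv Q (i + 1) ω)

/-- `V_∞(r) = 1 / (B⁻ + (1 - r)⁻¹)`. -/
def Vinf (Q : ℕ → Ω → Measure ℕ) (r : ℝ) (ω : Ω) : ℝ := (Bminus Q ω + (1 - r)⁻¹)⁻¹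

/-- All the offspring generating functions are fractional linear:
`1/(1 - f_n(s)) = e^{-X_n}/(1-s) + η_n`. -/
def FracLinear (Q : ℕ → Ω → Measure ℕ) : Prop :=
  ∀ n, 1 ≤ n → ∀ ω : Ω, ∀ s : ℝ, 0 ≤ s → s < 1 →
    (1 - pgf Q n ω s)⁻¹ = Real.exp (-(Xenv Q n ω)) / (1 - s) + etaEnv Q n ω

/-- Assumption A1 with explicit constant `χ`. -/
def AssumptionA1With (μ : Measure Ω) (Q : ℕ → Ω → Measure ℕ) (χ : ℝ) : Prop :=
  0 < χ ∧ χ < 1 / 2 ∧ ∀ n, 1 ≤ n →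
    ∀ᵐ ω ∂μ, χ ≤ pgf Q n ω 0 ∧ pgf Q n ω 0 ≤ 1 - χ ∧ χ ≤ etaEnv Q n ω

/-- Assumption A1: for some `χ ∈ (0,1/2)`, `χ ≤ f(0) ≤ 1 - χ` and `η ≥ χ` a.s. -/
def AssumptionA1 (μ : Measure Ω) (Q : ℕ → Ω → Measure ℕ) : Prop :=
  ∃ χ : ℝ, AssumptionA1With μ Q χ

/-- Assumption A2: `X` has zero mean, finite positive variance and is non-lattice. -/
def AssumptionA2 (μ : Measure Ω) (Q : ℕ → Ω → Measure ℕ) : Prop :=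
  Integrable (Xenv Q 1) μ ∧ (∫ ω, Xenv Q 1 ω ∂μ) = 0 ∧
    Integrable (fun ω => Xenv Q 1 ω ^ 2) μ ∧ 0 < ∫ ω, Xenv Q 1 ω ^ 2 ∂μ ∧
    NonLattice (μ.map (Xenv Q 1))

/-- `ζ(a) = ∑_{y ≥ a} y² Q({y}) / m(Q)²`. -/
def zetaEnv (Q : ℕ → Ω → Measure ℕ) (a : ℕ) (ω : Ω) : ℝ :=
  (∑' y : ℕ, if a ≤ y then (y : ℝ) ^ 2 * (Q 1 ω {y}).toReal else 0) / meanQ Q 1 ω ^ 2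

/-- Assumption A3: `E[(log⁺ ζ(a))^{2+ε}] < ∞` for some `ε > 0`, `a ∈ ℕ`. -/
def AssumptionA3 (μ : Measure Ω) (Q : ℕ → Ω → Measure ℕ) : Prop :=
  ∃ ε : ℝ, 0 < ε ∧ ∃ a : ℕ, 1 ≤ a ∧
    Integrable (fun ω => Real.log (max (zetaEnv Q a ω) 1) ^ (2 + ε)) μ

/-- The extinction moment `T = min {k ≥ 0 : Z_k = 0}`. -/
def extinctTime (Z : ℕ → Ω → ℕ) (ω : Ω) : ℕ := sInf {k | Z k ω = 0}

/-- The branching property of `Z` in the environment `Q` (started from one particle):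
given the environment and `Z_k`, the conditional generating function of `Z_n` is
`f_{k,n}(s)^{Z_k}`; the state `0` is absorbing. -/
def BranchingProperty (μ : Measure Ω) (Q : ℕ → Ω → Measure ℕ) (Z : ℕ → Ω → ℕ) : Prop :=
  (∀ ω, Z 0 ω = 1) ∧ (∀ n, Measurable (Z n)) ∧ (∀ n ω, Z n ω = 0 → Z (n + 1) ω = 0) ∧
    ∀ k n : ℕ, k ≤ n → ∀ s : ℝ, 0 ≤ s → s ≤ 1 →
      (μ[fun ω => s ^ Z n ω | envSigma Q ⊔ MeasurableSpace.comap (Z k) inferInstance])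
        =ᵐ[μ] fun ω => pgfComp Q k n ω s ^ Z k ω

/-- `l(y) = y 1{0 ≤ y ≤ 1} + 1{y > 1}`. -/
def lfun (y : ℝ) : ℝ := if y < 0 then 0 else if y ≤ 1 then y else 1

/-- `κ(y) = y 1{y > 0}`. -/
def kappa (y : ℝ) : ℝ := if 0 < y then y else 0

/-- `θ(α,β,λ; u, v, x)` for a triple `u = (u₁,u₂,u₃)`. -/
def thetaFun (α β lam : ℝ) (u : ℝ × ℝ × ℝ) (v x : ℝ) : ℝ :=
  lfun v / (Real.exp (-x) * α +
    (lam * α * Real.exp (-x) * lfun u.1 + lfun u.2.1 * lfun v) * (β + α * kappa u.2.2))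

/-- `θ*(α,β,λ; u, v, x)`, the special case `u = (1,1,u)`. -/
def thetaStar (α β lam u v x : ℝ) : ℝ :=
  lfun v / (α * Real.exp (-x) + (lam * α * Real.exp (-x) + lfun v) * (β + α * kappa u))

/-- `ω(λ; u, v, x)` for a triple `u = (u₁,u₂,u₃)`. -/
def omegaFun (lam : ℝ) (u : ℝ × ℝ × ℝ) (v x : ℝ) : ℝ :=
  lfun v / (1 + (lam * lfun u.1 + lfun u.2.1 * lfun v * Real.exp x) * kappa u.2.2)

/-- `ω*(λ; u, v, x)`, the special case `u = (1,1,u)`. -/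
def omegaStar (lam u v x : ℝ) : ℝ :=
  lfun v / (1 + (lam + lfun v * Real.exp x) * kappa u)

/-- The random vector `U_m = ((1 - e^{-λα e^{-S_m}})/(λα e^{-S_m}), e^{-λα e^{-S_m}}, b_m)`. -/
def Uvec {Ω : Type*} [MeasurableSpace Ω] (Q : ℕ → Ω → Measure ℕ) (α lam : ℝ) (m : ℕ)
    (ω : Ω) : ℝ × ℝ × ℝ :=
  ((1 - Real.exp (-(lam * α * Real.exp (-(Senv Q m ω))))) /
      (lam * α * Real.exp (-(Senv Q m ω))),
    Real.exp (-(lam * α * Real.exp (-(Senv Q m ω)))), bEnv Q m ω)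

/-- `Ṽ_m(r) = (1 - f_{m,n}(r)) e^{S_m - S_n}`. -/
def Vtil {Ω : Type*} [MeasurableSpace Ω] (Q : ℕ → Ω → Measure ℕ) (m n : ℕ) (r : ℝ)
    (ω : Ω) : ℝ :=
  (1 - pgfComp Q m n ω r) * Real.exp (Senv Q m ω - Senv Q n ω)

/-! ### Sequences with polynomial decay -/

lemma tendsto_half_conv {a b : ℕ → ℝ} {ρ B : ℝ} (hρ : 0 ≤ ρ) (ha : Summable a)
    (ha0 : ∀ n, 0 ≤ a n) (hb : Tendsto (fun n : ℕ => (n : ℝ) ^ ρ * b n) atTop (𝓝 B))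
    {c : ℕ → ℕ} (hc : ∀ n, ∀ j < c n, 2 * j ≤ n) (hct : Tendsto c atTop atTop) :
    Tendsto (fun n : ℕ => (n : ℝ) ^ ρ * ∑ j ∈ Finset.range (c n), a j * b (n - j)) atTop
      (𝓝 ((∑' j, a j) * B)) := by
  obtain ⟨C, hC⟩ : ∃ C, ∀ n : ℕ, |(n : ℝ) ^ ρ * b n| ≤ C := by
    obtain ⟨C, hC⟩ := (Metric.isBounded_range_of_tendsto _ hb).exists_norm_le
    exact ⟨C, fun n => hC _ (mem_range_self n)⟩
  have hC0 : 0 ≤ C := (abs_nonneg _).trans (hC 0)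
  have key : Tendsto (fun n : ℕ => ∑' j, if j < c n then a j * ((n : ℝ) ^ ρ * b (n - j)) else 0)
      atTop (𝓝 (∑' j, a j * B)) := by
    refine tendsto_tsum_of_dominated_convergence (bound := fun j => a j * (2 ^ ρ * C))
      (ha.mul_right _) ?_ ?_
    · intro j
      have h1 : Tendsto (fun n : ℕ => ((n : ℝ) / ((n - j : ℕ) : ℝ)) ^ ρ *
          (((n - j : ℕ) : ℝ) ^ ρ * b (n - j))) atTop (𝓝 (1 ^ ρ * B)) := by
        refine Tendsto.mul (Tendsto.rpow_const ?_ (Or.inr hρ))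
          (hb.comp (tendsto_sub_atTop_nat j))
        have := (tendsto_natCast_div_add_atTop (j : ℝ)).inv₀ one_ne_zero
        rw [inv_one] at this
        refine ((this.comp (tendsto_sub_atTop_nat j))).congr' ?_
        filter_upwards [eventually_ge_atTop j] with n hn
        simp [Nat.cast_sub hn]
      rw [Real.one_rpow, one_mul] at h1
      refine (h1.const_mul (a j)).congr' ?_
      filter_upwards [hct.eventually_gt_atTop j, eventually_gt_atTop j] with n hn hj
      rw [if_pos hn]
      have : (0 : ℝ) < ((n - j : ℕ) : ℝ) := by exact_mod_cast Nat.sub_pos_of_lt hj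
      rw [Real.div_rpow (by positivity) this.le]
      have := Real.rpow_pos_of_pos this ρ
      field_simp
    · refine Eventually.of_forall fun n j => ?_
      split_ifs with h
      · rw [norm_mul, Real.norm_of_nonneg (ha0 j)]
        refine mul_le_mul_of_nonneg_left ?_ (ha0 j)
        have h2 : (n : ℝ) ≤ 2 * ((n - j : ℕ) : ℝ) := by
          have := hc n j h
          exact_mod_cast (by omega : n ≤ 2 * (n - j))
        calc ‖(n : ℝ) ^ ρ * b (n - j)‖ = (n : ℝ) ^ ρ * |b (n - j)| := by
              rw [norm_mul, Real.norm_of_nonneg (by positivity), Real.norm_eq_abs]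
          _ ≤ (2 * ((n - j : ℕ) : ℝ)) ^ ρ * |b (n - j)| := by gcongr
          _ = 2 ^ ρ * |((n - j : ℕ) : ℝ) ^ ρ * b (n - j)| := by
              rw [Real.mul_rpow (by positivity) (by positivity), abs_mul,
                abs_of_nonneg (by positivity : (0:ℝ) ≤ ((n - j : ℕ) : ℝ) ^ ρ), mul_assoc]
          _ ≤ _ := by gcongr; exact hC _
      · simpa using mul_nonneg (ha0 j) (by positivity)
  rw [tsum_mul_right] at key
  refine key.congr fun n => ?_
  rw [tsum_eq_sum (s := Finset.range (c n))
    (fun j hj => if_neg (by simpa using hj)), Finset.mul_sum]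
  refine Finset.sum_congr rfl fun j hj => ?_
  rw [if_pos (by simpa using hj)]
  ring

lemma exists_bound_of_tendsto {x : ℕ → ℝ} {B : ℝ} (h : Tendsto x atTop (𝓝 B)) :
    ∃ C, 0 < C ∧ ∀ n, |x n| ≤ C := by
  obtain ⟨C, hC⟩ := (Metric.isBounded_range_of_tendsto x h).exists_norm_le
  exact ⟨max C 1, by positivity, fun n => (hC _ (mem_range_self n)).trans (le_max_left _ _)⟩

lemma summable_of_rpow_bound {a : ℕ → ℝ} (ha0 : ∀ n, 0 ≤ a n) {r C : ℝ} (hr : 1 < r)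
    (h : ∀ n : ℕ, 1 ≤ n → (n : ℝ) ^ r * a n ≤ C) : Summable a := by
  rw [← summable_nat_add_iff 1]
  refine Summable.of_nonneg_of_le (fun n => ha0 _) (fun n => ?_)
    (((summable_nat_add_iff 1).2 (Real.summable_nat_rpow.2 (neg_lt_neg hr))).mul_left C)
  have h1 := h (n + 1) (by omega)
  have h2 : (0 : ℝ) < ((n + 1 : ℕ) : ℝ) ^ r := by positivity
  rw [Real.rpow_neg (by positivity), ← div_eq_mul_inv, le_div_iff₀ h2]
  linarith

lemma summable_of_tendsto_rpow {a : ℕ → ℝ} (ha0 : ∀ n, 0 ≤ a n) {A : ℝ}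
    (h : Tendsto (fun n : ℕ => (n : ℝ) ^ (3 / 2 : ℝ) * a n) atTop (𝓝 A)) : Summable a := by
  obtain ⟨C, -, hC⟩ := exists_bound_of_tendsto h
  exact summable_of_rpow_bound ha0 (by norm_num) fun n _ => (le_abs_self _).trans (hC n)

/-- The convolution of two sequences asymptotic to multiples of `n ^ (-3/2)`. -/
lemma tendsto_conv {a b : ℕ → ℝ} (ha0 : ∀ n, 0 ≤ a n) (hb0 : ∀ n, 0 ≤ b n) {A B : ℝ}
    (ha : Tendsto (fun n : ℕ => (n : ℝ) ^ (3 / 2 : ℝ) * a n) atTop (𝓝 A))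
    (hb : Tendsto (fun n : ℕ => (n : ℝ) ^ (3 / 2 : ℝ) * b n) atTop (𝓝 B)) :
    Tendsto (fun n : ℕ => (n : ℝ) ^ (3 / 2 : ℝ) * ∑ j ∈ Finset.range (n + 1), a j * b (n - j))
      atTop (𝓝 ((∑' j, a j) * B + (∑' j, b j) * A)) := by
  have h1 := tendsto_half_conv (by norm_num) (summable_of_tendsto_rpow ha0 ha) ha0 hb
    (c := fun n => n / 2 + 1) (fun n j hj => by omega)
    (tendsto_atTop_mono (fun n => Nat.le_succ _) (Nat.tendsto_div_const_atTop (by norm_num)))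
  have h2 := tendsto_half_conv (by norm_num) (summable_of_tendsto_rpow hb0 hb) hb0 ha
    (c := fun n => n - n / 2) (fun n j hj => by omega)
    (tendsto_atTop_mono (fun n => by show n / 2 ≤ n - n / 2; omega)
      (Nat.tendsto_div_const_atTop (by norm_num)))
  refine (h1.add h2).congr fun n => ?_
  rw [← mul_add]
  congr 1
  rw [← Finset.sum_range_add_sum_Ico _ (show n / 2 + 1 ≤ n + 1 by omega)]
  congr 1
  refine Finset.sum_bij' (fun j _ => n - j) (fun j _ => n - j) ?_ ?_ ?_ ?_ ?_ <;>
    simp only [Finset.mem_range, Finset.mem_Ico] <;> intro j hj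
  · omega
  · omega
  · omega
  · omega
  · rw [mul_comm, Nat.sub_sub_self (by omega)]

lemma sum_inv_sqrt_le (n : ℕ) :
    ∑ i ∈ Finset.range n, ((i + 1 : ℕ) : ℝ) ^ (-(1 / 2) : ℝ) ≤ 2 * (n : ℝ) ^ (1 / 2 : ℝ) := by
  induction n with
  | zero => simp
  | succ n ih =>
    rw [Finset.sum_range_succ]
    refine (add_le_add_left ih _).trans ?_
    rw [Real.rpow_neg (by positivity), ← Real.sqrt_eq_rpow, ← Real.sqrt_eq_rpow]
    have h1 : 0 < √((n + 1 : ℕ) : ℝ) := Real.sqrt_pos.2 (by positivity)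
    have h2 := Real.sqrt_nonneg (n : ℝ)
    have h3 := Real.sq_sqrt (show (0:ℝ) ≤ ((n + 1 : ℕ) : ℝ) by positivity)
    have h4 := Real.sq_sqrt (show (0:ℝ) ≤ (n : ℝ) by positivity)
    rw [← sub_nonneg]
    have : 2 * √((n + 1 : ℕ) : ℝ) - (2 * √(n : ℝ) + (√((n + 1 : ℕ) : ℝ))⁻¹) =
        (√((n + 1 : ℕ) : ℝ) - √(n : ℝ)) ^ 2 / √((n + 1 : ℕ) : ℝ) := by
      field_simp
      push_cast at h3 ⊢
      nlinarith
    rw [this]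
    positivity

lemma sum_half_inv_sqrt_le {p w : ℕ → ℝ} (hp0 : ∀ n, 0 ≤ p n) {C : ℝ} (hC0 : 0 ≤ C)
    (hC : ∀ n : ℕ, 1 ≤ n → w n ≤ C * (n : ℝ) ^ (-(1 / 2) : ℝ)) {n : ℕ} {M : ℝ}
    (hM : ∀ j, n / 2 < j → j < n → p j ≤ M) (hM0 : 0 ≤ M) :
    ∑ j ∈ Finset.Ico (n / 2 + 1) n, p j * w (n - j) ≤ M * (2 * C * (n : ℝ) ^ (1 / 2 : ℝ)) := by
  have h1 : ∑ j ∈ Finset.Ico (n / 2 + 1) n, p j * w (n - j) ≤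
      ∑ j ∈ Finset.Ico (n / 2 + 1) n, M * (C * ((n - j : ℕ) : ℝ) ^ (-(1 / 2) : ℝ)) := by
    refine Finset.sum_le_sum fun j hj => ?_
    rw [Finset.mem_Ico] at hj
    refine (mul_le_mul_of_nonneg_left (hC (n - j) (by omega)) (hp0 j)).trans ?_
    exact mul_le_mul_of_nonneg_right (hM j (by omega) hj.2) (by positivity)
  have h2 : ∑ j ∈ Finset.Ico (n / 2 + 1) n, M * (C * ((n - j : ℕ) : ℝ) ^ (-(1 / 2) : ℝ)) ≤
      ∑ j ∈ Finset.range n, M * (C * ((n - j : ℕ) : ℝ) ^ (-(1 / 2) : ℝ)) := by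
    refine Finset.sum_le_sum_of_subset_of_nonneg (fun j hj => ?_) fun _ _ _ => by positivity
    simp only [Finset.mem_Ico, Finset.mem_range] at hj ⊢
    exact hj.2
  refine h1.trans (h2.trans ?_)
  rw [← Finset.sum_range_reflect]
  have h3 : ∀ j ∈ Finset.range n, M * (C * ((n - (n - 1 - j) : ℕ) : ℝ) ^ (-(1 / 2) : ℝ)) =
      M * C * ((j + 1 : ℕ) : ℝ) ^ (-(1 / 2) : ℝ) := fun j hj => by
    rw [Finset.mem_range] at hj
    rw [show n - (n - 1 - j) = j + 1 by omega]
    ring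
  rw [Finset.sum_congr rfl h3, ← Finset.mul_sum]
  refine (mul_le_mul_of_nonneg_left (sum_inv_sqrt_le n) (by positivity)).trans ?_
  exact le_of_eq (by ring)

/-- A renewal type recursion `n p_n = ∑ p_j w_{n-j}` with `w_n ~ L n ^ (-1/2)` forces
`p_n ~ (∑ p_j) L n ^ (-3/2)`. -/
lemma tendsto_of_recursion {p w : ℕ → ℝ} (hp0 : ∀ n, 0 ≤ p n) (hp1 : ∀ n, p n ≤ 1)
    (hw0 : ∀ n, 0 ≤ w n) {L : ℝ}
    (hrec : ∀ n : ℕ, (n : ℝ) * p n = ∑ j ∈ Finset.range n, p j * w (n - j))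
    (hw : Tendsto (fun n : ℕ => (n : ℝ) ^ (1 / 2 : ℝ) * w n) atTop (𝓝 L)) :
    Tendsto (fun n : ℕ => (n : ℝ) ^ (3 / 2 : ℝ) * p n) atTop (𝓝 ((∑' j, p j) * L)) := by
  obtain ⟨C, hC0, hC⟩ := exists_bound_of_tendsto hw
  have hC' : ∀ n : ℕ, 1 ≤ n → w n ≤ C * (n : ℝ) ^ (-(1 / 2) : ℝ) := fun n hn => by
    rw [Real.rpow_neg (by positivity), ← div_eq_mul_inv, le_div_iff₀ (by positivity), mul_comm]
    exact (le_abs_self _).trans (hC n)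
  have hsplit : ∀ n : ℕ, 1 ≤ n → (n : ℝ) * p n =
      ∑ j ∈ Finset.range (if n = 1 then 1 else n / 2 + 1), p j * w (n - j) +
        ∑ j ∈ Finset.Ico (n / 2 + 1) n, p j * w (n - j) := fun n hn => by
    rw [hrec n]
    split_ifs with h
    · subst h; simp
    · rw [Finset.sum_range_add_sum_Ico _ (by omega)]
  have hsmall : ∀ n : ℕ, 1 ≤ n → ∀ S, ∑ j ∈ Finset.range (n / 2 + 1), p j ≤ S →
      ∀ M, 0 ≤ M → (∀ j, n / 2 < j → j < n → p j ≤ M) →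
      (n : ℝ) * p n ≤ S * (2 * C * (n : ℝ) ^ (-(1 / 2) : ℝ)) +
        M * (2 * C * (n : ℝ) ^ (1 / 2 : ℝ)) := by
    intro n hn S hS M hM0 hM
    rw [hsplit n hn]
    refine add_le_add ?_ (sum_half_inv_sqrt_le hp0 hC0.le hC' hM hM0)
    have h1 : ∀ j ∈ Finset.range (if n = 1 then 1 else n / 2 + 1), p j * w (n - j) ≤
        p j * (2 * C * (n : ℝ) ^ (-(1 / 2) : ℝ)) := fun j hj => by
      rw [Finset.mem_range] at hj
      have hj' : n ≤ 4 * (n - j) ∧ 1 ≤ n - j := by split_ifs at hj <;> omega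
      refine mul_le_mul_of_nonneg_left ((hC' _ hj'.2).trans ?_) (hp0 j)
      rw [mul_comm 2 C, mul_assoc]
      refine mul_le_mul_of_nonneg_left ?_ hC0.le
      rw [Real.rpow_neg (by positivity), Real.rpow_neg (by positivity), ← Real.sqrt_eq_rpow,
        ← Real.sqrt_eq_rpow, ← div_eq_mul_inv]
      have hn' : (0 : ℝ) < n := by exact_mod_cast hn
      have hnj : (0 : ℝ) < (n - j : ℕ) := by exact_mod_cast hj'.2
      rw [le_div_iff₀ (by positivity), inv_mul_le_iff₀ (by positivity)]
      refine Real.sqrt_le_iff.2 ⟨by positivity, ?_⟩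
      rw [mul_pow, Real.sq_sqrt hnj.le]
      have : (n : ℝ) ≤ 4 * (n - j : ℕ) := by exact_mod_cast hj'.1
      linarith
    refine (Finset.sum_le_sum h1).trans ?_
    rw [← Finset.sum_mul]
    refine mul_le_mul_of_nonneg_right (le_trans ?_ hS) (by positivity)
    refine Finset.sum_le_sum_of_subset_of_nonneg (Finset.range_subset_range.2 ?_)
      fun j _ _ => hp0 j
    split_ifs <;> omega
  set Z := ∑' j : ℕ, (j : ℝ) ^ (-(5 / 4) : ℝ) with hZ
  have hZs : Summable fun j : ℕ => (j : ℝ) ^ (-(5 / 4) : ℝ) :=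
    Real.summable_nat_rpow.2 (by norm_num)
  have hZ0 : 0 ≤ Z := tsum_nonneg fun j => by positivity
  have hhalf : ∀ n j : ℕ, 1 ≤ n → n / 2 < j →
      (j : ℝ) ^ (-(5 / 4) : ℝ) ≤ 4 * (n : ℝ) ^ (-(5 / 4) : ℝ) := fun n j hn hj => by
    have h1 : (n : ℝ) / 2 ≤ j := by
      rw [div_le_iff₀ (by norm_num)]; exact_mod_cast (by omega : n ≤ j * 2)
    have hn' : (0 : ℝ) < n := by exact_mod_cast hn
    refine (Real.rpow_le_rpow_of_nonpos (by positivity) h1 (by norm_num)).trans ?_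
    rw [Real.div_rpow hn'.le (by norm_num), div_le_iff₀ (by positivity), mul_assoc, mul_comm _
      ((2 : ℝ) ^ _), ← mul_assoc]
    refine le_mul_of_one_le_left (by positivity) ?_
    calc (1 : ℝ) = 4 * 2 ^ (-2 : ℝ) := by
          rw [Real.rpow_neg (by norm_num)]; norm_num
      _ ≤ _ := by
          gcongr <;> norm_num
  obtain ⟨n₀, hn₀⟩ : ∃ n₀ : ℕ, ∀ n, n₀ ≤ n →
      2 * C * (1 + Z) + 8 * C ≤ (n : ℝ) ^ (1 / 4 : ℝ) := by
    have := ((tendsto_rpow_atTop (show (0 : ℝ) < 1 / 4 by norm_num)).comp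
      tendsto_natCast_atTop_atTop).eventually_ge_atTop (2 * C * (1 + Z) + 8 * C)
    exact eventually_atTop.1 this
  set K := max 1 ((n₀ : ℝ) ^ (5 / 4 : ℝ)) with hK
  have hK1 : 1 ≤ K := le_max_left _ _
  have hind : ∀ n : ℕ, 1 ≤ n → p n ≤ K * (n : ℝ) ^ (-(5 / 4) : ℝ) := by
    intro n
    induction n using Nat.strong_induction_on with
    | _ n ih =>
      intro hn
      have hn' : (0 : ℝ) < n := by exact_mod_cast hn
      rcases lt_or_ge n n₀ with h | h
      · refine (hp1 n).trans ?_
        rw [Real.rpow_neg hn'.le, ← div_eq_mul_inv, le_div_iff₀ (by positivity), one_mul]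
        refine le_trans ?_ (le_max_right _ _)
        gcongr
      · have hS : ∑ j ∈ Finset.range (n / 2 + 1), p j ≤ K * (1 + Z) := by
          rcases eq_or_lt_of_le hn with h1 | h1
          · subst h1
            have := hp1 0
            simp only [Finset.sum_range_succ]
            norm_num
            nlinarith
          rw [Finset.sum_range_succ', mul_add, mul_one, add_comm]
          refine add_le_add ((hp1 0).trans hK1) ?_
          calc ∑ j ∈ Finset.range (n / 2), p (j + 1)
              ≤ ∑ j ∈ Finset.range (n / 2), K * ((j + 1 : ℕ) : ℝ) ^ (-(5 / 4) : ℝ) :=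
                Finset.sum_le_sum fun j hj => ih (j + 1)
                  (by rw [Finset.mem_range] at hj; omega) (by omega)
            _ ≤ K * Z := by
                rw [← Finset.mul_sum]
                refine mul_le_mul_of_nonneg_left ?_ (by positivity)
                refine le_trans ?_ (hZs.sum_le_tsum (Finset.range (n / 2 + 1))
                  fun _ _ => by positivity)
                rw [Finset.sum_range_succ']
                exact le_add_of_nonneg_right (by positivity)
        have := hsmall n hn _ hS (K * (4 * (n : ℝ) ^ (-(5 / 4) : ℝ))) (by positivity)
          fun j hj hjn => (ih j hjn (by omega)).trans
            (mul_le_mul_of_nonneg_left (hhalf n j hn hj) (by positivity))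
        have h4 : (n : ℝ) ^ (-(5 / 4) : ℝ) * (n : ℝ) ^ (1 / 2 : ℝ) ≤
            (n : ℝ) ^ (-(1 / 2) : ℝ) := by
          rw [← Real.rpow_add hn']
          exact Real.rpow_le_rpow_of_exponent_le (by exact_mod_cast hn) (by norm_num)
        have h5 : (n : ℝ) * p n ≤
            K * (n : ℝ) ^ (-(1 / 2) : ℝ) * (2 * C * (1 + Z) + 8 * C) := by
          refine this.trans ?_
          have : K * (4 * (n : ℝ) ^ (-(5 / 4) : ℝ)) * (2 * C * (n : ℝ) ^ (1 / 2 : ℝ)) ≤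
              K * (8 * C) * (n : ℝ) ^ (-(1 / 2) : ℝ) := by
            calc _ = K * (8 * C) * ((n : ℝ) ^ (-(5 / 4) : ℝ) * (n : ℝ) ^ (1 / 2 : ℝ)) := by ring
              _ ≤ _ := by gcongr
          linarith
        have h6 : (n : ℝ) * p n ≤ K * (n : ℝ) ^ (-(1 / 2) : ℝ) * (n : ℝ) ^ (1 / 4 : ℝ) :=
          h5.trans (mul_le_mul_of_nonneg_left (hn₀ n h) (by positivity))
        rw [mul_assoc, ← Real.rpow_add hn'] at h6
        have h7 : (n : ℝ) * (n : ℝ) ^ (-(5 / 4) : ℝ) = (n : ℝ) ^ (-(1 / 2) + 1 / 4 : ℝ) := by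
          rw [← Real.rpow_one_add' hn'.le (by norm_num)]; norm_num
        rw [← h7] at h6
        refine le_of_mul_le_mul_left (h6.trans (le_of_eq ?_)) hn'
        ring
  have hps : Summable p := by
    refine summable_of_rpow_bound hp0 (r := 5 / 4) (C := K) (by norm_num) fun n hn => ?_
    have hn' : (0 : ℝ) < n := by exact_mod_cast hn
    refine (mul_le_mul_of_nonneg_left (hind n hn) (by positivity)).trans (le_of_eq ?_)
    rw [Real.rpow_neg hn'.le]
    field_simp
  have h1 := tendsto_half_conv (by norm_num) hps hp0 hw (c := fun n => if n = 1 then 1 else n / 2 + 1)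
    (fun n j hj => by split_ifs at hj <;> omega)
    (tendsto_atTop_mono (fun n => by show n / 2 ≤ _; split_ifs <;> omega)
      (Nat.tendsto_div_const_atTop (n := 2) (by norm_num)))
  have h2 : Tendsto (fun n : ℕ => (n : ℝ) ^ (1 / 2 : ℝ) *
      ∑ j ∈ Finset.Ico (n / 2 + 1) n, p j * w (n - j)) atTop (𝓝 0) := by
    refine squeeze_zero' (g := fun n : ℕ => 8 * C * K * (n : ℝ) ^ (-(1 / 4) : ℝ))
      (Eventually.of_forall fun n => mul_nonneg (by positivity)
        (Finset.sum_nonneg fun j _ => mul_nonneg (hp0 j) (hw0 _))) ?_ ?_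
    · filter_upwards [eventually_ge_atTop 1] with n hn
      have hn' : (0 : ℝ) < n := by exact_mod_cast hn
      refine (mul_le_mul_of_nonneg_left (sum_half_inv_sqrt_le hp0 hC0.le hC'
        (M := K * (4 * (n : ℝ) ^ (-(5 / 4) : ℝ))) (fun j hj _ => (hind j (by omega)).trans
          (mul_le_mul_of_nonneg_left (hhalf n j hn hj) (by positivity))) (by positivity))
        (by positivity)).trans (le_of_eq ?_)
      have : (n : ℝ) ^ (-(1 / 4) : ℝ) =
          (n : ℝ) ^ (1 / 2 : ℝ) * (n : ℝ) ^ (-(5 / 4) : ℝ) * (n : ℝ) ^ (1 / 2 : ℝ) := by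
        rw [← Real.rpow_add hn', ← Real.rpow_add hn']
        norm_num
      rw [this]
      ring
    · simpa using ((tendsto_rpow_neg_atTop (show (0 : ℝ) < 1 / 4 by norm_num)).comp
        tendsto_natCast_atTop_atTop).const_mul (8 * C * K)
  have h3 := h1.add h2
  rw [add_zero] at h3
  refine h3.congr' ?_
  filter_upwards [eventually_ge_atTop 1] with n hn
  have hn' : (0 : ℝ) < n := by exact_mod_cast hn
  rw [← mul_add, ← hsplit n hn, ← mul_assoc, ← Real.rpow_add_one hn'.ne']
  norm_num

/-! ### Characteristic functions of centred non-lattice laws -/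

section CharFun

variable {ν : Measure ℝ} [IsProbabilityMeasure ν] {σ : ℝ}

lemma charFun_taylor (hσ : 0 < σ) (h0 : ∫ x, x ∂ν = 0) (h2 : ∫ x, x ^ 2 ∂ν = σ ^ 2) :
    (fun t ↦ charFun ν (σ⁻¹ * t) - (1 - t ^ 2 / 2)) =o[𝓝 0] fun t : ℝ ↦ t ^ 2 := by
  have := taylor_charFun_two (P := ν) (X := fun x => σ⁻¹ * x) (by fun_prop)
    (by rw [integral_const_mul, h0, mul_zero])
    (by
      simp only [Pi.pow_apply, mul_pow]
      rw [integral_const_mul, h2]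
      field_simp)
  simpa only [charFun_map_mul] using this

lemma tendsto_charFun_pow (hσ : 0 < σ) (h0 : ∫ x, x ∂ν = 0) (h2 : ∫ x, x ^ 2 ∂ν = σ ^ 2) (u : ℝ) :
    Tendsto (fun n : ℕ => charFun ν ((√n)⁻¹ * u) ^ n) atTop
      (𝓝 (Complex.exp ((-(σ ^ 2 / 2) * u ^ 2 : ℝ)))) := by
  have := tendsto_charFun_inv_sqrt_mul_pow (P := ν) (X := fun x => σ⁻¹ * x) (by fun_prop)
    (by rw [integral_const_mul, h0, mul_zero])
    (by
      simp only [Pi.pow_apply, mul_pow]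
      rw [integral_const_mul, h2]
      field_simp) (σ * u)
  simp only [charFun_map_mul] at this
  convert this using 3 with n
  · congr 1; field_simp
  · push_cast; ring

lemma exists_norm_charFun_le (hσ : 0 < σ) (h0 : ∫ x, x ∂ν = 0) (h2 : ∫ x, x ^ 2 ∂ν = σ ^ 2) :
    ∃ δ > 0, ∃ c > 0, ∀ u : ℝ, |u| ≤ δ → ‖charFun ν u‖ ≤ Real.exp (-c * u ^ 2) := by
  have h := (charFun_taylor hσ h0 h2).def (show (0 : ℝ) < 1 / 4 by norm_num)
  obtain ⟨ε, hε, hb⟩ := Metric.eventually_nhds_iff.1 h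
  refine ⟨min (ε / 2) 1 / σ, by positivity, σ ^ 2 / 4, by positivity, fun u hu => ?_⟩
  rw [le_div_iff₀ hσ] at hu
  have hu' : |σ * u| ≤ min (ε / 2) 1 := by rw [abs_mul, abs_of_pos hσ, mul_comm]; exact hu
  have h3 := hb (y := σ * u) (by
    rw [Real.dist_eq, sub_zero]
    exact (hu'.trans (min_le_left _ _)).trans_lt (by linarith))
  rw [show σ⁻¹ * (σ * u) = u by field_simp] at h3
  have h4 : (σ * u) ^ 2 ≤ 1 := by
    rw [← sq_abs]
    exact pow_le_one₀ (abs_nonneg _) (hu'.trans (min_le_right _ _))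
  have h5 : ‖(1 - ((σ * u : ℝ) : ℂ) ^ 2 / 2 : ℂ)‖ = 1 - (σ * u) ^ 2 / 2 := by
    rw [← Complex.ofReal_one, show ((1 : ℝ) : ℂ) - ((σ * u : ℝ) : ℂ) ^ 2 / 2 =
      ((1 - (σ * u) ^ 2 / 2 : ℝ) : ℂ) by push_cast; ring, Complex.norm_real,
      Real.norm_of_nonneg (by linarith)]
  have h6 := norm_le_insert' (charFun ν u) (1 - ((σ * u : ℝ) : ℂ) ^ 2 / 2)
  rw [h5] at h6
  rw [Real.norm_of_nonneg (sq_nonneg _)] at h3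
  have h7 := Real.add_one_le_exp (-(σ ^ 2 / 4) * u ^ 2)
  nlinarith

lemma norm_charFun_lt_one (hnl : NonLattice ν) {θ : ℝ} (hθ : θ ≠ 0) : ‖charFun ν θ‖ < 1 := by
  refine lt_of_le_of_ne (norm_charFun_le_one θ) fun h => hnl ?_
  set ψ := Complex.arg (charFun ν θ) with hψ
  have h1 : charFun ν θ = Complex.exp (ψ * Complex.I) := by
    have := Complex.norm_mul_exp_arg_mul_I (charFun ν θ)
    rw [h] at this
    simpa using this.symm
  have hint : Integrable (fun x : ℝ => Complex.exp ((θ * x : ℝ) * Complex.I)) ν :=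
    Integrable.of_bound (by fun_prop) 1 (Eventually.of_forall fun x => by
      rw [Complex.norm_exp_ofReal_mul_I])
  have h2 : ∫ x, (1 - Real.cos (θ * x - ψ)) ∂ν = 0 := by
    have h3 : ∫ x, Complex.exp ((θ * x : ℝ) * Complex.I) * Complex.exp (-ψ * Complex.I) ∂ν = 1 := by
      rw [integral_mul_const]
      have : ∫ x, Complex.exp ((θ * x : ℝ) * Complex.I) ∂ν = charFun ν θ := by
        rw [charFun_apply_real]
        simp
      rw [this, h1, ← Complex.exp_add]
      simp
    have h4 := congrArg Complex.re h3
    rw [← RCLike.re_eq_complex_re, ← integral_re (hint.mul_const _)] at h4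
    rw [integral_sub (integrable_const _)]
    · rw [RCLike.re_eq_complex_re] at h4
      have h5 : ∀ x : ℝ, (Complex.exp ((θ * x : ℝ) * Complex.I) *
          Complex.exp (-ψ * Complex.I)).re = Real.cos (θ * x - ψ) := fun x => by
        rw [← Complex.exp_add, ← add_mul, show ((θ * x : ℝ) : ℂ) + -ψ = ((θ * x - ψ : ℝ) : ℂ) by
          push_cast; ring, Complex.exp_ofReal_mul_I_re]
      simp only [h5] at h4
      simp [h4]
    · exact Integrable.of_bound (by fun_prop) 1 (Eventually.of_forall fun x => Real.abs_cos_le_one _)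
  rw [integral_eq_zero_iff_of_nonneg (fun x => sub_nonneg.2 (Real.cos_le_one _))] at h2
  · refine ⟨ψ / θ, 2 * Real.pi / θ, ?_⟩
    refine (prob_compl_eq_zero_iff₀ ?_).1 (measure_mono_null ?_ (ae_iff.1 h2))
    · rw [show {x : ℝ | ∃ k : ℤ, x = ψ / θ + k * (2 * Real.pi / θ)} =
        Set.range fun k : ℤ => ψ / θ + k * (2 * Real.pi / θ) by ext x; simp [eq_comm]]
      exact (countable_range _).measurableSet.nullMeasurableSet
    · intro x hx hx2
      refine hx ?_
      simp only [Pi.zero_apply] at hx2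
      obtain ⟨k, hk⟩ := (Real.cos_eq_one_iff _).1 (sub_eq_zero.1 hx2).symm
      refine ⟨k, ?_⟩
      field_simp
      linarith
  · exact (integrable_const _).sub
      (Integrable.of_bound (by fun_prop) 1 (Eventually.of_forall fun x => Real.abs_cos_le_one _))

/-- Laplace's method for powers of a characteristic function. -/
lemma tendsto_sqrt_mul_integral_charFun (hσ : 0 < σ) (h0 : ∫ x, x ∂ν = 0)
    (h2 : ∫ x, x ^ 2 ∂ν = σ ^ 2) (hnl : NonLattice ν) {g : ℝ → ℂ} (hg : Continuous g)
    (hgc : HasCompactSupport g) :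
    Tendsto (fun n : ℕ => (√n : ℂ) * ∫ θ, g θ * charFun ν θ ^ n) atTop
      (𝓝 (g 0 * (√(2 * Real.pi) / σ : ℝ))) := by
  obtain ⟨δ, hδ, c, hc, hφ⟩ := exists_norm_charFun_le hσ h0 h2
  obtain ⟨M, hM⟩ := hg.bounded_above_of_compact_support hgc
  have hφc : Continuous (charFun ν) := continuous_charFun
  have hint : ∀ n : ℕ, Integrable fun θ => g θ * charFun ν θ ^ n := fun n =>
    (hg.mul (hφc.pow n)).integrable_of_hasCompactSupport hgc.mul_right
  set I := Icc (-δ) δ with hI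
  have hnear : Tendsto (fun n : ℕ => (√n : ℂ) * ∫ θ in I, g θ * charFun ν θ ^ n) atTop
      (𝓝 (g 0 * (√(2 * Real.pi) / σ : ℝ))) := by
    have h3 : Tendsto (fun n : ℕ => ∫ u : ℝ,
        I.indicator (fun θ => g θ * charFun ν θ ^ n) ((√n)⁻¹ * u)) atTop
        (𝓝 (∫ u : ℝ, g 0 * Complex.exp ((-(σ ^ 2 / 2) * u ^ 2 : ℝ)))) := by
      refine tendsto_integral_filter_of_dominated_convergence
        (fun u => M * Real.exp (-c * u ^ 2)) ?_ ?_ ?_ ?_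
      · exact Eventually.of_forall fun n => (((hg.mul (hφc.pow n)).measurable.indicator
          measurableSet_Icc).comp (measurable_const_mul (√n : ℝ)⁻¹)).aestronglyMeasurable
      · filter_upwards [eventually_gt_atTop 0] with n hn
        refine Eventually.of_forall fun u => ?_
        have hn' : (0 : ℝ) < n := by exact_mod_cast hn
        have hM0 : 0 ≤ M := (norm_nonneg _).trans (hM 0)
        rw [indicator_apply]
        split_ifs with h
        · rw [norm_mul, norm_pow]
          refine mul_le_mul (hM _) ?_ (by positivity) hM0
          refine (pow_le_pow_left₀ (norm_nonneg _) (hφ _ (abs_le.2 h)) n).trans (le_of_eq ?_)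
          rw [← Real.exp_nat_mul, mul_pow, inv_pow, Real.sq_sqrt hn'.le]
          congr 1
          field_simp
        · rw [norm_zero]; positivity
      · exact (integrable_exp_neg_mul_sq hc).const_mul M
      · refine Eventually.of_forall fun u => ?_
        have h4 : Tendsto (fun n : ℕ => (√n)⁻¹ * u) atTop (𝓝 0) := by
          rw [← zero_mul u]
          exact (tendsto_inv_atTop_zero.comp (Real.tendsto_sqrt_atTop.comp
            tendsto_natCast_atTop_atTop)).mul_const u
        have h5 := ((hg.tendsto 0).comp h4).mul (tendsto_charFun_pow hσ h0 h2 u)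
        refine h5.congr' ?_
        filter_upwards [h4 (Icc_mem_nhds (show -δ < 0 by linarith) hδ)] with n hn
        rw [indicator_of_mem (by exact hn)]
        rfl
    rw [integral_const_mul] at h3
    have h6 : ∫ u : ℝ, Complex.exp ((-(σ ^ 2 / 2) * u ^ 2 : ℝ)) = (√(2 * Real.pi) / σ : ℝ) := by
      simp_rw [← Complex.ofReal_exp]
      rw [integral_complex_ofReal, integral_gaussian]
      congr 1
      rw [show Real.pi / (σ ^ 2 / 2) = 2 * Real.pi / σ ^ 2 by field_simp,
        Real.sqrt_div (by positivity), Real.sqrt_sq hσ.le]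
    rw [h6] at h3
    refine h3.congr fun n => ?_
    rw [Measure.integral_comp_mul_left, inv_inv, abs_of_nonneg (Real.sqrt_nonneg _),
      integral_indicator measurableSet_Icc]
    simp [hI]
  have hfar : Tendsto (fun n : ℕ => (√n : ℂ) * ∫ θ in Iᶜ, g θ * charFun ν θ ^ n) atTop (𝓝 0) := by
    obtain ⟨q, hq1, hq0, hq⟩ : ∃ q < 1, 0 ≤ q ∧ ∀ θ ∈ Iᶜ ∩ tsupport g, ‖charFun ν θ‖ ≤ q := by
      have hK : IsCompact ({θ : ℝ | δ ≤ |θ|} ∩ tsupport g) :=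
        hgc.isCompact.inter_left (isClosed_le continuous_const continuous_abs)
      have hsub : Iᶜ ∩ tsupport g ⊆ {θ : ℝ | δ ≤ |θ|} ∩ tsupport g := fun θ hθ =>
        ⟨(not_le.1 fun h => hθ.1 (abs_le.1 h)).le, hθ.2⟩
      rcases ({θ : ℝ | δ ≤ |θ|} ∩ tsupport g).eq_empty_or_nonempty with he | hne
      · exact ⟨0, by norm_num, le_rfl, fun θ hθ => by have := hsub hθ; rw [he] at this; exact this.elim⟩
      · obtain ⟨θ₀, hθ₀, hmax⟩ := hK.exists_isMaxOn hne hφc.norm.continuousOn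
        refine ⟨_, norm_charFun_lt_one hnl (θ := θ₀) ?_, norm_nonneg _, fun θ hθ => hmax (hsub hθ)⟩
        rintro rfl
        have := hθ₀.1
        simp only [mem_ofPred_eq, abs_zero] at this
        linarith
    have hb : ∀ n : ℕ, ‖(√n : ℂ) * ∫ θ in Iᶜ, g θ * charFun ν θ ^ n‖ ≤
        (n * q ^ n) * ∫ θ in Iᶜ, ‖g θ‖ := fun n => by
      rw [norm_mul, Complex.norm_real, Real.norm_of_nonneg (Real.sqrt_nonneg _), mul_assoc]
      refine mul_le_mul ?_ ?_ (norm_nonneg _) (by positivity)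
      · refine Real.sqrt_le_iff.2 ⟨by positivity, ?_⟩
        exact_mod_cast Nat.le_self_pow (by norm_num) n
      · rw [← integral_const_mul]
        refine norm_integral_le_of_norm_le
          (((hg.integrable_of_hasCompactSupport hgc).norm.const_mul _).integrableOn) ?_
        refine (ae_restrict_iff' measurableSet_Icc.compl).2 (Eventually.of_forall fun θ hθ => ?_)
        rw [norm_mul, norm_pow, mul_comm]
        by_cases hs : θ ∈ tsupport g
        · gcongr; exact hq θ ⟨hθ, hs⟩
        · rw [image_eq_zero_of_notMem_tsupport hs]; simp
    refine squeeze_zero_norm hb ?_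
    have := (tendsto_self_mul_const_pow_of_lt_one hq0 hq1).mul_const (∫ θ in Iᶜ, ‖g θ‖)
    rwa [zero_mul] at this
  have := hnear.add hfar
  rw [add_zero] at this
  refine this.congr fun n => ?_
  rw [← mul_add, integral_add_compl measurableSet_Icc (hint n)]

end CharFun

/-! ### A positive kernel with compactly supported spectrum -/

/-- The triangle function. -/
def triFun (θ : ℝ) : ℝ := max (1 - |θ|) 0

/-- The spectrum of `smoothKer`. -/
def specFun (θ : ℝ) : ℂ := triFun θ * (1 + Complex.exp (-(θ * Complex.I)))

/-- A strictly positive integrable kernel whose Fourier transform has compact support. -/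
def smoothKer (x : ℝ) : ℝ := Real.sinc (x / 2) ^ 2 + Real.sinc ((x - 1) / 2) ^ 2

lemma continuous_triFun : Continuous triFun := by unfold triFun; fun_prop

lemma triFun_eq_zero {θ : ℝ} (h : θ ∉ Icc (-1 : ℝ) 1) : triFun θ = 0 := by
  have : 1 < |θ| := not_le.1 fun h' => h (abs_le.1 h')
  exact max_eq_right (by linarith)

lemma continuous_specFun : Continuous specFun := by
  have := continuous_triFun
  unfold specFun; fun_prop

lemma hasCompactSupport_specFun : HasCompactSupport specFun :=
  HasCompactSupport.intro (isCompact_Icc (a := (-1 : ℝ)) (b := 1)) fun θ h => by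
    simp [specFun, triFun_eq_zero h]

lemma specFun_zero : specFun 0 = 2 := by
  norm_num [specFun, triFun]

lemma sq_mul_sinc_sq (x : ℝ) : x ^ 2 * Real.sinc (x / 2) ^ 2 = 2 * (1 - Real.cos x) := by
  rcases eq_or_ne x 0 with rfl | hx
  · simp
  · rw [Real.sinc_of_ne_zero (by positivity)]
    have := Real.cos_sq' (x / 2)
    have h2 := Real.cos_two_mul (x / 2)
    rw [show 2 * (x / 2) = x by ring] at h2
    rw [h2, this]
    field_simp
    ring

lemma integral_triFun_mul_exp (x : ℝ) :
    ∫ θ, (triFun θ : ℂ) * Complex.exp (θ * x * Complex.I) = (Real.sinc (x / 2) ^ 2 : ℝ) := by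
  have hc : Continuous fun θ : ℝ => (triFun θ : ℂ) * Complex.exp (θ * x * Complex.I) := by
    have := continuous_triFun
    fun_prop
  have h1 : ∫ θ, (triFun θ : ℂ) * Complex.exp (θ * x * Complex.I) =
      ∫ θ in (-1 : ℝ)..1, (triFun θ : ℂ) * Complex.exp (θ * x * Complex.I) := by
    rw [intervalIntegral.integral_of_le (by norm_num), ← integral_Icc_eq_integral_Ioc,
      setIntegral_eq_integral_of_forall_compl_eq_zero]
    intro θ hθ
    simp [triFun_eq_zero hθ]
  have h2 : ∫ θ in (-1 : ℝ)..0, (triFun θ : ℂ) * Complex.exp (θ * x * Complex.I) =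
      ∫ θ in (-1 : ℝ)..0, (1 + θ : ℂ) * Complex.exp (θ * x * Complex.I) := by
    refine intervalIntegral.integral_congr fun θ hθ => ?_
    rw [uIcc_of_le (by norm_num)] at hθ
    simp only [triFun, abs_of_nonpos hθ.2, sub_neg_eq_add]
    rw [max_eq_left (by linarith [hθ.1])]
    push_cast; ring
  have h3 : ∫ θ in (0 : ℝ)..1, (triFun θ : ℂ) * Complex.exp (θ * x * Complex.I) =
      ∫ θ in (0 : ℝ)..1, (1 - θ : ℂ) * Complex.exp (θ * x * Complex.I) := by
    refine intervalIntegral.integral_congr fun θ hθ => ?_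
    rw [uIcc_of_le (by norm_num)] at hθ
    simp only [triFun, abs_of_nonneg hθ.1]
    rw [max_eq_left (by linarith [hθ.2])]
    push_cast; ring
  rw [h1, ← intervalIntegral.integral_add_adjacent_intervals (b := 0)
    (hc.intervalIntegrable _ _) (hc.intervalIntegrable _ _), h2, h3]
  rcases eq_or_ne x 0 with rfl | hx
  · have h4 : ∫ θ in (-1 : ℝ)..0, (1 + θ : ℂ) = 1 / 2 := by
      have : ∀ θ : ℝ, (1 + θ : ℂ) = ((1 + θ : ℝ) : ℂ) := fun θ => by push_cast; rfl
      simp_rw [this]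
      rw [intervalIntegral.integral_ofReal, intervalIntegral.integral_add
        (Continuous.intervalIntegrable (by fun_prop) _ _)
        (Continuous.intervalIntegrable (by fun_prop) _ _)]
      simp
      norm_num
    have h5 : ∫ θ in (0 : ℝ)..1, (1 - θ : ℂ) = 1 / 2 := by
      have : ∀ θ : ℝ, (1 - θ : ℂ) = ((1 - θ : ℝ) : ℂ) := fun θ => by push_cast; rfl
      simp_rw [this]
      rw [intervalIntegral.integral_ofReal, intervalIntegral.integral_sub
        (Continuous.intervalIntegrable (by fun_prop) _ _)
        (Continuous.intervalIntegrable (by fun_prop) _ _)]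
      simp
      norm_num
    simp only [Complex.ofReal_zero, mul_zero, zero_mul, Complex.exp_zero, mul_one, h4, h5]
    norm_num
  · have hx' : (x : ℂ) ≠ 0 := by simpa using hx
    have hd : ∀ θ : ℝ, HasDerivAt (fun θ : ℝ => Complex.exp (θ * x * Complex.I))
        (Complex.exp (θ * x * Complex.I) * (x * Complex.I)) θ := fun θ => by
      have := ((Complex.ofRealCLM.hasDerivAt (x := θ)).mul_const (x * Complex.I : ℂ)).cexp
      simpa [mul_assoc] using this
    have h4 : ∫ θ in (-1 : ℝ)..0, (1 + θ : ℂ) * Complex.exp (θ * x * Complex.I) =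
        (1 / (x * Complex.I) - 1 / (x * Complex.I) ^ 2) +
          Complex.exp (-x * Complex.I) / (x * Complex.I) ^ 2 := by
      rw [intervalIntegral.integral_eq_sub_of_hasDerivAt (f := fun θ : ℝ =>
        (1 + θ : ℂ) * Complex.exp (θ * x * Complex.I) / (x * Complex.I) -
          Complex.exp (θ * x * Complex.I) / (x * Complex.I) ^ 2) ?_
        (Continuous.intervalIntegrable (by fun_prop) _ _)]
      · simp
      · intro θ _
        have := (((Complex.ofRealCLM.hasDerivAt (x := θ)).const_add 1).mul (hd θ)).div_const
          (x * Complex.I) |>.sub ((hd θ).div_const ((x * Complex.I) ^ 2))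
        refine this.congr_deriv ?_
        simp only [Complex.ofRealCLM_apply, Complex.ofReal_one]
        field_simp
        ring
    have h5 : ∫ θ in (0 : ℝ)..1, (1 - θ : ℂ) * Complex.exp (θ * x * Complex.I) =
        Complex.exp (x * Complex.I) / (x * Complex.I) ^ 2 -
          (1 / (x * Complex.I) + 1 / (x * Complex.I) ^ 2) := by
      rw [intervalIntegral.integral_eq_sub_of_hasDerivAt (f := fun θ : ℝ =>
        (1 - θ : ℂ) * Complex.exp (θ * x * Complex.I) / (x * Complex.I) +
          Complex.exp (θ * x * Complex.I) / (x * Complex.I) ^ 2) ?_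
        (Continuous.intervalIntegrable (by fun_prop) _ _)]
      · simp
      · intro θ _
        have := (((Complex.ofRealCLM.hasDerivAt (x := θ)).const_sub 1).mul (hd θ)).div_const
          (x * Complex.I) |>.add ((hd θ).div_const ((x * Complex.I) ^ 2))
        refine this.congr_deriv ?_
        simp only [Complex.ofRealCLM_apply, Complex.ofReal_one]
        field_simp
        ring
    rw [h4, h5]
    have h6 := sq_mul_sinc_sq x
    have h7 : Real.sinc (x / 2) ^ 2 = 2 * (1 - Real.cos x) / x ^ 2 := by
      rw [← h6]; field_simp
    rw [h7, mul_pow, Complex.I_sq]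
    have h8 : Complex.exp (x * Complex.I) + Complex.exp (-x * Complex.I) = 2 * Real.cos x := by
      rw [Complex.ofReal_cos, Complex.cos]; ring
    have h9 : ∀ a b : ℂ, 1 / (x * Complex.I) - 1 / (x ^ 2 * -1) + a / (x ^ 2 * -1) +
        (b / (x ^ 2 * -1) - (1 / (x * Complex.I) + 1 / (x ^ 2 * -1))) =
          (2 - (b + a)) / x ^ 2 := fun a b => by
      field_simp
      ring
    rw [h9, h8]
    push_cast
    ring

lemma integral_specFun_mul_exp (x : ℝ) :
    ∫ θ, specFun θ * Complex.exp (θ * x * Complex.I) = smoothKer x := by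
  have hc : ∀ x : ℝ, Integrable fun θ : ℝ => (triFun θ : ℂ) * Complex.exp (θ * x * Complex.I) :=
    fun x => by
      have := continuous_triFun
      refine Continuous.integrable_of_hasCompactSupport (by fun_prop) ?_
      exact HasCompactSupport.intro (isCompact_Icc (a := (-1 : ℝ)) (b := 1)) fun θ h => by
        simp [triFun_eq_zero h]
  have h : ∀ θ : ℝ, specFun θ * Complex.exp (θ * x * Complex.I) =
      (triFun θ : ℂ) * Complex.exp (θ * x * Complex.I) +
        (triFun θ : ℂ) * Complex.exp (θ * (x - 1 : ℝ) * Complex.I) := fun θ => by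
    rw [specFun, mul_assoc, add_mul, mul_add, ← Complex.exp_add, one_mul]
    congr 3
    push_cast; ring
  simp_rw [h]
  rw [integral_add (hc _) (hc _), integral_triFun_mul_exp, integral_triFun_mul_exp, smoothKer]
  push_cast; rfl

lemma continuous_smoothKer : Continuous smoothKer := by
  unfold smoothKer
  have := Real.continuous_sinc
  fun_prop

lemma smoothKer_lower : ∃ c > 0, ∀ x, c ≤ smoothKer x * (1 + |x|) ^ 2 := by
  refine ⟨2 * (2 - 2 * Real.cos (1 / 2)), ?_, fun x => ?_⟩
  · have : Real.cos (1 / 2) < 1 := by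
      have := Real.cos_lt_cos_of_nonneg_of_le_pi_div_two (x := 0) (y := 1 / 2) le_rfl
        (by linarith [Real.pi_gt_three]) (by norm_num)
      simpa using this
    linarith
  · have h1 := sq_mul_sinc_sq x
    have h2 := sq_mul_sinc_sq (x - 1)
    have h3 : x ^ 2 ≤ (1 + |x|) ^ 2 := by
      rw [← sq_abs]; gcongr; linarith
    have h4 : (x - 1) ^ 2 ≤ (1 + |x|) ^ 2 := by
      rw [← sq_abs (x - 1)]
      gcongr
      have := abs_sub x 1
      rw [abs_one] at this
      linarith
    have h5 : Real.cos x + Real.cos (x - 1) ≤ 2 * Real.cos (1 / 2) := by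
      rw [Real.cos_add_cos, show (x - (x - 1)) / 2 = 1 / 2 by ring]
      have h6 : 0 < Real.cos (1 / 2) := Real.cos_pos_of_mem_Ioo
        ⟨by linarith [Real.pi_gt_three], by linarith [Real.pi_gt_three]⟩
      nlinarith [Real.cos_le_one ((x + (x - 1)) / 2)]
    rw [smoothKer]
    nlinarith [mul_le_mul_of_nonneg_right h3 (sq_nonneg (Real.sinc (x / 2))),
      mul_le_mul_of_nonneg_right h4 (sq_nonneg (Real.sinc ((x - 1) / 2)))]

lemma smoothKer_pos (x : ℝ) : 0 < smoothKer x := by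
  obtain ⟨c, hc, h⟩ := smoothKer_lower
  exact pos_of_mul_pos_left (hc.trans_le (h x)) (by positivity)

lemma integrable_smoothKer : Integrable smoothKer := by
  have h0 : Integrable fun x : ℝ => Real.sinc (x / 2) ^ 2 := by
    refine (integrable_inv_one_add_sq.const_mul 5).mono'
      (by have := Real.continuous_sinc; exact Continuous.aestronglyMeasurable (by fun_prop))
      (Eventually.of_forall fun x => ?_)
    rw [Real.norm_of_nonneg (sq_nonneg _), ← div_eq_mul_inv, le_div_iff₀ (by positivity)]
    have h1 := sq_mul_sinc_sq x
    have h2 : Real.sinc (x / 2) ^ 2 ≤ 1 := by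
      rw [← sq_abs]
      exact pow_le_one₀ (abs_nonneg _) (Real.abs_sinc_le_one _)
    nlinarith [Real.neg_one_le_cos x]
  have h1 := h0.comp_sub_right 1
  exact h0.add h1

lemma integral_smoothKer_mul_exp (τ : ℝ) :
    ∫ x, (smoothKer x : ℂ) * Complex.exp (τ * x * Complex.I) = 2 * Real.pi * specFun (-τ) := by
  have hF : ∀ y : ℝ, FourierTransform.fourier specFun y = smoothKer (-(2 * Real.pi) * y) := fun y => by
    rw [Real.fourier_real_eq_integral_exp_smul, ← integral_specFun_mul_exp]
    refine integral_congr_ae (Eventually.of_forall fun θ => ?_)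
    simp only [smul_eq_mul]
    rw [mul_comm]
    congr 2
    push_cast; ring
  have hi : Integrable (FourierTransform.fourier specFun) := by
    rw [show FourierTransform.fourier specFun = fun y => (smoothKer (-(2 * Real.pi) * y) : ℂ) from
      funext hF]
    exact (integrable_smoothKer.comp_mul_left' (by simp [Real.pi_ne_zero])).ofReal
  have := congrFun (continuous_specFun.fourierInv_fourier_eq
    (continuous_specFun.integrable_of_hasCompactSupport hasCompactSupport_specFun) hi) (-τ)
  rw [Real.fourierInv_eq_fourier_neg, Real.fourier_real_eq_integral_exp_smul, neg_neg] at this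
  rw [← this]
  simp_rw [hF]
  have h2 := Measure.integral_comp_mul_left
    (fun x : ℝ => (smoothKer x : ℂ) * Complex.exp (τ * x * Complex.I)) (-(2 * Real.pi))
  have h3 : |(-(2 * Real.pi))⁻¹| = (2 * Real.pi)⁻¹ := by
    rw [abs_inv, abs_neg, abs_of_pos (by positivity)]
  rw [h3, eq_comm, inv_smul_eq_iff₀ (α := ℝ) (by positivity)] at h2
  rw [h2, Complex.real_smul]
  push_cast
  congr 1
  refine integral_congr_ae (Eventually.of_forall fun y => ?_)
  simp only [smul_eq_mul]
  rw [mul_comm]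
  congr 2
  ring

/-! ### Restricting weak limits to half-lines -/

lemma tendsto_setIntegral_Ici {m : ℕ → Measure ℝ} {M : Measure ℝ} [∀ n, IsFiniteMeasure (m n)]
    [IsFiniteMeasure M]
    (h : ∀ f : ℝ → ℝ, Continuous f → (∃ C, ∀ x, |f x| ≤ C) →
      Tendsto (fun n => ∫ x, f x ∂m n) atTop (𝓝 (∫ x, f x ∂M)))
    {a : ℝ} (ha : M {a} = 0) {f : ℝ → ℝ} (hf : Continuous f) (hb : ∃ C, ∀ x, |f x| ≤ C) :
    Tendsto (fun n => ∫ x in Ici a, f x ∂m n) atTop (𝓝 (∫ x in Ici a, f x ∂M)) := by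
  obtain ⟨C, hC⟩ := hb
  have hC0 : 0 ≤ C := (abs_nonneg _).trans (hC 0)
  set up : ℕ → ℝ → ℝ := fun k x => max 0 (min 1 (1 + k * (x - a))) with hup
  set dn : ℕ → ℝ → ℝ := fun k x => max 0 (min 1 (k * (x - a))) with hdn
  have hupc : ∀ k, Continuous (up k) := fun k => by fun_prop
  have hdnc : ∀ k, Continuous (dn k) := fun k => by fun_prop
  have hup1 : ∀ k x, |up k x| ≤ 1 := fun k x => by
    rw [abs_of_nonneg (le_max_left _ _)]
    exact max_le zero_le_one (min_le_left _ _)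
  have hdn1 : ∀ k x, |dn k x| ≤ 1 := fun k x => by
    rw [abs_of_nonneg (le_max_left _ _)]
    exact max_le zero_le_one (min_le_left _ _)
  have hle : ∀ k x, dn k x ≤ up k x := fun k x =>
    max_le_max le_rfl (min_le_min le_rfl (by linarith))
  have hlim : Tendsto (fun k => ∫ x, (up k x - dn k x) ∂M) atTop (𝓝 0) := by
    have h1 : Tendsto (fun k => ∫ x, (up k x - dn k x) ∂M) atTop (𝓝 (∫ _, (0 : ℝ) ∂M)) := by
      refine tendsto_integral_of_dominated_convergence (fun _ => 2)
        (fun k => ((hupc k).sub (hdnc k)).aestronglyMeasurable) (integrable_const _)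
        (fun k => Eventually.of_forall fun x => ?_) ?_
      · rw [Real.norm_eq_abs]
        refine (abs_sub _ _).trans ?_
        linarith [hup1 k x, hdn1 k x]
      · have : ∀ᵐ x ∂M, x ≠ a := by rw [ae_iff]; simpa using ha
        filter_upwards [this] with x hx
        refine tendsto_const_nhds.congr' ?_
        obtain ⟨k₀, hk₀⟩ := exists_nat_ge (1 / |x - a|)
        have hxa : 0 < |x - a| := abs_pos.2 (sub_ne_zero.2 hx)
        filter_upwards [eventually_ge_atTop k₀] with k hk
        have hk1 : 1 ≤ k * |x - a| := by
          rw [div_le_iff₀ hxa] at hk₀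
          refine hk₀.trans ?_
          gcongr
        simp only [hup, hdn]
        rcases lt_or_gt_of_ne hx with hlt | hgt
        · rw [abs_of_neg (by linarith)] at hk1
          rw [max_eq_left ((min_le_right _ _).trans (by linarith)),
            max_eq_left ((min_le_right _ _).trans (by linarith)), sub_zero]
        · rw [abs_of_pos (by linarith)] at hk1
          rw [min_eq_left (by linarith), min_eq_left hk1]
          simp
    simpa using h1
  have hdiff : ∀ (μ' : Measure ℝ) [IsFiniteMeasure μ'] (k : ℕ),
      |∫ x in Ici a, f x ∂μ' - ∫ x, f x * dn k x ∂μ'| ≤ C * ∫ x, (up k x - dn k x) ∂μ' := by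
    intro μ' _ k
    have hi1 : Integrable (fun x => f x * dn k x) μ' :=
      Integrable.of_bound (hf.mul (hdnc k)).aestronglyMeasurable (C * 1)
        (Eventually.of_forall fun x => by
          rw [Real.norm_eq_abs, abs_mul]; exact mul_le_mul (hC x) (hdn1 k x) (abs_nonneg _) hC0)
    have hi2 : Integrable f μ' := Integrable.of_bound hf.aestronglyMeasurable C
      (Eventually.of_forall hC)
    have hi3 : Integrable (fun x => up k x - dn k x) μ' :=
      (Integrable.of_bound (hupc k).aestronglyMeasurable 1 (Eventually.of_forall (hup1 k))).sub
        (Integrable.of_bound (hdnc k).aestronglyMeasurable 1 (Eventually.of_forall (hdn1 k)))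
    rw [← integral_indicator measurableSet_Ici, ← integral_sub (hi2.indicator measurableSet_Ici) hi1,
      ← integral_const_mul, ← Real.norm_eq_abs]
    refine norm_integral_le_of_norm_le (hi3.const_mul C) (Eventually.of_forall fun x => ?_)
    rw [Real.norm_eq_abs]
    by_cases hx : x ∈ Ici a
    · have hx' : 0 ≤ x - a := sub_nonneg.2 hx
      have hu : up k x = 1 := by
        simp only [hup]
        rw [min_eq_left (by nlinarith [mul_nonneg (Nat.cast_nonneg (α := ℝ) k) hx'])]
        simp
      rw [indicator_of_mem hx, hu, show f x - f x * dn k x = f x * (1 - dn k x) by ring, abs_mul,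
        abs_of_nonneg (sub_nonneg.2 ((le_abs_self _).trans (hdn1 k x)))]
      exact mul_le_mul_of_nonneg_right (hC x) (sub_nonneg.2 ((le_abs_self _).trans (hdn1 k x)))
    · have hx' : x - a < 0 := sub_neg.2 (not_le.1 hx)
      have hd : dn k x = 0 := by
        simp only [hdn]
        exact max_eq_left ((min_le_right _ _).trans
          (mul_nonpos_of_nonneg_of_nonpos (Nat.cast_nonneg k) hx'.le))
      rw [indicator_of_notMem hx, hd]
      simp only [mul_zero, sub_zero, abs_zero]
      exact mul_nonneg hC0 (le_max_left _ _)
  rw [Metric.tendsto_atTop]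
  intro ε hε
  obtain ⟨k, hk⟩ := ((hlim.const_mul C).eventually (gt_mem_nhds (show C * 0 < ε / 4 by linarith))).exists
  have h1 := h (fun x => f x * dn k x) (hf.mul (hdnc k)) ⟨C * 1, fun x => by
    rw [abs_mul]; exact mul_le_mul (hC x) (hdn1 k x) (abs_nonneg _) hC0⟩
  have h2 := h (fun x => up k x - dn k x) ((hupc k).sub (hdnc k)) ⟨2, fun x =>
    (abs_sub _ _).trans (by linarith [hup1 k x, hdn1 k x])⟩
  obtain ⟨N₁, hN₁⟩ := Metric.tendsto_atTop.1 h1 (ε / 4) (by linarith)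
  obtain ⟨N₂, hN₂⟩ := eventually_atTop.1 ((h2.const_mul C).eventually (gt_mem_nhds hk))
  refine ⟨max N₁ N₂, fun n hn => ?_⟩
  have e1 := hN₁ n (le_of_max_le_left hn)
  have e2 := hN₂ n (le_of_max_le_right hn)
  have e3 := hdiff (m n) k
  have e4 := hdiff M k
  rw [Real.dist_eq] at e1 ⊢
  rw [abs_le] at e3 e4
  rw [abs_lt] at e1 ⊢
  constructor <;> linarith [e1.1, e1.2, e3.1, e3.2, e4.1, e4.2]

/-! ### The local limit theorem -/

/-- Convolution powers of a measure. -/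
def npow (ν : Measure ℝ) : ℕ → Measure ℝ
  | 0 => Measure.dirac 0
  | n + 1 => npow ν n ∗ ν

section LLT

variable {ν : Measure ℝ} [IsProbabilityMeasure ν]

instance (n : ℕ) : IsProbabilityMeasure (npow ν n) := by
  induction n with
  | zero => rw [npow]; infer_instance
  | succ n ih => rw [npow]; infer_instance

lemma charFun_npow (n : ℕ) (t : ℝ) : charFun (npow ν n) t = charFun ν t ^ n := by
  induction n with
  | zero => simp [npow]
  | succ n ih => rw [npow, charFun_conv, ih, pow_succ]

lemma smoothKer_le : ∃ C, ∀ x, |smoothKer x| ≤ C := by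
  refine ⟨2, fun x => ?_⟩
  rw [abs_of_pos (smoothKer_pos x), smoothKer, ← sq_abs, ← sq_abs (Real.sinc ((x - 1) / 2))]
  have h := fun y => pow_le_one₀ (n := 2) (abs_nonneg _) (Real.abs_sinc_le_one y)
  linarith [h (x / 2), h ((x - 1) / 2)]

lemma integrable_smoothKer_of_finite (m : Measure ℝ) [IsFiniteMeasure m] :
    Integrable smoothKer m := by
  obtain ⟨C, hC⟩ := smoothKer_le
  exact Integrable.of_bound continuous_smoothKer.aestronglyMeasurable C (Eventually.of_forall hC)

lemma integral_smoothKer_mul_exp_of_prob (m : Measure ℝ) [IsProbabilityMeasure m] (τ : ℝ) :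
    ∫ x, (smoothKer x : ℂ) * Complex.exp (τ * x * Complex.I) ∂m =
      ∫ θ, specFun (θ - τ) * charFun m θ := by
  have hs : Integrable specFun :=
    continuous_specFun.integrable_of_hasCompactSupport hasCompactSupport_specFun
  have h1 : ∀ x : ℝ, (smoothKer x : ℂ) * Complex.exp (τ * x * Complex.I) =
      ∫ θ, specFun (θ - τ) * Complex.exp (θ * x * Complex.I) := fun x => by
    rw [← integral_specFun_mul_exp, ← integral_mul_const,
      ← integral_sub_right_eq_self (μ := volume) _ τ]
    refine integral_congr_ae (Eventually.of_forall fun θ => ?_)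
    simp only
    rw [mul_assoc, ← Complex.exp_add]
    congr 2
    push_cast; ring
  simp_rw [h1]
  rw [integral_integral_swap]
  · simp_rw [integral_const_mul, charFun_apply_real]
  · have h2 : Integrable (fun p : ℝ × ℝ => (1 : ℂ) * specFun (p.2 - τ)) (m.prod volume) :=
      (integrable_const (1 : ℂ)).mul_prod (hs.comp_sub_right τ)
    refine h2.mono (Continuous.aestronglyMeasurable ?_) (Eventually.of_forall fun p => ?_)
    · have := continuous_specFun
      fun_prop
    · rw [Function.uncurry, norm_mul, one_mul, ← Complex.ofReal_mul, Complex.norm_exp_ofReal_mul_I,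
        mul_one]

lemma integral_tilted_smoothKer {E : Type*} [NormedAddCommGroup E] [NormedSpace ℝ E]
    (m : Measure ℝ) (f : ℝ → E) :
    ∫ x, f x ∂(m.tilted fun x => Real.log (smoothKer x)) =
      (∫ x, smoothKer x ∂m)⁻¹ • ∫ x, smoothKer x • f x ∂m := by
  rw [integral_tilted, ← integral_smul]
  simp_rw [Real.exp_log (smoothKer_pos _), smul_smul, div_eq_inv_mul]

lemma isProbabilityMeasure_tilted_smoothKer (m : Measure ℝ) [NeZero m]
    (h : Integrable smoothKer m) :
    IsProbabilityMeasure (m.tilted fun x => Real.log (smoothKer x)) := by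
  refine isProbabilityMeasure_tilted ?_
  simpa only [Real.exp_log (smoothKer_pos _)] using h

lemma charFun_tilted_smoothKer (m : Measure ℝ) (τ : ℝ) :
    charFun (m.tilted fun x => Real.log (smoothKer x)) τ =
      ((∫ x, smoothKer x ∂m : ℝ) : ℂ)⁻¹ *
        ∫ x, (smoothKer x : ℂ) * Complex.exp (τ * x * Complex.I) ∂m := by
  rw [charFun_apply_real, integral_tilted_smoothKer, Complex.real_smul, Complex.ofReal_inv]
  simp_rw [Complex.real_smul]

lemma integral_smoothKer_pos (m : Measure ℝ) [NeZero m] (h : Integrable smoothKer m) :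
    0 < ∫ x, smoothKer x ∂m := by
  rw [integral_pos_iff_support_of_nonneg (fun x => (smoothKer_pos x).le) h]
  have : Function.support smoothKer = univ := by
    ext x; simp [(smoothKer_pos x).ne']
  rw [this, Measure.measure_univ_pos]
  exact NeZero.ne m

variable {σ : ℝ}

lemma tendsto_sqrt_mul_integral_smoothKer (hσ : 0 < σ) (h0 : ∫ x, x ∂ν = 0)
    (h2 : ∫ x, x ^ 2 ∂ν = σ ^ 2) (hnl : NonLattice ν) {f : ℝ → ℝ} (hf : Continuous f)
    (hb : ∃ C, ∀ x, |f x| ≤ C) :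
    Tendsto (fun n : ℕ => Real.sqrt n * ∫ x, smoothKer x * f x ∂(npow ν n)) atTop
      (𝓝 ((σ * Real.sqrt (2 * Real.pi))⁻¹ * ∫ x, smoothKer x * f x)) := by
  have hpi := Real.pi_pos
  set c : ℝ := Real.sqrt (2 * Real.pi) / σ with hc
  have hc0 : 0 < c := by positivity
  have hi : ∀ n, Integrable smoothKer (npow ν n) := fun n => integrable_smoothKer_of_finite _
  have hch : ∀ τ : ℝ, Tendsto (fun n : ℕ => (Real.sqrt n : ℂ) *
      ∫ x, (smoothKer x : ℂ) * Complex.exp (τ * x * Complex.I) ∂(npow ν n)) atTop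
      (𝓝 (specFun (-τ) * (c : ℝ))) := fun τ => by
    have h3 := tendsto_sqrt_mul_integral_charFun hσ h0 h2 hnl (g := fun θ => specFun (θ - τ))
      (by have := continuous_specFun; fun_prop)
      (hasCompactSupport_specFun.comp_homeomorph (Homeomorph.subRight τ))
    simp only [zero_sub] at h3
    simpa only [integral_smoothKer_mul_exp_of_prob, charFun_npow] using h3
  have hvol : ∫ x, smoothKer x = 4 * Real.pi := by
    have := integral_smoothKer_mul_exp 0
    simp only [Complex.ofReal_zero, zero_mul, Complex.exp_zero, mul_one, neg_zero,
      specFun_zero, integral_complex_ofReal] at this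
    have h4 : ((∫ x, smoothKer x : ℝ) : ℂ) = ((4 * Real.pi : ℝ) : ℂ) := by
      rw [this]; push_cast; ring
    exact_mod_cast h4
  have hH : Tendsto (fun n : ℕ => Real.sqrt n * ∫ x, smoothKer x ∂(npow ν n)) atTop
      (𝓝 (2 * c)) := by
    have h3 := hch 0
    simp only [Complex.ofReal_zero, zero_mul, Complex.exp_zero, mul_one, neg_zero,
      specFun_zero, integral_complex_ofReal] at h3
    have h5 : Tendsto (fun n : ℕ => ((Real.sqrt n * ∫ x, smoothKer x ∂(npow ν n) : ℝ) : ℂ)) atTop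
        (𝓝 ((2 * c : ℝ) : ℂ)) := by
      push_cast
      exact h3
    exact (Complex.continuous_re.tendsto _).comp h5
  have hpm : ∀ n, IsProbabilityMeasure ((npow ν n).tilted fun x => Real.log (smoothKer x)) :=
    fun n => isProbabilityMeasure_tilted_smoothKer _ (hi n)
  have hpv : IsProbabilityMeasure ((volume : Measure ℝ).tilted fun x => Real.log (smoothKer x)) :=
    isProbabilityMeasure_tilted_smoothKer _ integrable_smoothKer
  let pn : ℕ → ProbabilityMeasure ℝ := fun n => ⟨_, hpm n⟩
  let pv : ProbabilityMeasure ℝ := ⟨_, hpv⟩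
  have hpn : ∀ n, (pn n : Measure ℝ) = (npow ν n).tilted fun x => Real.log (smoothKer x) :=
    fun n => rfl
  have hpv' : (pv : Measure ℝ) = (volume : Measure ℝ).tilted fun x => Real.log (smoothKer x) := rfl
  have hconv : Tendsto pn atTop (𝓝 pv) := by
    rw [ProbabilityMeasure.tendsto_iff_tendsto_charFun]
    intro τ
    simp only [hpn, hpv', charFun_tilted_smoothKer, hvol,
      integral_smoothKer_mul_exp]
    have h3 := (hch τ).mul (((Complex.continuous_ofReal.tendsto _).comp hH).inv₀
      (by simpa using hc0.ne'))
    have hcc : (c : ℂ) ≠ 0 := by exact_mod_cast hc0.ne'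
    have hpc : (Real.pi : ℂ) ≠ 0 := by exact_mod_cast hpi.ne'
    refine (h3.congr' ?_).trans_eq ?_
    · filter_upwards [eventually_gt_atTop 0] with n hn
      have hn' : (Real.sqrt n : ℂ) ≠ 0 := by
        exact_mod_cast (Real.sqrt_pos.2 (Nat.cast_pos.2 hn)).ne'
      have hHn : ((∫ x, smoothKer x ∂(npow ν n) : ℝ) : ℂ) ≠ 0 := by
        exact_mod_cast (integral_smoothKer_pos _ (hi n)).ne'
      simp only [Function.comp]
      push_cast
      generalize ∫ x, (smoothKer x : ℂ) * Complex.exp (τ * x * Complex.I) ∂(npow ν n) = w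
      field_simp
    · congr 1
      push_cast
      field_simp
      ring
  obtain ⟨C, hC⟩ := hb
  have h3 := (ProbabilityMeasure.tendsto_iff_forall_integral_tendsto.1 hconv)
    (BoundedContinuousFunction.ofNormedAddCommGroup f hf C hC)
  simp only [hpn, hpv', BoundedContinuousFunction.coe_ofNormedAddCommGroup,
    integral_tilted_smoothKer, smul_eq_mul, hvol] at h3
  refine ((hH.mul h3).congr' ?_).trans_eq ?_
  · refine Eventually.of_forall fun n => ?_
    have := (integral_smoothKer_pos _ (hi n)).ne'
    field_simp
  · congr 1
    have h5 : Real.sqrt (2 * Real.pi) ^ 2 = 2 * Real.pi := Real.sq_sqrt (by positivity)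
    rw [hc]
    field_simp
    rw [h5]
    ring

/-- The closed positive or the open negative half-line. -/
def IsHalf (A : Set ℝ) : Prop := A = Ici 0 ∨ A = Iio 0

lemma IsHalf.measurableSet {A : Set ℝ} (hA : IsHalf A) : MeasurableSet A := by
  rcases hA with rfl | rfl
  · exact measurableSet_Ici
  · exact measurableSet_Iio

lemma tendsto_sqrt_mul_setIntegral_exp (hσ : 0 < σ) (h0 : ∫ x, x ∂ν = 0)
    (h2 : ∫ x, x ^ 2 ∂ν = σ ^ 2) (hnl : NonLattice ν) {A : Set ℝ} (hA : IsHalf A) {lam : ℝ}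
    (hlam : 0 < lam) :
    Tendsto (fun n : ℕ => Real.sqrt n * ∫ x in A, Real.exp (-(lam * |x|)) ∂(npow ν n)) atTop
      (𝓝 ((σ * Real.sqrt (2 * Real.pi))⁻¹ / lam)) := by
  set m : ℕ → Measure ℝ := fun n => ENNReal.ofReal (Real.sqrt n) •
    (npow ν n).withDensity fun x => ENNReal.ofReal (smoothKer x) with hm
  set M : Measure ℝ := ENNReal.ofReal (σ * Real.sqrt (2 * Real.pi))⁻¹ •
    (volume : Measure ℝ).withDensity fun x => ENNReal.ofReal (smoothKer x) with hM
  have hsm : Measurable fun x => ENNReal.ofReal (smoothKer x) :=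
    continuous_smoothKer.measurable.ennreal_ofReal
  have hfin : ∀ m' : Measure ℝ, Integrable smoothKer m' →
      IsFiniteMeasure (m'.withDensity fun x => ENNReal.ofReal (smoothKer x)) := fun m' hi =>
    isFiniteMeasure_withDensity_ofReal hi.2
  have hm1 : ∀ n, IsFiniteMeasure (m n) := fun n => by
    have := hfin _ (integrable_smoothKer_of_finite (npow ν n))
    exact Measure.smul_finite _ ENNReal.ofReal_ne_top
  have hM1 : IsFiniteMeasure M := by
    have := hfin _ integrable_smoothKer
    exact Measure.smul_finite _ ENNReal.ofReal_ne_top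
  have hint : ∀ (m' : Measure ℝ) (r : ℝ) (f : ℝ → ℝ), 0 ≤ r → ∫ x, f x ∂(ENNReal.ofReal r •
      m'.withDensity fun x => ENNReal.ofReal (smoothKer x)) =
      r * ∫ x, smoothKer x * f x ∂m' := fun m' r f hr => by
    rw [integral_smul_measure, integral_withDensity_eq_integral_toReal_smul hsm
      (Eventually.of_forall fun _ => ENNReal.ofReal_lt_top), ENNReal.toReal_ofReal hr]
    simp [ENNReal.toReal_ofReal (smoothKer_pos _).le]
  have hc0 : 0 ≤ (σ * Real.sqrt (2 * Real.pi))⁻¹ := by positivity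
  have hweak : ∀ f : ℝ → ℝ, Continuous f → (∃ C, ∀ x, |f x| ≤ C) →
      Tendsto (fun n => ∫ x, f x ∂m n) atTop (𝓝 (∫ x, f x ∂M)) := fun f hf hb => by
    simp only [hm, hM]
    rw [hint _ _ _ hc0]
    simp_rw [hint _ _ _ (Real.sqrt_nonneg _)]
    exact tendsto_sqrt_mul_integral_smoothKer hσ h0 h2 hnl hf hb
  have hM0 : M {0} = 0 := by
    have : (volume : Measure ℝ).withDensity (fun x => ENNReal.ofReal (smoothKer x)) {0} = 0 :=
      withDensity_absolutelyContinuous _ _ Real.volume_singleton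
    rw [hM, Measure.smul_apply, this, smul_zero]
  set f : ℝ → ℝ := fun x => Real.exp (-(lam * |x|)) / smoothKer x with hf
  have hfc : Continuous f := by
    have := continuous_smoothKer
    exact Continuous.div (by fun_prop) this fun x => (smoothKer_pos x).ne'
  have hfb : ∃ C, ∀ x, |f x| ≤ C := by
    obtain ⟨c, hc, hlow⟩ := smoothKer_lower
    refine ⟨(1 + 1 / lam) ^ 2 * 2 / c, fun x => ?_⟩
    rw [abs_of_nonneg (div_nonneg (Real.exp_pos _).le (smoothKer_pos x).le),
      div_le_div_iff₀ (smoothKer_pos x) hc]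
    have hx := abs_nonneg x
    have h3 : Real.exp (-(lam * |x|)) * (1 + |x|) ^ 2 ≤ (1 + 1 / lam) ^ 2 * 2 := by
      rw [Real.exp_neg, inv_mul_le_iff₀ (Real.exp_pos _)]
      have h4 := Real.quadratic_le_exp_of_nonneg (mul_nonneg hlam.le hx)
      have h5 : 1 + |x| ≤ (1 + 1 / lam) * (1 + lam * |x|) := by
        have : (1 + 1 / lam) * (1 + lam * |x|) = 1 + |x| + 1 / lam + lam * |x| := by
          field_simp; ring
        rw [this]
        have : 0 < 1 / lam := by positivity
        nlinarith
      calc (1 + |x|) ^ 2 ≤ ((1 + 1 / lam) * (1 + lam * |x|)) ^ 2 := by gcongr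
        _ = (1 + 1 / lam) ^ 2 * (1 + lam * |x|) ^ 2 := by ring
        _ ≤ (1 + 1 / lam) ^ 2 * (2 * Real.exp (lam * |x|)) := by
          gcongr
          nlinarith
        _ = _ := by ring
    calc Real.exp (-(lam * |x|)) * c
        ≤ Real.exp (-(lam * |x|)) * (smoothKer x * (1 + |x|) ^ 2) := by gcongr; exact hlow x
      _ = (Real.exp (-(lam * |x|)) * (1 + |x|) ^ 2) * smoothKer x := by ring
      _ ≤ _ := by
        have := (smoothKer_pos x).le
        gcongr
  have hsf : ∀ x, smoothKer x * f x = Real.exp (-(lam * |x|)) := fun x =>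
    mul_div_cancel₀ _ (smoothKer_pos x).ne'
  have hset : ∀ (m' : Measure ℝ) (r : ℝ) (B : Set ℝ), 0 ≤ r → MeasurableSet B →
      ∫ x in B, f x ∂(ENNReal.ofReal r • m'.withDensity fun x => ENNReal.ofReal (smoothKer x)) =
      r * ∫ x in B, Real.exp (-(lam * |x|)) ∂m' := fun m' r B hr hB => by
    rw [← integral_indicator hB, hint _ _ _ hr, ← integral_indicator hB]
    congr 2
    ext x
    by_cases hx : x ∈ B
    · simp [hx, hsf]
    · simp [hx]
  have hIci := tendsto_setIntegral_Ici hweak hM0 hfc hfb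
  have hall := hweak f hfc hfb
  have hA' : Tendsto (fun n => ∫ x in A, f x ∂m n) atTop (𝓝 (∫ x in A, f x ∂M)) := by
    rcases hA with rfl | rfl
    · exact hIci
    · obtain ⟨C, hC⟩ := hfb
      have h3 : ∀ (m' : Measure ℝ) [IsFiniteMeasure m'],
          ∫ x in Iio 0, f x ∂m' = ∫ x, f x ∂m' - ∫ x in Ici 0, f x ∂m' := fun m' _ => by
        have hi : Integrable f m' := Integrable.of_bound hfc.aestronglyMeasurable C
          (Eventually.of_forall hC)
        rw [← integral_add_compl measurableSet_Ici hi, compl_Ici]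
        ring
      simp_rw [h3]
      exact hall.sub hIci
  simp only [hm, hM] at hA'
  rw [hset _ _ _ hc0 hA.measurableSet] at hA'
  simp_rw [hset _ _ _ (Real.sqrt_nonneg _) hA.measurableSet] at hA'
  convert hA' using 2
  rw [div_eq_mul_inv]
  congr 1
  rcases hA with rfl | rfl
  · rw [integral_Ici_eq_integral_Ioi, setIntegral_congr_fun (g := fun x => Real.exp (-lam * x))
      measurableSet_Ioi fun x hx => by
        simp only [abs_of_pos (show 0 < x from hx), neg_mul]]
    rw [integral_exp_mul_Ioi (by linarith)]
    simp [neg_div]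
  · rw [← integral_Iic_eq_integral_Iio, setIntegral_congr_fun (g := fun x => Real.exp (lam * x))
      measurableSet_Iic fun x hx => by
        simp only [abs_of_nonpos (show x ≤ 0 from hx), mul_neg, neg_neg]]
    rw [integral_exp_mul_Iic hlam]
    simp

end LLT

/-! ### Wiener–Hopf factorization of formal power series -/

section Factorization

open PowerSeries

variable {R : Type*} [CommRing R]

/-- The power series with all coefficients in a given non-unital subring. -/
def coeffSubring (S : NonUnitalSubring R) : NonUnitalSubring R⟦X⟧ where
  carrier := {F | ∀ n, coeff n F ∈ S}
  add_mem' hF hG n := by rw [map_add]; exact S.add_mem (hF n) (hG n)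
  zero_mem' n := by rw [map_zero]; exact S.zero_mem
  mul_mem' hF hG n := by
    rw [coeff_mul]
    exact sum_mem fun p _ => S.mul_mem (hF p.1) (hG p.2)
  neg_mem' hF n := by rw [map_neg]; exact S.neg_mem (hF n)

lemma eq_zero_of_mem_coeffSubring {S T : NonUnitalSubring R}
    (hST : ∀ x, x ∈ S → x ∈ T → x = 0) {F : R⟦X⟧} (hS : F ∈ coeffSubring S)
    (hT : F ∈ coeffSubring T) : F = 0 := by
  ext n
  rw [map_zero]
  exact hST _ (hS n) (hT n)

variable {S T : NonUnitalSubring R} (hST : ∀ x, x ∈ S → x ∈ T → x = 0)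
  {P N D F G : R⟦X⟧} (hP : P - 1 ∈ coeffSubring S) (hN : N - 1 ∈ coeffSubring T)
  (hF : F ∈ coeffSubring S) (hG : G ∈ coeffSubring T)
  (hPD : P * D = 1 - G) (hND : N * D = 1 - F)

include hST hP hN hF hG hPD hND

lemma wienerHopf : P * N * D = 1 := by
  have h1 : P * (1 - F) = N * (1 - G) := by rw [← hPD, ← hND]; ring
  have h2 : P * (1 - F) - 1 = 0 := by
    refine eq_zero_of_mem_coeffSubring hST ?_ ?_
    · have : P * (1 - F) - 1 = (P - 1) - F - (P - 1) * F := by ring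
      rw [this]
      exact sub_mem (sub_mem hP hF) (mul_mem hP hF)
    · have : P * (1 - F) - 1 = (N - 1) - G - (N - 1) * G := by rw [h1]; ring
      rw [this]
      exact sub_mem (sub_mem hN hG) (mul_mem hN hG)
  rw [mul_assoc, hND]
  exact sub_eq_zero.1 h2

lemma mul_eq_of_mul_wienerHopf {E₁ E₂ : R⟦X⟧} (h₁ : E₁ ∈ coeffSubring S)
    (h₂ : E₂ ∈ coeffSubring T) (h : N * E₁ + P * E₂ = 0) : E₁ = 0 := by
  have h0 := wienerHopf hST hP hN hF hG hPD hND
  have h3 : (1 - F) * E₁ = 0 := by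
    refine eq_zero_of_mem_coeffSubring hST ?_ ?_
    · rw [sub_mul, one_mul]
      exact sub_mem h₁ (mul_mem hF h₁)
    · have : (1 - F) * E₁ = -(E₂ - G * E₂) := by
        linear_combination D * h - E₁ * hND - E₂ * hPD
      rw [this]
      exact neg_mem (sub_mem h₂ (mul_mem hG h₂))
  rw [← hND] at h3
  linear_combination P * h3 - E₁ * h0

/-- The ladder identity `s P' = W P`. -/
lemma wienerHopf_derivative {a : R} {W W' : R⟦X⟧} (hD : D = 1 - C a * X)
    (hW : W ∈ coeffSubring S) (hW' : W' ∈ coeffSubring T) (hWD : (W + W') * D = C a * X) :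
    X * d⁄dX R P = W * P := by
  have h0 := wienerHopf hST hP hN hF hG hPD hND
  have hX : ∀ {U : NonUnitalSubring R} {H : R⟦X⟧}, H - 1 ∈ coeffSubring U →
      X * d⁄dX R H ∈ coeffSubring U := fun {U H} hH n => by
    rcases n with - | n
    · rw [coeff_zero_X_mul]; exact U.zero_mem
    · have h1 := hH (n + 1)
      rw [map_sub, coeff_one, if_neg n.succ_ne_zero, sub_zero] at h1
      rw [coeff_succ_X_mul, coeff_derivative, mul_comm,
        show ((n : R) + 1) = ((n + 1 : ℕ) : R) by push_cast; rfl, ← nsmul_eq_mul]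
      exact nsmul_mem h1 _
  have hm : ∀ {U : NonUnitalSubring R} {V H : R⟦X⟧}, H - 1 ∈ coeffSubring U →
      V ∈ coeffSubring U → V * H ∈ coeffSubring U := fun {U V H} hH hV => by
    have : V * H = V + V * (H - 1) := by ring
    rw [this]
    exact add_mem hV (mul_mem hV hH)
  refine sub_eq_zero.1 (mul_eq_of_mul_wienerHopf hST hP hN hF hG hPD hND
    (sub_mem (hX hP) (hm hP hW)) (sub_mem (hX hN) (hm hN hW')) ?_)
  have hdD : d⁄dX R D = -C a := by
    rw [hD, map_sub]
    simp
  have hd : d⁄dX R (P * N * D) = 0 := by rw [h0]; simp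
  rw [Derivation.leibniz, Derivation.leibniz, hdD] at hd
  simp only [smul_eq_mul] at hd
  have h1 : X * (N * d⁄dX R P + P * d⁄dX R N) = (W + W') * (P * N) := by
    linear_combination (P * N * X) * hd - (P * N) ^ 2 * hWD -
      (X * (N * d⁄dX R P + P * d⁄dX R N) - (W + W') * (P * N)) * h0
  linear_combination h1

/-- The factorization of the generating series of the walk started at another point. -/
lemma wienerHopf_start {P' H B B' : R⟦X⟧} (hP' : P' ∈ coeffSubring S) (hH : H ∈ coeffSubring T)
    {e : R} (hPD' : P' * D = C e - H) (hB : B ∈ coeffSubring S) (hB' : B' ∈ coeffSubring T)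
    (hBB : B + B' = C e * N) : P' = B * P := by
  have h0 := wienerHopf hST hP hN hF hG hPD hND
  have h1 : P' * (1 - F) - B = 0 := by
    refine eq_zero_of_mem_coeffSubring hST ?_ ?_
    · rw [mul_sub, mul_one]
      exact sub_mem (sub_mem hP' (mul_mem hP' hF)) hB
    · have : P' * (1 - F) - B = B' - (H + (N - 1) * H) := by
        linear_combination N * hPD' - P' * hND - hBB
      rw [this]
      exact sub_mem hB' (add_mem hH (mul_mem hN hH))
  linear_combination P * h1 + P * P' * hND - P' * h0

end Factorization

/-! ### Ladder measures of a random walk -/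

lemma IsHalf.compl {A : Set ℝ} (hA : IsHalf A) {x y : ℝ} (hx : x ∈ Aᶜ) (hy : y ∈ Aᶜ) :
    x + y ∈ Aᶜ := by
  rcases hA with rfl | rfl
  · simp only [compl_Ici, mem_Iio] at *; linarith
  · simp only [compl_Iio, mem_Ici] at *; linarith

lemma IsHalf.add {A : Set ℝ} (hA : IsHalf A) {x y : ℝ} (hx : x ∈ A) (hy : y ∈ A) :
    x + y ∈ A := by
  rcases hA with rfl | rfl
  · simp only [mem_Ici] at *; linarith
  · simp only [mem_Iio] at *; linarith

lemma IsHalf.isHalf_compl {A : Set ℝ} (hA : IsHalf A) : IsHalf Aᶜ := by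
  rcases hA with rfl | rfl
  · exact Or.inr compl_Ici
  · exact Or.inl compl_Iio

lemma charFun_add_measure (m₁ m₂ : Measure ℝ) [IsFiniteMeasure m₁] [IsFiniteMeasure m₂] :
    charFun (m₁ + m₂) = charFun m₁ + charFun m₂ := by
  ext t
  have hi : ∀ (m : Measure ℝ) [IsFiniteMeasure m],
      Integrable (fun x : ℝ => Complex.exp (t * x * Complex.I)) m := fun m _ => by
    refine Integrable.of_bound (by fun_prop) 1 (Eventually.of_forall fun x => ?_)
    rw [← Complex.ofReal_mul, Complex.norm_exp_ofReal_mul_I]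
  simp only [Pi.add_apply, charFun_apply_real]
  exact integral_add_measure (hi _) (hi _)

lemma charFun_sum_measure {ι : Type*} (s : Finset ι) (m : ι → Measure ℝ)
    [∀ i, IsFiniteMeasure (m i)] : charFun (∑ i ∈ s, m i) = ∑ i ∈ s, charFun (m i) := by
  classical
  induction s using Finset.induction_on with
  | empty => ext t; simp
  | insert i s hi ih => rw [Finset.sum_insert hi, Finset.sum_insert hi, charFun_add_measure, ih]

lemma charFun_restrict_add_compl (m : Measure ℝ) [IsFiniteMeasure m] {A : Set ℝ}
    (hA : MeasurableSet A) : charFun (m.restrict A) + charFun (m.restrict Aᶜ) = charFun m := by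
  rw [← charFun_add_measure, Measure.restrict_add_restrict_compl hA]

lemma ae_mem_conv {A B C : Set ℝ} (hC : MeasurableSet C) (h : ∀ x ∈ A, ∀ y ∈ B, x + y ∈ C)
    {m₁ m₂ : Measure ℝ} [IsFiniteMeasure m₁] [IsFiniteMeasure m₂] (h₁ : ∀ᵐ x ∂m₁, x ∈ A)
    (h₂ : ∀ᵐ x ∂m₂, x ∈ B) : ∀ᵐ x ∂(m₁ ∗ m₂), x ∈ C := by
  rw [Measure.conv]
  refine (ae_map_iff (by fun_prop) hC).2 ?_
  filter_upwards [Measure.quasiMeasurePreserving_fst.ae h₁,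
    Measure.quasiMeasurePreserving_snd.ae h₂] with p hp1 hp2 using h _ hp1 _ hp2

/-- Characteristic functions of signed measures carried by a half-line. -/
def suppRing {A : Set ℝ} (hA : IsHalf A) : NonUnitalSubring (ℝ → ℂ) where
  carrier := {f | ∃ m₁ m₂ : Measure ℝ, IsFiniteMeasure m₁ ∧ IsFiniteMeasure m₂ ∧
    (∀ᵐ x ∂m₁, x ∈ A) ∧ (∀ᵐ x ∂m₂, x ∈ A) ∧ f = charFun m₁ - charFun m₂}
  add_mem' := by
    rintro _ _ ⟨m₁, m₂, i₁, i₂, h₁, h₂, rfl⟩ ⟨m₃, m₄, i₃, i₄, h₃, h₄, rfl⟩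
    refine ⟨m₁ + m₃, m₂ + m₄, inferInstance, inferInstance, ae_add_measure_iff.2 ⟨h₁, h₃⟩,
      ae_add_measure_iff.2 ⟨h₂, h₄⟩, ?_⟩
    rw [charFun_add_measure, charFun_add_measure]
    ring
  zero_mem' := ⟨0, 0, inferInstance, inferInstance, by simp, by simp, by simp⟩
  neg_mem' := by
    rintro _ ⟨m₁, m₂, i₁, i₂, h₁, h₂, rfl⟩
    exact ⟨m₂, m₁, i₂, i₁, h₂, h₁, by ring⟩
  mul_mem' := by
    rintro _ _ ⟨m₁, m₂, i₁, i₂, h₁, h₂, rfl⟩ ⟨m₃, m₄, i₃, i₄, h₃, h₄, rfl⟩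
    have hc := fun {m m' : Measure ℝ} [IsFiniteMeasure m] [IsFiniteMeasure m'] =>
      ae_mem_conv (m₁ := m) (m₂ := m') hA.measurableSet fun x hx y hy => hA.add hx hy
    refine ⟨m₁ ∗ m₃ + m₂ ∗ m₄, m₁ ∗ m₄ + m₂ ∗ m₃, inferInstance, inferInstance,
      ae_add_measure_iff.2 ⟨hc h₁ h₃, hc h₂ h₄⟩, ae_add_measure_iff.2 ⟨hc h₁ h₄, hc h₂ h₃⟩, ?_⟩
    rw [charFun_add_measure, charFun_add_measure]
    ext t
    simp only [Pi.mul_apply, Pi.sub_apply, Pi.add_apply, charFun_conv]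
    ring

lemma charFun_mem_suppRing {A : Set ℝ} (hA : IsHalf A) {m : Measure ℝ} [IsFiniteMeasure m]
    (h : ∀ᵐ x ∂m, x ∈ A) : charFun m ∈ suppRing hA := by
  refine ⟨m, 0, inferInstance, inferInstance, h, by simp, ?_⟩
  ext t
  simp

lemma charFun_restrict_mem_suppRing {A : Set ℝ} (hA : IsHalf A) {m : Measure ℝ}
    [IsFiniteMeasure m] : charFun (m.restrict A) ∈ suppRing hA :=
  charFun_mem_suppRing hA (ae_restrict_mem hA.measurableSet)

lemma eq_zero_of_mem_suppRing {A : Set ℝ} (hA : IsHalf A) (f : ℝ → ℂ) (hf : f ∈ suppRing hA)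
    (hf' : f ∈ suppRing hA.isHalf_compl) : f = 0 := by
  obtain ⟨m₁, m₂, i₁, i₂, h₁, h₂, rfl⟩ := hf
  obtain ⟨m₃, m₄, i₃, i₄, h₃, h₄, h⟩ := hf'
  have h5 : m₁ + m₄ = m₂ + m₃ := by
    refine Measure.ext_of_charFun ?_
    rw [charFun_add_measure, charFun_add_measure]
    linear_combination h
  have hr : ∀ {m : Measure ℝ}, (∀ᵐ x ∂m, x ∈ A) → m.restrict A = m := fun h =>
    Measure.restrict_eq_self_of_ae_mem h
  have hr' : ∀ {m : Measure ℝ}, (∀ᵐ x ∂m, x ∈ Aᶜ) → m.restrict A = 0 := fun h => by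
    rw [Measure.restrict_eq_zero]
    simpa [ae_iff] using h
  have h6 := congrArg (fun m : Measure ℝ => m.restrict A) h5
  simp only [Measure.restrict_add, hr h₁, hr h₂, hr' h₃, hr' h₄, add_zero] at h6
  rw [h6, sub_self]

/-- The measures `E[g(S_n); S_1 ∈ A, …, S_n ∈ A]` of the walk with step law `ν` and initial
measure `m`. -/
def lad (ν : Measure ℝ) (A : Set ℝ) (m : Measure ℝ) : ℕ → Measure ℝ
  | 0 => m
  | n + 1 => (lad ν A m n ∗ ν).restrict A

section Ladder

variable {ν : Measure ℝ} [IsProbabilityMeasure ν]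

instance isFiniteMeasure_lad (A : Set ℝ) (m : Measure ℝ) [IsFiniteMeasure m] (n : ℕ) :
    IsFiniteMeasure (lad ν A m n) := by
  induction n with
  | zero => rw [lad]; infer_instance
  | succ n ih => rw [lad]; infer_instance

open PowerSeries

lemma coeff_zero_mul_one_sub {R : Type*} [CommRing R] (F : R⟦X⟧) (a : R) :
    coeff 0 (F * (1 - C a * X)) = coeff 0 F := by
  rw [mul_sub, mul_one, map_sub, ← mul_assoc, coeff_zero_mul_X, sub_zero]

lemma coeff_succ_mul_one_sub {R : Type*} [CommRing R] (F : R⟦X⟧) (a : R) (n : ℕ) :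
    coeff (n + 1) (F * (1 - C a * X)) = coeff (n + 1) F - a * coeff n F := by
  rw [mul_sub, mul_one, map_sub, ← mul_assoc, coeff_succ_mul_X, mul_comm F, coeff_C_mul]

lemma charFun_conv_eq (m₁ m₂ : Measure ℝ) [IsFiniteMeasure m₁] [IsFiniteMeasure m₂] :
    charFun (m₁ ∗ m₂) = charFun m₁ * charFun m₂ := funext fun t => charFun_conv t

lemma charFun_dirac_zero : charFun (Measure.dirac (0 : ℝ)) = 1 := by
  ext t; simp

/-- Generating series of the ladder measures. -/
def ladSeries (ν : Measure ℝ) (A : Set ℝ) (m : Measure ℝ) : (ℝ → ℂ)⟦X⟧ :=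
  mk fun n => charFun (lad ν A m n)

/-- Generating series of the measures with which the walk leaves `A`. -/
def exitSeries (ν : Measure ℝ) (A : Set ℝ) (m : Measure ℝ) : (ℝ → ℂ)⟦X⟧ :=
  mk fun n => match n with
    | 0 => 0
    | n + 1 => charFun ((lad ν A m n ∗ ν).restrict Aᶜ)

lemma ladSeries_mul {A : Set ℝ} (hA : IsHalf A) (m : Measure ℝ) [IsFiniteMeasure m] :
    ladSeries ν A m * (1 - C (charFun ν) * X) = C (charFun m) - exitSeries ν A m := by
  ext1 n
  rcases n with - | n
  · rw [coeff_zero_mul_one_sub, map_sub, coeff_zero_C]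
    simp [ladSeries, exitSeries, lad]
  · rw [coeff_succ_mul_one_sub, map_sub, coeff_C, if_neg n.succ_ne_zero]
    simp only [ladSeries, exitSeries, coeff_mk, lad]
    have := charFun_restrict_add_compl (lad ν A m n ∗ ν) hA.measurableSet
    rw [charFun_conv_eq] at this
    linear_combination this

lemma exitSeries_mem {A : Set ℝ} (hA : IsHalf A) (m : Measure ℝ) [IsFiniteMeasure m] :
    exitSeries ν A m ∈ coeffSubring (suppRing hA.isHalf_compl) := fun n => by
  rcases n with - | n
  · simp only [exitSeries, coeff_mk]; exact zero_mem _
  · simp only [exitSeries, coeff_mk]; exact charFun_restrict_mem_suppRing _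

lemma ladSeries_mem {A : Set ℝ} (hA : IsHalf A) (m : Measure ℝ) [IsFiniteMeasure m]
    (hm : ∀ᵐ x ∂m, x ∈ A) : ladSeries ν A m ∈ coeffSubring (suppRing hA) := fun n => by
  rw [ladSeries, coeff_mk]
  rcases n with - | n
  · exact charFun_mem_suppRing hA hm
  · exact charFun_restrict_mem_suppRing hA

lemma ladSeries_sub_one_mem {A : Set ℝ} (hA : IsHalf A) :
    ladSeries ν A (Measure.dirac 0) - 1 ∈ coeffSubring (suppRing hA) := fun n => by
  rw [map_sub, coeff_one, ladSeries, coeff_mk]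
  rcases n with - | n
  · rw [lad, charFun_dirac_zero, if_pos rfl, sub_self]
    exact zero_mem _
  · rw [if_neg n.succ_ne_zero, sub_zero]
    exact charFun_restrict_mem_suppRing hA

lemma smul_lad_eq {A : Set ℝ} (hA : IsHalf A) (n : ℕ) :
    (n : ENNReal) • lad ν A (Measure.dirac 0) n =
      ∑ j ∈ Finset.range n, lad ν A (Measure.dirac 0) j ∗ (npow ν (n - j)).restrict A := by
  rcases n with - | n
  · simp
  set W : Set ℝ → (ℝ → ℂ)⟦X⟧ := fun B => mk fun n => match n with
    | 0 => 0
    | n + 1 => charFun ((npow ν (n + 1)).restrict B) with hW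
  have hWm : ∀ {B : Set ℝ} (hB : IsHalf B), W B ∈ coeffSubring (suppRing hB) := fun hB n => by
    rcases n with - | n
    · simp only [hW, coeff_mk]; exact zero_mem _
    · simp only [hW, coeff_mk]; exact charFun_restrict_mem_suppRing _
  have hA' := hA.isHalf_compl
  have hcc : suppRing hA = suppRing hA'.isHalf_compl := by
    congr 1; rw [compl_compl]
  have key := wienerHopf_derivative (eq_zero_of_mem_suppRing hA) (ladSeries_sub_one_mem (ν := ν) hA)
    (ladSeries_sub_one_mem (ν := ν) hA')
    (hcc ▸ exitSeries_mem (ν := ν) hA' (Measure.dirac 0)) (exitSeries_mem (ν := ν) hA (Measure.dirac 0))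
    (by rw [ladSeries_mul hA, charFun_dirac_zero, map_one])
    (by rw [ladSeries_mul hA', charFun_dirac_zero, map_one]) rfl (hWm hA) (hWm hA') (by
      ext1 k
      rcases k with - | k
      · rw [coeff_zero_mul_one_sub, coeff_zero_mul_X]
        simp [hW]
      · rw [coeff_succ_mul_one_sub, coeff_succ_mul_X, coeff_C, map_add, map_add]
        simp only [hW, coeff_mk]
        rw [charFun_restrict_add_compl _ hA.measurableSet]
        rcases k with - | k
        · simp only [npow, if_pos, charFun_conv_eq, charFun_dirac_zero]
          ring
        · rw [charFun_restrict_add_compl _ hA.measurableSet, if_neg k.succ_ne_zero]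
          simp only [npow, charFun_conv_eq]
          ring)
  have h1 := congrArg (coeff (n + 1)) key
  rw [coeff_succ_X_mul, coeff_derivative, mul_comm (W A), coeff_mul,
    Finset.Nat.sum_antidiagonal_eq_sum_range_succ_mk, Finset.sum_range_succ] at h1
  simp only [ladSeries, coeff_mk, hW, Nat.sub_self, mul_zero, add_zero] at h1
  have : IsFiniteMeasure (((n + 1 : ℕ) : ENNReal) • lad ν A (Measure.dirac 0) (n + 1)) :=
    Measure.smul_finite _ (ENNReal.natCast_ne_top _)
  refine Measure.ext_of_charFun ?_
  have h2 : charFun (((n + 1 : ℕ) : ENNReal) • lad ν A (Measure.dirac 0) (n + 1)) =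
      charFun (lad ν A (Measure.dirac 0) (n + 1)) * ((n : ℝ → ℂ) + 1) := by
    ext t
    rw [charFun_apply_real, integral_smul_measure, Pi.mul_apply, charFun_apply_real,
      ENNReal.toReal_natCast, Complex.real_smul, mul_comm]
    simp
  rw [h2, h1, charFun_sum_measure]
  refine Finset.sum_congr rfl fun j hj => ?_
  obtain ⟨i, hi⟩ := Nat.exists_eq_add_of_lt (Finset.mem_range.1 hj)
  rw [charFun_conv_eq, hi, show j + i + 1 - j = i + 1 by omega]

lemma lad_dirac_eq {A : Set ℝ} (hA : IsHalf A) {y : ℝ} (hy : y ∈ A) (n : ℕ) :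
    lad ν A (Measure.dirac y) n =
      ∑ j ∈ Finset.range (n + 1), (Measure.dirac y ∗ lad ν Aᶜ (Measure.dirac 0) j).restrict A ∗
        lad ν A (Measure.dirac 0) (n - j) := by
  set B : Set ℝ → (ℝ → ℂ)⟦X⟧ := fun E => mk fun n =>
    charFun ((Measure.dirac y ∗ lad ν Aᶜ (Measure.dirac 0) n).restrict E) with hB
  have hBm : ∀ {E : Set ℝ} (hE : IsHalf E), B E ∈ coeffSubring (suppRing hE) := fun hE n => by
    simp only [hB, coeff_mk]; exact charFun_restrict_mem_suppRing _
  have hA' := hA.isHalf_compl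
  have hcc : suppRing hA = suppRing hA'.isHalf_compl := by
    congr 1; rw [compl_compl]
  have key := wienerHopf_start (eq_zero_of_mem_suppRing hA) (ladSeries_sub_one_mem (ν := ν) hA)
    (ladSeries_sub_one_mem (ν := ν) hA')
    (hcc ▸ exitSeries_mem (ν := ν) hA' (Measure.dirac 0)) (exitSeries_mem (ν := ν) hA (Measure.dirac 0))
    (by rw [ladSeries_mul hA, charFun_dirac_zero, map_one])
    (by rw [ladSeries_mul hA', charFun_dirac_zero, map_one])
    (ladSeries_mem hA (Measure.dirac y) ((ae_dirac_iff hA.measurableSet).2 hy))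
    (exitSeries_mem hA _) (ladSeries_mul hA (Measure.dirac y)) (hBm hA) (hBm hA') (by
      ext1 k
      rw [map_add, coeff_C_mul]
      simp only [hB, coeff_mk, ladSeries]
      rw [charFun_restrict_add_compl _ hA.measurableSet, charFun_conv_eq])
  have h1 := congrArg (coeff n) key
  rw [coeff_mul, Finset.Nat.sum_antidiagonal_eq_sum_range_succ_mk] at h1
  simp only [ladSeries, coeff_mk, hB] at h1
  refine Measure.ext_of_charFun ?_
  rw [h1, charFun_sum_measure]
  simp only [charFun_conv_eq]

end Ladder

/-! ### Laplace transforms of ladder measures -/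

/-- The Laplace transform of the image of `m` under the absolute value. -/
def lap (m : Measure ℝ) (lam : ℝ) : ℝ := ∫ x, Real.exp (-(lam * |x|)) ∂m

lemma exp_neg_abs_le {lam : ℝ} (hlam : 0 ≤ lam) (x : ℝ) : Real.exp (-(lam * |x|)) ≤ 1 :=
  Real.exp_le_one_iff.2 (neg_nonpos.2 (mul_nonneg hlam (abs_nonneg x)))

lemma integrable_exp_abs {m : Measure ℝ} [IsFiniteMeasure m] {lam : ℝ} (hlam : 0 ≤ lam) :
    Integrable (fun x => Real.exp (-(lam * |x|))) m :=
  Integrable.of_bound (by fun_prop) 1 (Eventually.of_forall fun x => by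
    rw [Real.norm_of_nonneg (Real.exp_pos _).le]; exact exp_neg_abs_le hlam x)

lemma lap_nonneg (m : Measure ℝ) (lam : ℝ) : 0 ≤ lap m lam :=
  integral_nonneg fun _ => (Real.exp_pos _).le

lemma lap_le {m : Measure ℝ} [IsFiniteMeasure m] {lam : ℝ} (hlam : 0 ≤ lam) :
    lap m lam ≤ m.real univ := by
  rw [lap, ← mul_one (m.real univ), ← smul_eq_mul, ← integral_const]
  exact integral_mono (integrable_exp_abs hlam) (integrable_const 1) (exp_neg_abs_le hlam)

lemma ae_lad_mem {ν : Measure ℝ} {A : Set ℝ} (hA : IsHalf A) {B : Set ℝ} (hAB : A ⊆ B) {m : Measure ℝ}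
    (hm : ∀ᵐ x ∂m, x ∈ B) (n : ℕ) : ∀ᵐ x ∂(lad ν A m n), x ∈ B := by
  rcases n with - | n
  · exact hm
  · exact (ae_restrict_mem hA.measurableSet).mono fun x hx => hAB hx

lemma ae_lad_zero_mem {ν : Measure ℝ} {A : Set ℝ} (hA : IsHalf A) (n : ℕ) :
    ∀ᵐ x ∂(lad ν A (Measure.dirac 0) n), x ∈ insert 0 A :=
  ae_lad_mem hA (subset_insert _ _)
    ((ae_dirac_iff (hA.measurableSet.insert 0)).2 (mem_insert _ _)) n

section Lap

variable {ν : Measure ℝ} [IsProbabilityMeasure ν]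

lemma lad_univ_le (A : Set ℝ) (m : Measure ℝ) [IsFiniteMeasure m] (n : ℕ) :
    lad ν A m n univ ≤ m univ := by
  induction n with
  | zero => rw [lad]
  | succ n ih =>
    rw [lad, Measure.restrict_apply MeasurableSet.univ]
    refine (measure_mono (subset_univ _)).trans ?_
    rw [Measure.conv, Measure.map_apply (by fun_prop) MeasurableSet.univ, preimage_univ,
      ← univ_prod_univ, Measure.prod_prod, measure_univ (μ := ν), mul_one]
    exact ih

lemma lad_real_univ_le (A : Set ℝ) (y : ℝ) (n : ℕ) :
    (lad ν A (Measure.dirac y) n).real univ ≤ 1 :=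
  ENNReal.toReal_le_of_le_ofReal zero_le_one
    ((lad_univ_le A _ n).trans (by rw [measure_univ, ENNReal.ofReal_one]))

lemma IsHalf.abs_add {A : Set ℝ} (hA : IsHalf A) {x y : ℝ} (hx : x ∈ insert 0 A)
    (hy : y ∈ insert 0 A) : |x + y| = |x| + |y| := by
  rcases hA with rfl | rfl
  · simp only [mem_insert_iff, mem_Ici] at hx hy
    have hx' : 0 ≤ x := hx.elim (fun h => h.ge) id
    have hy' : 0 ≤ y := hy.elim (fun h => h.ge) id
    rw [abs_of_nonneg hx', abs_of_nonneg hy', abs_of_nonneg (add_nonneg hx' hy')]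
  · simp only [mem_insert_iff, mem_Iio] at hx hy
    have hx' : x ≤ 0 := hx.elim (fun h => h.le) le_of_lt
    have hy' : y ≤ 0 := hy.elim (fun h => h.le) le_of_lt
    rw [abs_of_nonpos hx', abs_of_nonpos hy', abs_of_nonpos (add_nonpos hx' hy')]
    ring

lemma lap_conv {A : Set ℝ} (hA : IsHalf A) {m₁ m₂ : Measure ℝ} [IsFiniteMeasure m₁]
    [IsFiniteMeasure m₂] (h₁ : ∀ᵐ x ∂m₁, x ∈ insert 0 A) (h₂ : ∀ᵐ x ∂m₂, x ∈ insert 0 A)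
    {lam : ℝ} (hlam : 0 ≤ lam) : lap (m₁ ∗ m₂) lam = lap m₁ lam * lap m₂ lam := by
  rw [lap, lap, lap, integral_conv (integrable_exp_abs hlam), ← integral_mul_const]
  refine integral_congr_ae ?_
  filter_upwards [h₁] with x hx
  rw [← integral_const_mul]
  refine integral_congr_ae ?_
  filter_upwards [h₂] with y hy
  rw [← Real.exp_add, hA.abs_add hx hy]
  congr 1
  ring

lemma lap_sum {ι : Type*} (s : Finset ι) (m : ι → Measure ℝ) [∀ i, IsFiniteMeasure (m i)]
    {lam : ℝ} (hlam : 0 ≤ lam) : lap (∑ i ∈ s, m i) lam = ∑ i ∈ s, lap (m i) lam :=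
  integral_finsetSum_measure fun _ _ => integrable_exp_abs hlam

variable {σ : ℝ}

/-- The step law: centred, with variance `σ ^ 2`, non-lattice. -/
structure IsStep (ν : Measure ℝ) (σ : ℝ) : Prop where
  pos : 0 < σ
  mean : ∫ x, x ∂ν = 0
  var : ∫ x, x ^ 2 ∂ν = σ ^ 2
  nonLattice : NonLattice ν

/-- The constant of the local limit theorem. -/
def llt (σ : ℝ) : ℝ := (σ * Real.sqrt (2 * Real.pi))⁻¹

lemma tendsto_lap_lad_tsum (h : IsStep ν σ) {A : Set ℝ} (hA : IsHalf A) {lam : ℝ}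
    (hlam : 0 < lam) :
    Tendsto (fun n : ℕ => (n : ℝ) ^ (3 / 2 : ℝ) * lap (lad ν A (Measure.dirac 0) n) lam) atTop
      (𝓝 ((∑' j, lap (lad ν A (Measure.dirac 0) j) lam) * (llt σ / lam))) := by
  refine tendsto_of_recursion (w := fun n => lap ((npow ν n).restrict A) lam)
    (fun n => lap_nonneg _ _) (fun n => (lap_le hlam.le).trans (lad_real_univ_le _ _ _))
    (fun n => lap_nonneg _ _) (fun n => ?_) ?_
  · have h1 := congrArg (fun m => lap m lam) (smul_lad_eq (ν := ν) hA n)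
    simp only [lap_sum _ _ hlam.le] at h1
    rw [lap, integral_smul_measure, ENNReal.toReal_natCast, smul_eq_mul, ← lap] at h1
    rw [h1]
    refine Finset.sum_congr rfl fun j _ => ?_
    exact lap_conv hA (ae_lad_zero_mem hA j)
      ((ae_restrict_mem hA.measurableSet).mono fun x hx => mem_insert_of_mem _ hx) hlam.le
  · simp_rw [← Real.sqrt_eq_rpow]
    exact tendsto_sqrt_mul_setIntegral_exp h.pos h.mean h.var h.nonLattice hA hlam

lemma summable_lap_lad (h : IsStep ν σ) {A : Set ℝ} (hA : IsHalf A) {lam : ℝ} (hlam : 0 < lam) :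
    Summable fun n => lap (lad ν A (Measure.dirac 0) n) lam :=
  summable_of_tendsto_rpow (fun _ => lap_nonneg _ _) (tendsto_lap_lad_tsum h hA hlam)

lemma lap_lad_dirac {A : Set ℝ} (hA : IsHalf A) {y : ℝ} (hy : y ∈ A) (n : ℕ) {lam : ℝ}
    (hlam : 0 ≤ lam) :
    lap (lad ν A (Measure.dirac y) n) lam = ∑ j ∈ Finset.range (n + 1),
      (∫ x in {x | y + x ∈ A}, Real.exp (-(lam * |y + x|)) ∂(lad ν Aᶜ (Measure.dirac 0) j)) *
        lap (lad ν A (Measure.dirac 0) (n - j)) lam := by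
  rw [lad_dirac_eq hA hy, lap_sum _ _ hlam]
  refine Finset.sum_congr rfl fun j _ => ?_
  rw [lap_conv hA ((ae_restrict_mem hA.measurableSet).mono fun x hx => mem_insert_of_mem _ hx)
    (ae_lad_zero_mem hA _) hlam]
  congr 1
  have hm : MeasurableSet {x | y + x ∈ A} := (measurable_const_add y) hA.measurableSet
  rw [lap, ← integral_indicator hA.measurableSet, integral_conv
    ((integrable_exp_abs hlam).indicator hA.measurableSet), integral_dirac,
    ← integral_indicator hm]
  rfl

lemma lap_lad_dirac_le {A : Set ℝ} (hA : IsHalf A) {y : ℝ} (hy : y ∈ A) (n : ℕ) {lam : ℝ}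
    (hlam : 0 ≤ lam) {s : ℝ} (hs : 0 ≤ s) :
    lap (lad ν A (Measure.dirac y) n) lam ≤ Real.exp (s * |y|) * ∑ j ∈ Finset.range (n + 1),
      lap (lad ν Aᶜ (Measure.dirac 0) j) s * lap (lad ν A (Measure.dirac 0) (n - j)) lam := by
  rw [lap_lad_dirac hA hy n hlam, Finset.mul_sum]
  refine Finset.sum_le_sum fun j _ => ?_
  rw [← mul_assoc]
  refine mul_le_mul_of_nonneg_right ?_ (lap_nonneg _ _)
  have hm : MeasurableSet {x | y + x ∈ A} := (measurable_const_add y) hA.measurableSet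
  rw [lap, ← integral_const_mul, ← integral_indicator hm]
  refine integral_mono_of_nonneg (Eventually.of_forall fun x => indicator_nonneg
    (fun _ _ => (Real.exp_pos _).le) _) ((integrable_exp_abs hs).const_mul _) ?_
  filter_upwards [ae_lad_zero_mem (ν := ν) hA.isHalf_compl j] with x hx
  by_cases hxA : y + x ∈ A
  · rw [indicator_of_mem (by exact hxA)]
    refine (exp_neg_abs_le hlam _).trans ?_
    rw [← Real.exp_add, Real.one_le_exp_iff]
    have : |x| ≤ |y| := by
      rcases hA with rfl | rfl
      · simp only [compl_Ici, mem_insert_iff, mem_Iio, mem_Ici] at hx hxA hy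
        have hx' : x ≤ 0 := hx.elim (fun h => h.le) le_of_lt
        rw [abs_of_nonpos hx', abs_of_nonneg hy]; linarith
      · simp only [compl_Iio, mem_insert_iff, mem_Iio, mem_Ici] at hx hxA hy
        have hx' : 0 ≤ x := hx.elim (fun h => h.ge) id
        rw [abs_of_nonneg hx', abs_of_neg hy]; linarith
    nlinarith
  · rw [indicator_of_notMem (by exact hxA)]
    positivity

lemma exists_lap_lad_dirac_le (h : IsStep ν σ) {A : Set ℝ} (hA : IsHalf A) {lam s : ℝ}
    (hlam : 0 < lam) (hs : 0 < s) : ∃ C, 0 < C ∧ ∀ y ∈ A, ∀ n : ℕ,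
      (n : ℝ) ^ (3 / 2 : ℝ) * lap (lad ν A (Measure.dirac y) n) lam ≤ C * Real.exp (s * |y|) := by
  obtain ⟨C, hC0, hC⟩ := exists_bound_of_tendsto (tendsto_conv (fun _ => lap_nonneg _ _)
    (fun _ => lap_nonneg _ _) (tendsto_lap_lad_tsum (ν := ν) h hA.isHalf_compl hs)
    (tendsto_lap_lad_tsum (ν := ν) h hA hlam))
  refine ⟨C, hC0, fun y hy n => ?_⟩
  have h2 := (le_abs_self _).trans (hC n)
  have h3 := lap_lad_dirac_le (ν := ν) hA hy n hlam.le hs.le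
  set T := ∑ j ∈ Finset.range (n + 1), lap (lad ν Aᶜ (Measure.dirac 0) j) s *
    lap (lad ν A (Measure.dirac 0) (n - j)) lam
  calc _ ≤ (n : ℝ) ^ (3 / 2 : ℝ) * (Real.exp (s * |y|) * T) := by gcongr
    _ = ((n : ℝ) ^ (3 / 2 : ℝ) * T) * Real.exp (s * |y|) := by ring
    _ ≤ C * Real.exp (s * |y|) := by gcongr

end Lap

/-! ### Weak convergence from Laplace transforms -/

/-- The measure with density `f` with respect to `m`. -/
def tilt (m : Measure ℝ) (f : ℝ → ℝ) : Measure ℝ := m.withDensity fun x => ENNReal.ofReal (f x)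

lemma isFiniteMeasure_tilt {m : Measure ℝ} {f : ℝ → ℝ} (hf : Integrable f m) :
    IsFiniteMeasure (tilt m f) :=
  isFiniteMeasure_withDensity_ofReal hf.hasFiniteIntegral

lemma setIntegral_tilt {m : Measure ℝ} {f : ℝ → ℝ} (hf : Measurable f) (h0 : ∀ x, 0 ≤ f x)
    (g : ℝ → ℝ) {s : Set ℝ} (hs : MeasurableSet s) :
    ∫ x in s, g x ∂(tilt m f) = ∫ x in s, f x * g x ∂m := by
  rw [tilt, restrict_withDensity hs, integral_withDensity_eq_integral_toReal_smul
    hf.ennreal_ofReal (ae_of_all _ fun _ => ENNReal.ofReal_lt_top)]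
  simp_rw [ENNReal.toReal_ofReal (h0 _), smul_eq_mul]

lemma exp_neg_abs_mem (x : ℝ) : Real.exp (-|x|) ∈ Icc (0 : ℝ) 1 :=
  ⟨(Real.exp_pos _).le, Real.exp_le_one_iff.2 (neg_nonpos.2 (abs_nonneg x))⟩

lemma exists_abs_le_of_continuous {G : ℝ → ℝ} (hG : Continuous G) :
    ∃ C, 0 ≤ C ∧ ∀ s ∈ Icc (0 : ℝ) 1, |G s| ≤ C := by
  obtain ⟨C, hC⟩ := isCompact_Icc.exists_bound_of_continuousOn (s := Icc (0 : ℝ) 1)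
    hG.continuousOn
  exact ⟨C, (norm_nonneg _).trans (hC 0 (by simp)), hC⟩

lemma integrable_comp_exp (m : Measure ℝ) [IsFiniteMeasure m] {G : ℝ → ℝ} (hG : Continuous G) :
    Integrable (fun x => G (Real.exp (-|x|))) m := by
  obtain ⟨C, -, hC⟩ := exists_abs_le_of_continuous hG
  exact Integrable.of_bound (by fun_prop) C
    (Eventually.of_forall fun x => hC _ (exp_neg_abs_mem x))

section Weak

variable {m : ℕ → Measure ℝ} {M : Measure ℝ} [∀ n, IsFiniteMeasure (m n)] [IsFiniteMeasure M]

lemma integral_eval_exp (m : Measure ℝ) [IsFiniteMeasure m] (p : Polynomial ℝ) :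
    ∫ x, p.eval (Real.exp (-|x|)) ∂m = ∑ i ∈ p.support, p.coeff i * lap m i := by
  simp_rw [Polynomial.eval_eq_sum, Polynomial.sum]
  have he : ∀ (i : ℕ) (x : ℝ), Real.exp (-|x|) ^ i = Real.exp (-(i * |x|)) := fun i x => by
    rw [← Real.exp_nat_mul, mul_neg]
  simp_rw [he]
  rw [integral_finsetSum _ fun i _ => (integrable_exp_abs (Nat.cast_nonneg i)).const_mul _]
  simp_rw [integral_const_mul]
  rfl

lemma tendsto_integral_comp_exp
    (h : ∀ j : ℕ, Tendsto (fun n => lap (m n) j) atTop (𝓝 (lap M j)))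
    {G : ℝ → ℝ} (hG : Continuous G) :
    Tendsto (fun n => ∫ x, G (Real.exp (-|x|)) ∂m n) atTop
      (𝓝 (∫ x, G (Real.exp (-|x|)) ∂M)) := by
  have h0 : ∀ m : Measure ℝ, lap m ((0 : ℕ) : ℝ) = m.real univ := fun m => by simp [lap]
  obtain ⟨B₁, hB₁, hB⟩ := exists_bound_of_tendsto (h 0)
  set B := max B₁ (M.real univ) with hBdef
  have hB0 : 0 < B := hB₁.trans_le (le_max_left _ _)
  have hn : ∀ n, (m n).real univ ≤ B := fun n => by
    rw [← h0]; exact (le_abs_self _).trans ((hB n).trans (le_max_left _ _))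
  rw [Metric.tendsto_atTop]
  intro ε hε
  obtain ⟨p, hp⟩ := exists_polynomial_near_of_continuousOn 0 1 G hG.continuousOn (ε / (4 * B))
    (by positivity)
  have hclose : ∀ (m : Measure ℝ) [IsFiniteMeasure m], m.real univ ≤ B →
      |∫ x, p.eval (Real.exp (-|x|)) ∂m - ∫ x, G (Real.exp (-|x|)) ∂m| ≤ ε / 4 := by
    intro m _ hm
    rw [← integral_sub (integrable_comp_exp m p.continuous) (integrable_comp_exp m hG),
      ← Real.norm_eq_abs]
    calc _ ≤ ε / (4 * B) * m.real univ := norm_integral_le_of_norm_le_const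
            (Eventually.of_forall fun x => (hp _ (exp_neg_abs_mem x)).le)
      _ ≤ ε / (4 * B) * B := by gcongr
      _ = ε / 4 := by field_simp
  have hpoly : Tendsto (fun n => ∫ x, p.eval (Real.exp (-|x|)) ∂m n) atTop
      (𝓝 (∫ x, p.eval (Real.exp (-|x|)) ∂M)) := by
    simp_rw [integral_eval_exp]
    exact tendsto_finsetSum _ fun i _ => (h i).const_mul _
  obtain ⟨N, hN⟩ := (Metric.tendsto_atTop.1 hpoly) (ε / 4) (by positivity)
  refine ⟨N, fun n hnN => ?_⟩
  have h1 := hclose (m n) (hn n)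
  have h2 := hclose M (le_max_right _ _)
  have h3 := hN n hnN
  rw [Real.dist_eq] at h3 ⊢
  rw [abs_le] at h1 h2
  rw [abs_lt] at h3 ⊢
  constructor <;> linarith [h1.1, h1.2, h2.1, h2.2, h3.1, h3.2]

lemma tendsto_setIntegral_comp_exp
    (h : ∀ j : ℕ, Tendsto (fun n => lap (m n) j) atTop (𝓝 (lap M j)))
    {φ : ℝ → ℝ} (hφ : Continuous φ) {c : ℝ} (hc : M {x | φ (Real.exp (-|x|)) = c} = 0)
    {H : ℝ → ℝ} (hH : Continuous H) (hHb : ∃ C, ∀ x, |H x| ≤ C) :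
    Tendsto (fun n => ∫ x in {x | c ≤ φ (Real.exp (-|x|))}, H (φ (Real.exp (-|x|))) ∂m n) atTop
      (𝓝 (∫ x in {x | c ≤ φ (Real.exp (-|x|))}, H (φ (Real.exp (-|x|))) ∂M)) := by
  have hm : Measurable fun x : ℝ => φ (Real.exp (-|x|)) := by fun_prop
  have key : ∀ m : Measure ℝ, ∫ x in Ici c, H x ∂(m.map fun x => φ (Real.exp (-|x|))) =
      ∫ x in {x | c ≤ φ (Real.exp (-|x|))}, H (φ (Real.exp (-|x|))) ∂m := fun m => by
    rw [setIntegral_map measurableSet_Ici hH.aestronglyMeasurable hm.aemeasurable]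
    rfl
  simp_rw [← key]
  refine tendsto_setIntegral_Ici (fun f hf hfb => ?_) ?_ hH hHb
  · simp_rw [integral_map hm.aemeasurable hf.aestronglyMeasurable]
    exact tendsto_integral_comp_exp h (hf.comp hφ)
  · rw [Measure.map_apply hm (measurableSet_singleton c)]
    exact hc

/-- Extension of a function from `[0, 1]` by constants. -/
lemma exists_bounded_extension {G : ℝ → ℝ} (hG : Continuous G) :
    ∃ H : ℝ → ℝ, Continuous H ∧ (∃ C, ∀ x, |H x| ≤ C) ∧ ∀ x ∈ Icc (0 : ℝ) 1, H x = G x := by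
  obtain ⟨C, -, hC⟩ := exists_abs_le_of_continuous hG
  refine ⟨fun x => G (max 0 (min 1 x)), by fun_prop, ⟨C, fun x => hC _ ?_⟩, fun x hx => ?_⟩
  · exact ⟨le_max_left _ _, max_le zero_le_one (min_le_left _ _)⟩
  · simp only [min_eq_right hx.2, max_eq_right hx.1]

lemma tendsto_setIntegral_abs_le
    (h : ∀ j : ℕ, Tendsto (fun n => lap (m n) j) atTop (𝓝 (lap M j)))
    {a : ℝ} (ha : M {x | |x| = a} = 0) {G : ℝ → ℝ} (hG : Continuous G) :
    Tendsto (fun n => ∫ x in {x | |x| ≤ a}, G (Real.exp (-|x|)) ∂m n) atTop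
      (𝓝 (∫ x in {x | |x| ≤ a}, G (Real.exp (-|x|)) ∂M)) := by
  obtain ⟨H, hH, hHb, hHG⟩ := exists_bounded_extension hG
  have := tendsto_setIntegral_comp_exp h continuous_id (c := Real.exp (-a))
    (by simpa only [id, Real.exp_eq_exp, neg_inj] using ha) hH hHb
  simpa only [id, Real.exp_le_exp, neg_le_neg_iff, hHG _ (exp_neg_abs_mem _)] using this

lemma tendsto_setIntegral_le_abs
    (h : ∀ j : ℕ, Tendsto (fun n => lap (m n) j) atTop (𝓝 (lap M j)))
    {a : ℝ} (ha : M {x | |x| = a} = 0) {G : ℝ → ℝ} (hG : Continuous G) :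
    Tendsto (fun n => ∫ x in {x | a ≤ |x|}, G (Real.exp (-|x|)) ∂m n) atTop
      (𝓝 (∫ x in {x | a ≤ |x|}, G (Real.exp (-|x|)) ∂M)) := by
  obtain ⟨H, hH, ⟨C, hC⟩, hHG⟩ := exists_bounded_extension hG
  have := tendsto_setIntegral_comp_exp h continuous_neg (c := -Real.exp (-a))
    (by simpa only [id, Real.exp_eq_exp, neg_inj] using ha) (hH.comp continuous_neg)
    ⟨C, fun x => hC _⟩
  simpa only [Function.comp, neg_neg, Real.exp_le_exp, neg_le_neg_iff,
    hHG _ (exp_neg_abs_mem _)] using this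

end Weak

/-! ### Renewal functions -/

/-- The renewal function of the ladder measures of a half-line. -/
def ren (ν : Measure ℝ) (A : Set ℝ) (t : ℝ) : ℝ :=
  ∑' k, (lad ν A (Measure.dirac 0) k).real {x | |x| ≤ t}

lemma real_abs_le_le (m : Measure ℝ) [IsFiniteMeasure m] (t : ℝ) {s : ℝ} (hs : 0 ≤ s) :
    m.real {x | |x| ≤ t} ≤ Real.exp (s * t) * lap m s := by
  have hm : MeasurableSet {x : ℝ | |x| ≤ t} := measurableSet_le (by fun_prop) measurable_const
  rw [← integral_indicator_one hm, lap, ← integral_const_mul]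
  refine integral_mono ((integrable_const _).indicator hm) ((integrable_exp_abs hs).const_mul _)
    fun x => ?_
  by_cases hx : |x| ≤ t
  · rw [indicator_of_mem (by exact hx), Pi.one_apply, ← Real.exp_add, Real.one_le_exp_iff]
    nlinarith
  · rw [indicator_of_notMem (by exact hx)]
    positivity

lemma ren_nonneg {ν : Measure ℝ} (A : Set ℝ) (t : ℝ) : 0 ≤ ren ν A t := tsum_nonneg fun _ => measureReal_nonneg

/-- The limit measure of the tilted ladder measures. -/
def renMeas (ν : Measure ℝ) (A : Set ℝ) : Measure ℝ :=
  tilt (volume.restrict (Ioi 0)) fun t => Real.exp (-t) * ren ν A t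

lemma renMeas_abs_eq (ν : Measure ℝ) (A : Set ℝ) (a : ℝ) : renMeas ν A {x | |x| = a} = 0 := by
  refine withDensity_absolutelyContinuous _ _ (Measure.absolutelyContinuous_of_le
    Measure.restrict_le_self ?_)
  refine Set.Finite.measure_zero ((Set.toFinite {a, -a}).subset fun x (hx : |x| = a) => ?_) _
  rcases abs_choice x with h | h
  · left; rw [← hx, h]
  · right; simp [← hx, h]

section Ren

variable {ν : Measure ℝ} [IsProbabilityMeasure ν] {σ : ℝ}

lemma summable_real_abs_le (h : IsStep ν σ) {A : Set ℝ} (hA : IsHalf A) (t : ℝ) :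
    Summable fun k => (lad ν A (Measure.dirac 0) k).real {x | |x| ≤ t} :=
  Summable.of_nonneg_of_le (fun _ => measureReal_nonneg)
    (fun _ => real_abs_le_le _ t zero_le_one) ((summable_lap_lad h hA one_pos).mul_left _)

lemma ren_le (h : IsStep ν σ) {A : Set ℝ} (hA : IsHalf A) (t : ℝ) {s : ℝ} (hs : 0 < s) :
    ren ν A t ≤ Real.exp (s * t) * ∑' k, lap (lad ν A (Measure.dirac 0) k) s := by
  rw [← tsum_mul_left]
  exact (summable_real_abs_le h hA t).tsum_le_tsum (fun _ => real_abs_le_le _ t hs.le)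
    ((summable_lap_lad h hA hs).mul_left _)

lemma monotone_ren (h : IsStep ν σ) {A : Set ℝ} (hA : IsHalf A) : Monotone (ren ν A) :=
  fun _ _ hst => (summable_real_abs_le h hA _).tsum_le_tsum
    (fun _ => measureReal_mono fun _ hx => le_trans (by exact hx) hst)
    (summable_real_abs_le h hA _)

lemma integrableOn_exp_mul_ren (h : IsStep ν σ) {A : Set ℝ} (hA : IsHalf A) {lam : ℝ}
    (hlam : 0 < lam) : IntegrableOn (fun t => Real.exp (-(lam * t)) * ren ν A t) (Ioi 0) := by
  set D := ∑' k, lap (lad ν A (Measure.dirac 0) k) (lam / 2)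
  refine Integrable.mono' (g := fun t => D * Real.exp (-(lam / 2) * t))
    ((exp_neg_integrableOn_Ioi 0 (half_pos hlam)).const_mul D) ?_ ?_
  · have := (monotone_ren h hA).measurable
    exact Measurable.aestronglyMeasurable (by fun_prop)
  · refine Eventually.of_forall fun t => ?_
    rw [Real.norm_of_nonneg (mul_nonneg (Real.exp_pos _).le (ren_nonneg A t))]
    calc _ ≤ Real.exp (-(lam * t)) * (Real.exp (lam / 2 * t) * D) := by
          gcongr; exact ren_le h hA t (half_pos hlam)
      _ = D * Real.exp (-(lam / 2) * t) := by
          rw [← mul_assoc, ← Real.exp_add, mul_comm]; congr 2; ring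

lemma setIntegral_mul_real_abs_le (m : Measure ℝ) [IsFiniteMeasure m] {f : ℝ → ℝ}
    (hf : IntegrableOn f (Ioi 0)) :
    ∫ t in Ioi 0, f t * m.real {x | |x| ≤ t} = ∫ x, (∫ t in Ioi |x|, f t) ∂m := by
  have hmeas : MeasurableSet {p : ℝ × ℝ | |p.2| ≤ p.1} :=
    measurableSet_le (by fun_prop) (by fun_prop)
  have hint : Integrable (Function.uncurry fun t x : ℝ =>
      {p : ℝ × ℝ | |p.2| ≤ p.1}.indicator (fun p => f p.1) (t, x))
      ((volume.restrict (Ioi (0 : ℝ))).prod m) :=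
    (Integrable.comp_fst (μ := volume.restrict (Ioi (0 : ℝ))) hf m).indicator hmeas
  have h1 : ∀ t, f t * m.real {x | |x| ≤ t} =
      ∫ x, {p : ℝ × ℝ | |p.2| ≤ p.1}.indicator (fun p => f p.1) (t, x) ∂m := fun t => by
    have hm : MeasurableSet {x : ℝ | |x| ≤ t} := measurableSet_le (by fun_prop) measurable_const
    rw [mul_comm, ← smul_eq_mul, ← integral_indicator_const _ hm]
    rfl
  simp_rw [h1]
  rw [integral_integral_swap hint]
  refine integral_congr_ae (Eventually.of_forall fun x => ?_)
  have hm : MeasurableSet {t : ℝ | |x| ≤ t} := measurableSet_Ici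
  calc _ = ∫ t in Ioi 0, {t : ℝ | |x| ≤ t}.indicator f t := rfl
    _ = ∫ t in Ioi 0 ∩ Ici |x|, f t := setIntegral_indicator hm
    _ = ∫ t in Ioi |x|, f t := by
        refine setIntegral_congr_set ?_
        have h2 : (Ioi 0 ∩ Ioi |x| : Set ℝ) = Ioi |x| :=
          inter_eq_right.2 (Ioi_subset_Ioi (abs_nonneg x))
        conv_rhs => rw [← h2]
        exact (ae_eq_refl _).inter Ioi_ae_eq_Ici.symm

lemma hasSum_integral_mul_ren {A : Set ℝ} {f : ℝ → ℝ} (hf : IntegrableOn f (Ioi 0)) (h0 : ∀ t, 0 ≤ f t)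
    (hs : Summable fun k => ∫ x, (∫ t in Ioi |x|, f t) ∂lad ν A (Measure.dirac 0) k) :
    HasSum (fun k => ∫ x, (∫ t in Ioi |x|, f t) ∂lad ν A (Measure.dirac 0) k)
      (∫ t in Ioi 0, f t * ren ν A t) := by
  simp_rw [← setIntegral_mul_real_abs_le _ hf, ren, ← tsum_mul_left] at hs ⊢
  refine hasSum_integral_of_summable_integral_norm (fun k => ?_) ?_
  · refine Integrable.mul_bdd (c := 1) hf ?_ (Eventually.of_forall fun t => ?_)
    · refine Measurable.aestronglyMeasurable (Monotone.measurable fun s t hst => ?_)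
      exact measureReal_mono fun _ hx => le_trans (by exact hx) hst
    · rw [Real.norm_of_nonneg measureReal_nonneg]
      exact (measureReal_mono (subset_univ _)).trans (lad_real_univ_le _ _ _)
  · simpa only [norm_mul, Real.norm_of_nonneg (h0 _), Real.norm_of_nonneg measureReal_nonneg]
      using hs

lemma integral_exp_mul_ren (h : IsStep ν σ) {A : Set ℝ} (hA : IsHalf A) {lam : ℝ}
    (hlam : 0 < lam) : ∫ t in Ioi 0, Real.exp (-(lam * t)) * ren ν A t =
      (∑' k, lap (lad ν A (Measure.dirac 0) k) lam) / lam := by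
  have h1 : ∀ a : ℝ, ∫ t in Ioi a, Real.exp (-(lam * t)) = Real.exp (-(lam * a)) / lam := by
    intro a
    have := integral_exp_mul_Ioi (a := -lam) (by linarith) a
    simp only [neg_mul] at this
    rw [this]; field_simp
  have hs : ∀ k, ∫ x, (∫ t in Ioi |x|, Real.exp (-(lam * t))) ∂lad ν A (Measure.dirac 0) k =
      lap (lad ν A (Measure.dirac 0) k) lam / lam := fun k => by
    simp_rw [h1]; rw [integral_div]; rfl
  have hi : IntegrableOn (fun t => Real.exp (-(lam * t))) (Ioi 0) := by
    simpa only [neg_mul] using exp_neg_integrableOn_Ioi 0 hlam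
  have := hasSum_integral_mul_ren (ν := ν) (A := A) hi (fun t => (Real.exp_pos _).le)
    (by simp_rw [hs]; exact (summable_lap_lad h hA hlam).div_const _)
  simp_rw [hs] at this
  rw [← this.tsum_eq, tsum_div_const]

lemma isFiniteMeasure_renMeas (h : IsStep ν σ) {A : Set ℝ} (hA : IsHalf A) :
    IsFiniteMeasure (renMeas ν A) :=
  isFiniteMeasure_tilt (by simpa only [one_mul, IntegrableOn] using integrableOn_exp_mul_ren h hA one_pos)

lemma setIntegral_renMeas (h : IsStep ν σ) {A : Set ℝ} (hA : IsHalf A) (g : ℝ → ℝ) {s : Set ℝ}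
    (hs : MeasurableSet s) : ∫ x in s, g x ∂renMeas ν A =
      ∫ x in s ∩ Ioi 0, Real.exp (-x) * ren ν A x * g x := by
  have := (monotone_ren h hA).measurable
  rw [renMeas, setIntegral_tilt (by fun_prop)
    (fun t => mul_nonneg (Real.exp_pos _).le (ren_nonneg A t)) g hs, Measure.restrict_restrict hs]

lemma lap_renMeas (h : IsStep ν σ) {A : Set ℝ} (hA : IsHalf A) {lam : ℝ} (hlam : 0 ≤ lam) :
    lap (renMeas ν A) lam = (∑' k, lap (lad ν A (Measure.dirac 0) k) (lam + 1)) / (lam + 1) := by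
  rw [lap, ← setIntegral_univ, setIntegral_renMeas h hA _ MeasurableSet.univ, univ_inter,
    ← integral_exp_mul_ren h hA (by linarith : 0 < lam + 1)]
  refine setIntegral_congr_fun measurableSet_Ioi fun x hx => ?_
  simp only [abs_of_pos (show 0 < x from hx)]
  rw [mul_right_comm, ← Real.exp_add]
  congr 2
  ring

end Ren

/-! ### Weak limits of the ladder measures -/

/-- The ladder measures, normalised and exponentially tilted. -/
def tlad (ν : Measure ℝ) (A : Set ℝ) (m : Measure ℝ) (n : ℕ) : Measure ℝ :=
  tilt (lad ν A m n) fun x => (n : ℝ) ^ (3 / 2 : ℝ) * Real.exp (-|x|)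

lemma setIntegral_tlad (ν : Measure ℝ) (A : Set ℝ) (m : Measure ℝ) (n : ℕ) (g : ℝ → ℝ)
    {s : Set ℝ} (hs : MeasurableSet s) : ∫ x in s, g x ∂tlad ν A m n =
      (n : ℝ) ^ (3 / 2 : ℝ) * ∫ x in s, Real.exp (-|x|) * g x ∂lad ν A m n := by
  rw [tlad, setIntegral_tilt (by fun_prop) (fun _ => by positivity) g hs, ← integral_const_mul]
  simp_rw [mul_assoc]

lemma lap_tlad (ν : Measure ℝ) (A : Set ℝ) (m : Measure ℝ) (n : ℕ) (lam : ℝ) :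
    lap (tlad ν A m n) lam = (n : ℝ) ^ (3 / 2 : ℝ) * lap (lad ν A m n) (lam + 1) := by
  rw [lap, ← setIntegral_univ, setIntegral_tlad _ _ _ _ _ MeasurableSet.univ, setIntegral_univ,
    lap]
  congr 2 with x
  rw [← Real.exp_add]
  congr 1
  ring

lemma IsStep.llt_pos {ν : Measure ℝ} {σ : ℝ} (h : IsStep ν σ) : 0 < llt σ := by
  have := h.pos
  rw [llt]; positivity

lemma lap_smul (m : Measure ℝ) {c : ℝ} (hc : 0 ≤ c) (lam : ℝ) :
    lap (ENNReal.ofReal c • m) lam = c * lap m lam := by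
  rw [lap, integral_smul_measure, ENNReal.toReal_ofReal hc, smul_eq_mul, lap]

/-- The overshoot term in the decomposition of the walk started at `y`. -/
def exitTerm (ν : Measure ℝ) (lam y : ℝ) (j : ℕ) : ℝ :=
  ∫ x in {x | |x| ≤ y}, Real.exp (-(lam * (y - |x|))) ∂lad ν (Iio 0) (Measure.dirac 0) j

lemma exitTerm_nonneg {ν : Measure ℝ} (lam y : ℝ) (j : ℕ) : 0 ≤ exitTerm ν lam y j :=
  integral_nonneg fun _ => (Real.exp_pos _).le

section WeakLad

variable {ν : Measure ℝ} [IsProbabilityMeasure ν] {σ : ℝ}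

instance isFiniteMeasure_tlad (A : Set ℝ) (m : Measure ℝ) [IsFiniteMeasure m] (n : ℕ) :
    IsFiniteMeasure (tlad ν A m n) :=
  isFiniteMeasure_tilt (Integrable.const_mul
    (by simpa only [one_mul] using integrable_exp_abs (m := lad ν A m n) zero_le_one) _)

lemma tendsto_lap_tlad_zero (h : IsStep ν σ) {A : Set ℝ} (hA : IsHalf A) (j : ℕ) :
    Tendsto (fun n => lap (tlad ν A (Measure.dirac 0) n) j) atTop
      (𝓝 (lap (ENNReal.ofReal (llt σ) • renMeas ν A) j)) := by
  have hj : (0 : ℝ) < j + 1 := by positivity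
  simp_rw [lap_smul _ h.llt_pos.le, lap_renMeas h hA (Nat.cast_nonneg j), lap_tlad]
  convert tendsto_lap_lad_tsum h hA hj using 2
  ring

lemma measurableSet_abs_le (y : ℝ) : MeasurableSet {x : ℝ | |x| ≤ y} :=
  measurableSet_le (by fun_prop) measurable_const

lemma integrableOn_exitTerm {lam : ℝ} (hlam : 0 ≤ lam) (y : ℝ) (m : Measure ℝ)
    [IsFiniteMeasure m] :
    IntegrableOn (fun x => Real.exp (-(lam * (y - |x|)))) {x | |x| ≤ y} m := by
  refine Integrable.of_bound (by fun_prop) 1 ?_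
  filter_upwards [ae_restrict_mem (measurableSet_abs_le y)] with x (hx : |x| ≤ y)
  rw [Real.norm_of_nonneg (Real.exp_pos _).le, Real.exp_le_one_iff]
  nlinarith

lemma exitTerm_le {lam : ℝ} (hlam : 0 ≤ lam) (y : ℝ) (j : ℕ) :
    exitTerm ν lam y j ≤ (lad ν (Iio 0) (Measure.dirac 0) j).real {x | |x| ≤ y} := by
  rw [← integral_indicator_one (measurableSet_abs_le y), integral_indicator (measurableSet_abs_le y)]
  refine setIntegral_mono_on (integrableOn_exitTerm hlam y _) (integrable_const 1)
    (measurableSet_abs_le y) fun x (hx : |x| ≤ y) => ?_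
  rw [Pi.one_apply, Real.exp_le_one_iff]
  nlinarith

lemma lap_lad_dirac_eq_exitTerm {y : ℝ} (hy : 0 ≤ y) (n : ℕ) {lam : ℝ} (hlam : 0 ≤ lam) :
    lap (lad ν (Ici 0) (Measure.dirac y) n) lam = ∑ j ∈ Finset.range (n + 1),
      exitTerm ν lam y j * lap (lad ν (Ici 0) (Measure.dirac 0) (n - j)) lam := by
  rw [lap_lad_dirac (Or.inl rfl) (by exact hy) n hlam]
  refine Finset.sum_congr rfl fun j _ => ?_
  congr 1
  have hm : MeasurableSet {x : ℝ | y + x ∈ Ici 0} := (measurable_const_add y) measurableSet_Ici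
  rw [exitTerm, compl_Ici, ← integral_indicator hm, ← integral_indicator (measurableSet_abs_le y)]
  refine integral_congr_ae ?_
  filter_upwards [ae_lad_zero_mem (ν := ν) (A := Iio 0) (Or.inr rfl) j] with x hx
  have hx' : x ≤ 0 := hx.elim (fun h => h.le) fun h => le_of_lt h
  simp only [indicator, mem_ofPred_eq, mem_Ici, abs_of_nonpos hx', sub_neg_eq_add]
  by_cases h : 0 ≤ y + x
  · rw [if_pos h, if_pos (by linarith), abs_of_nonneg h]
  · rw [if_neg h, if_neg (by linarith)]

lemma tendsto_exitTerm (h : IsStep ν σ) (lam y : ℝ) :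
    Tendsto (fun j : ℕ => (j : ℝ) ^ (3 / 2 : ℝ) * exitTerm ν lam y j) atTop
      (𝓝 (llt σ * ∫ t in Ioc 0 y, Real.exp (-(lam * (y - t))) * ren ν (Iio 0) t)) := by
  have hA : IsHalf (Iio 0) := Or.inr rfl
  have := isFiniteMeasure_renMeas h hA
  have : IsFiniteMeasure (ENNReal.ofReal (llt σ) • renMeas ν (Iio 0)) :=
    Measure.smul_finite _ ENNReal.ofReal_ne_top
  have hpos : ∀ s : ℝ, 0 < max s (Real.exp (-y)) := fun s => lt_max_of_lt_right (Real.exp_pos _)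
  have hG : Continuous fun s : ℝ =>
      Real.exp (-(lam * y)) * max s (Real.exp (-y)) ^ (-(lam + 1)) :=
    continuous_const.mul ((continuous_id.max continuous_const).rpow_const
      fun s => Or.inl (hpos s).ne')
  have hGe : ∀ x : ℝ, |x| ≤ y → Real.exp (-|x|) *
      (Real.exp (-(lam * y)) * max (Real.exp (-|x|)) (Real.exp (-y)) ^ (-(lam + 1))) =
      Real.exp (-(lam * (y - |x|))) := fun x hx => by
    rw [max_eq_left (Real.exp_le_exp.2 (neg_le_neg hx)), ← Real.exp_mul, ← Real.exp_add,
      ← Real.exp_add]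
    congr 1
    ring
  have key := tendsto_setIntegral_abs_le (tendsto_lap_tlad_zero h hA) (a := y)
    (by rw [Measure.smul_apply, renMeas_abs_eq, smul_zero]) hG
  rw [Measure.restrict_smul, integral_smul_measure, ENNReal.toReal_ofReal h.llt_pos.le,
    smul_eq_mul, setIntegral_renMeas h hA _ (measurableSet_abs_le y)] at key
  simp_rw [setIntegral_tlad _ _ _ _ _ (measurableSet_abs_le y)] at key
  have h1 : ∀ j, ∫ x in {x | |x| ≤ y}, Real.exp (-|x|) *
      (Real.exp (-(lam * y)) * max (Real.exp (-|x|)) (Real.exp (-y)) ^ (-(lam + 1)))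
        ∂lad ν (Iio 0) (Measure.dirac 0) j = exitTerm ν lam y j := fun j =>
    setIntegral_congr_fun (measurableSet_abs_le y) hGe
  simp_rw [h1] at key
  convert key using 3
  have h2 : {x : ℝ | |x| ≤ y} ∩ Ioi 0 = Ioc 0 y := by
    ext x
    simp only [mem_inter_iff, mem_ofPred_eq, mem_Ioi, mem_Ioc]
    constructor
    · rintro ⟨h1, h2⟩; exact ⟨h2, (le_abs_self x).trans h1⟩
    · rintro ⟨h1, h2⟩; exact ⟨by rwa [abs_of_pos h1], h1⟩
  rw [h2]
  refine setIntegral_congr_fun measurableSet_Ioc fun x hx => ?_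
  have h3 := hGe x (by rw [abs_of_pos hx.1]; exact hx.2)
  simp only [abs_of_pos hx.1] at h3 ⊢
  rw [← h3]
  ring

lemma integral_Ioi_indicator_exp (lam : ℝ) {a y : ℝ} (hay : a ≤ y) :
    ∫ t in Ioi a, (Iic y).indicator (fun t => lam * Real.exp (-(lam * (y - t)))) t =
      1 - Real.exp (-(lam * (y - a))) := by
  rw [setIntegral_indicator measurableSet_Iic, Ioi_inter_Iic, ← intervalIntegral.integral_of_le hay,
    intervalIntegral.integral_eq_sub_of_hasDerivAt (f := fun t => Real.exp (-(lam * (y - t))))]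
  · simp
  · intro t _
    have h1 : HasDerivAt (fun t => -(lam * (y - t))) lam t := by
      simpa using HasDerivAt.fun_neg (((hasDerivAt_id t).const_sub y).const_mul lam)
    simpa [mul_comm] using h1.exp
  · exact (by fun_prop : Continuous fun t => lam * Real.exp (-(lam * (y - t)))).intervalIntegrable _ _

lemma tsum_exitTerm_add (h : IsStep ν σ) {lam : ℝ} (hlam : 0 ≤ lam) (y : ℝ) :
    ∑' j, exitTerm ν lam y j +
      lam * ∫ t in Ioc 0 y, Real.exp (-(lam * (y - t))) * ren ν (Iio 0) t = ren ν (Iio 0) y := by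
  have hA : IsHalf (Iio 0) := Or.inr rfl
  have hs1 := summable_real_abs_le h hA y
  have hs2 : Summable fun j => exitTerm ν lam y j :=
    Summable.of_nonneg_of_le (exitTerm_nonneg lam y) (exitTerm_le hlam y) hs1
  set f : ℝ → ℝ := (Iic y).indicator fun t => lam * Real.exp (-(lam * (y - t))) with hf
  have hin : ∀ x : ℝ, ∫ t in Ioi |x|, f t =
      {x : ℝ | |x| ≤ y}.indicator (fun x => 1 - Real.exp (-(lam * (y - |x|)))) x := fun x => by
    by_cases hx : |x| ≤ y
    · rw [integral_Ioi_indicator_exp lam hx, indicator_of_mem (by exact hx)]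
    · rw [indicator_of_notMem (by exact hx), hf, setIntegral_indicator measurableSet_Iic,
        Ioi_inter_Iic, Ioc_eq_empty_of_le (not_le.1 hx).le, setIntegral_empty]
  have hterm : ∀ k, ∫ x, (∫ t in Ioi |x|, f t) ∂lad ν (Iio 0) (Measure.dirac 0) k =
      (lad ν (Iio 0) (Measure.dirac 0) k).real {x | |x| ≤ y} - exitTerm ν lam y k := fun k => by
    simp_rw [hin]
    rw [integral_indicator (measurableSet_abs_le y),
      integral_sub (integrable_const 1) (integrableOn_exitTerm hlam y _), exitTerm]
    simp
  have hfi : IntegrableOn f (Ioi 0) := by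
    rw [IntegrableOn, hf, integrable_indicator_iff measurableSet_Iic, IntegrableOn,
      Measure.restrict_restrict measurableSet_Iic, inter_comm, Ioi_inter_Iic]
    exact (Continuous.integrableOn_Icc (by fun_prop)).mono_set Ioc_subset_Icc_self
  have := hasSum_integral_mul_ren (ν := ν) (A := Iio 0) hfi
    (fun t => indicator_nonneg (fun _ _ => by positivity) _)
    (by simp_rw [hterm]; exact hs1.sub hs2)
  simp_rw [hterm] at this
  have h3 : ∫ t in Ioi 0, f t * ren ν (Iio 0) t =
      lam * ∫ t in Ioc 0 y, Real.exp (-(lam * (y - t))) * ren ν (Iio 0) t := by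
    rw [← integral_const_mul, ← Ioi_inter_Iic, ← setIntegral_indicator measurableSet_Iic]
    refine integral_congr_ae (Eventually.of_forall fun t => ?_)
    simp only [hf, indicator]
    split_ifs <;> ring
  rw [← h3, ← this.tsum_eq, hs1.tsum_sub hs2, ren]
  ring

lemma tendsto_lap_lad_dirac (h : IsStep ν σ) {y : ℝ} (hy : 0 ≤ y) {lam : ℝ} (hlam : 0 < lam) :
    Tendsto (fun n : ℕ => (n : ℝ) ^ (3 / 2 : ℝ) * lap (lad ν (Ici 0) (Measure.dirac y) n) lam)
      atTop (𝓝 (llt σ * ren ν (Iio 0) y *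
        ((∑' k, lap (lad ν (Ici 0) (Measure.dirac 0) k) lam) / lam))) := by
  have := tendsto_conv (exitTerm_nonneg (ν := ν) lam y) (fun _ => lap_nonneg _ _)
    (tendsto_exitTerm h lam y) (tendsto_lap_lad_tsum (ν := ν) h (Or.inl rfl : IsHalf (Ici 0)) hlam)
  simp_rw [lap_lad_dirac_eq_exitTerm hy _ hlam.le]
  convert this using 2
  rw [← tsum_exitTerm_add h hlam.le y]
  field_simp

lemma tendsto_setIntegral_lad (h : IsStep ν σ) {y : ℝ} (hy : 0 ≤ y) (a : ℝ) {G : ℝ → ℝ}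
    (hG : Continuous G) :
    Tendsto (fun n : ℕ => (n : ℝ) ^ (3 / 2 : ℝ) * ∫ x in {x | a ≤ |x|},
        Real.exp (-|x|) * G (Real.exp (-|x|)) ∂lad ν (Ici 0) (Measure.dirac y) n)
      atTop (𝓝 (llt σ * ren ν (Iio 0) y *
        ∫ x in Ici a ∩ Ioi 0, Real.exp (-x) * ren ν (Ici 0) x * G (Real.exp (-x)))) := by
  have hA : IsHalf (Ici 0) := Or.inl rfl
  have hm : MeasurableSet {x : ℝ | a ≤ |x|} := measurableSet_le measurable_const (by fun_prop)
  have hc : 0 ≤ llt σ * ren ν (Iio 0) y := mul_nonneg h.llt_pos.le (ren_nonneg _ _)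
  have := isFiniteMeasure_renMeas h hA
  have : IsFiniteMeasure (ENNReal.ofReal (llt σ * ren ν (Iio 0) y) • renMeas ν (Ici 0)) :=
    Measure.smul_finite _ ENNReal.ofReal_ne_top
  have key := tendsto_setIntegral_le_abs (m := tlad ν (Ici 0) (Measure.dirac y))
    (M := ENNReal.ofReal (llt σ * ren ν (Iio 0) y) • renMeas ν (Ici 0)) (fun j => ?_) (a := a)
    (by rw [Measure.smul_apply, renMeas_abs_eq, smul_zero]) hG
  · rw [Measure.restrict_smul, integral_smul_measure, ENNReal.toReal_ofReal hc,
      smul_eq_mul, setIntegral_renMeas h hA _ hm] at key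
    simp_rw [setIntegral_tlad _ _ _ _ _ hm] at key
    have h2 : {x : ℝ | a ≤ |x|} ∩ Ioi 0 = Ici a ∩ Ioi 0 := by
      ext x
      simp only [mem_inter_iff, mem_ofPred_eq, mem_Ioi, mem_Ici, and_congr_left_iff]
      intro hx
      rw [abs_of_pos hx]
    rw [h2] at key
    convert key using 3
    refine setIntegral_congr_fun (measurableSet_Ici.inter measurableSet_Ioi) fun x hx => ?_
    simp only [abs_of_pos (show 0 < x from hx.2)]
  · simp_rw [lap_smul _ hc, lap_renMeas h hA (Nat.cast_nonneg j), lap_tlad]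
    exact tendsto_lap_lad_dirac h hy (by positivity)

end WeakLad

/-! ### The law of the walk killed outside a half-line -/

section Killed

variable {μ : Measure Ω}

lemma walk_succ {Ω : Type*} (X : ℕ → Ω → ℝ) (n : ℕ) (ω : Ω) :
    walk X (n + 1) ω = walk X n ω + X (n + 1) ω :=
  Finset.sum_Icc_succ_top (by omega) _

lemma walk_zero {Ω : Type*} (X : ℕ → Ω → ℝ) (ω : Ω) : walk X 0 ω = 0 := by simp [walk]

/-- The event that the walk started at `y` stays in `A` up to time `n`. -/
def staySet (X : ℕ → Ω → ℝ) (A : Set ℝ) (y : ℝ) (n : ℕ) : Set Ω :=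
  {ω | ∀ i ∈ Finset.Icc 1 n, y + walk X i ω ∈ A}

lemma staySet_zero {Ω : Type*} (X : ℕ → Ω → ℝ) (A : Set ℝ) (y : ℝ) : staySet X A y 0 = univ := by
  ext; simp [staySet]

lemma staySet_succ {Ω : Type*} (X : ℕ → Ω → ℝ) (A : Set ℝ) (y : ℝ) (n : ℕ) :
    staySet X A y (n + 1) = (fun ω => y + walk X (n + 1) ω) ⁻¹' A ∩ staySet X A y n := by
  ext ω
  simp only [staySet, mem_ofPred_eq, mem_inter_iff, mem_preimage, Finset.mem_Icc]
  constructor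
  · intro h
    exact ⟨h _ ⟨by omega, le_rfl⟩, fun i hi => h i ⟨hi.1, by omega⟩⟩
  · rintro ⟨h1, h2⟩ i hi
    rcases Nat.lt_or_ge n i with h | h
    · obtain rfl : i = n + 1 := by omega
      exact h1
    · exact h2 i ⟨hi.1, h⟩

lemma measurable_envFiltration {Ω : Type*} {E : Type*} [MeasurableSpace E] (Y : ℕ → Ω → E) {i n : ℕ}
    (hi : i ∈ Finset.Icc 1 n) : Measurable[envFiltration Y n] (Y i) :=
  Measurable.mono (comap_measurable (Y i))
    (le_iSup₂ (f := fun i _ => MeasurableSpace.comap (Y i) inferInstance) i hi) le_rfl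

lemma measurable_walk_of {Ω : Type*} {m : MeasurableSpace Ω} {X : ℕ → Ω → ℝ} {n : ℕ}
    (hX : ∀ i ∈ Finset.Icc 1 n, Measurable[m] (X i)) : Measurable[m] (walk X n) := by
  exact Finset.measurable_sum (Finset.Icc 1 n) hX

lemma measurableSet_staySet_of {Ω : Type*} {m : MeasurableSpace Ω} {X : ℕ → Ω → ℝ} {n : ℕ}
    (hX : ∀ i ∈ Finset.Icc 1 n, Measurable[m] (X i)) {A : Set ℝ} (hA : MeasurableSet A)
    (y : ℝ) : MeasurableSet[m] (staySet X A y n) := by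
  have : staySet X A y n = ⋂ i ∈ Finset.Icc 1 n, (fun ω => y + walk X i ω) ⁻¹' A := by
    ext; simp [staySet]
  rw [this]
  refine Finset.measurableSet_biInter _ fun i hi => ?_
  refine (Measurable.const_add (measurable_walk_of fun j hj => hX j ?_) y) hA
  simp only [Finset.mem_Icc] at *
  omega

lemma envFiltration_le {E : Type*} [MeasurableSpace E] {Y : ℕ → Ω → E}
    (hY : ∀ i, Measurable (Y i)) (n : ℕ) : envFiltration Y n ≤ ‹MeasurableSpace Ω› :=
  iSup₂_le fun i _ => (hY i).comap_le

lemma IIDfam.indep_envFiltration {E : Type*} [MeasurableSpace E] {Y : ℕ → Ω → E}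
    (hY : IIDseq μ Y) (n : ℕ) :
    Indep (envFiltration Y n) (MeasurableSpace.comap (Y (n + 1)) inferInstance) μ := by
  have h := indep_iSup_of_disjoint (fun i => (hY.1 i).comap_le) hY.2.1
    (S := {i | i ∈ Finset.Icc 1 n}) (T := {n + 1}) (by
      simp [Set.disjoint_singleton_right])
  simpa [envFiltration] using h

variable [IsProbabilityMeasure μ]

theorem lad_map {X : ℕ → Ω → ℝ} (hX : IIDseq μ X) {A : Set ℝ} (hA : MeasurableSet A) (y : ℝ)
    (n : ℕ) : lad (μ.map (X 1)) A (Measure.dirac y) n =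
      (μ.restrict (staySet X A y n)).map fun ω => y + walk X n ω := by
  have hw : ∀ n, Measurable (walk X n) := fun n => measurable_walk_of fun i _ => hX.1 i
  have hXm := hX.1
  have : IsProbabilityMeasure (μ.map (X 1)) := Measure.isProbabilityMeasure_map (hX.1 1).aemeasurable
  induction n with
  | zero => simp [staySet_zero, walk_zero, lad]
  | succ n ih =>
    have hind := (Indep_iff _ _ _).1 (IIDfam.indep_envFiltration hX n)
    have hprod : (μ.restrict (staySet X A y n)).map (fun ω => (y + walk X n ω, X (n + 1) ω)) =
        ((μ.restrict (staySet X A y n)).map fun ω => y + walk X n ω).prod (μ.map (X 1)) := by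
      refine (Measure.prod_eq fun s t hs ht => ?_).symm
      rw [← (hX.2.2 (n + 1)).map_eq]
      have hs' : MeasurableSet[envFiltration X n] ((fun ω => y + walk X n ω) ⁻¹' s) :=
        (Measurable.const_add (measurable_walk_of fun i hi => measurable_envFiltration X hi) y) hs
      have hE : MeasurableSet[envFiltration X n] (staySet X A y n) :=
        measurableSet_staySet_of (fun i hi => measurable_envFiltration X hi) hA y
      have hl := envFiltration_le hX.1 n
      rw [Measure.map_apply (by fun_prop) (hs.prod ht), Measure.map_apply (by fun_prop) hs,
        Measure.map_apply (hX.1 _) ht, Measure.restrict_apply (hl _ hs'),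
        ← hind _ _ (hs'.inter hE) ⟨t, ht, rfl⟩, Measure.restrict_apply]
      · congr 1
        ext ω
        simp only [mem_inter_iff, mem_preimage, mem_prod]
        tauto
      · exact (by fun_prop : Measurable fun ω => (y + walk X n ω, X (n + 1) ω)) (hs.prod ht)
    rw [lad, ih, Measure.conv, ← hprod, Measure.map_map (by fun_prop) (by fun_prop),
      Measure.restrict_map (by fun_prop) hA, staySet_succ, ← Measure.restrict_restrict]
    · congr 1
      · ext ω; simp only [Function.comp_apply, walk_succ]; ring
      · congr 1
        ext ω
        simp only [mem_preimage, Function.comp_apply, walk_succ, add_assoc]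
    · exact (by fun_prop : Measurable fun ω => y + walk X (n + 1) ω) hA

lemma integral_lad {X : ℕ → Ω → ℝ} (hX : IIDseq μ X) {A : Set ℝ} (hA : MeasurableSet A)
    (y : ℝ) (n : ℕ) {f : ℝ → ℝ} (hf : Measurable f) :
    ∫ x, f x ∂lad (μ.map (X 1)) A (Measure.dirac y) n =
      ∫ ω in staySet X A y n, f (y + walk X n ω) ∂μ := by
  have hw : Measurable (walk X n) := measurable_walk_of fun i _ => hX.1 i
  rw [lad_map hX hA, integral_map (by fun_prop) hf.aestronglyMeasurable]

end Killed

/-! ### The harmonic functions as renewal functions -/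

section Harmonic

lemma Mwalk_neg_iff {Ω : Type*} (X : ℕ → Ω → ℝ) (k : ℕ) (ω : Ω) :
    Mwalk X (k + 1) ω < 0 ↔ ω ∈ staySet X (Iio 0) 0 (k + 1) := by
  simp [Mwalk, staySet, Finset.sup'_lt_iff]

lemma Lwalk_nonneg_iff {Ω : Type*} (X : ℕ → Ω → ℝ) (k : ℕ) (ω : Ω) :
    0 ≤ Lwalk X (k + 1) ω ↔ ω ∈ staySet X (Ici 0) 0 (k + 1) := by
  simp [Lwalk, staySet, Finset.le_inf'_iff]

lemma walk_mem_of_mem_staySet {Ω : Type*} {X : ℕ → Ω → ℝ} {A : Set ℝ} {y : ℝ} {k : ℕ} {ω : Ω}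
    (h : ω ∈ staySet X A y (k + 1)) : y + walk X (k + 1) ω ∈ A :=
  h _ (Finset.mem_Icc.2 ⟨by omega, le_rfl⟩)

variable {μ : Measure Ω} {X : ℕ → Ω → ℝ} {σ : ℝ}

lemma uFun_nonneg (x : ℝ) : 0 ≤ uFun μ X x := by
  rw [uFun]
  split_ifs
  · exact add_nonneg zero_le_one (tsum_nonneg fun _ => ENNReal.toReal_nonneg)
  · exact le_rfl

lemma one_le_vFun {x : ℝ} (hx : x ≤ 0) : 1 ≤ vFun μ X x := by
  rw [vFun, if_pos hx]
  exact le_add_of_nonneg_right (tsum_nonneg fun _ => ENNReal.toReal_nonneg)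

lemma vFun_nonneg (x : ℝ) : 0 ≤ vFun μ X x := by
  by_cases hx : x ≤ 0
  · exact zero_le_one.trans (one_le_vFun hx)
  · rw [vFun, if_neg hx]

lemma uFun_zero : uFun μ X 0 = 1 := by
  have : ∀ k, {ω | -walk X (k + 1) ω ≤ 0 ∧ Mwalk X (k + 1) ω < 0} = ∅ := fun k => by
    refine eq_empty_of_forall_notMem fun ω hω => ?_
    have := walk_mem_of_mem_staySet ((Mwalk_neg_iff X k ω).1 hω.2)
    rw [zero_add, mem_Iio] at this
    linarith [hω.1]
  rw [uFun, if_pos le_rfl]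
  simp_rw [this]
  simp

variable [IsProbabilityMeasure μ]

lemma lad_real_eq (hX : IIDseq μ X) {A : Set ℝ} (hA : MeasurableSet A) (y : ℝ) (n : ℕ)
    {s : Set ℝ} (hs : MeasurableSet s) : (lad (μ.map (X 1)) A (Measure.dirac y) n).real s =
      (μ ((fun ω => y + walk X n ω) ⁻¹' s ∩ staySet X A y n)).toReal := by
  have hw : Measurable fun ω => y + walk X n ω :=
    (measurable_walk_of fun i _ => hX.1 i).const_add y
  rw [lad_map hX hA, Measure.real, Measure.map_apply hw hs, Measure.restrict_apply (hw hs)]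

lemma uFun_eq_ren (hX : IIDseq μ X) (h : IsStep (μ.map (X 1)) σ) {x : ℝ} (hx : 0 ≤ x) :
    uFun μ X x = ren (μ.map (X 1)) (Iio 0) x := by
  have : IsProbabilityMeasure (μ.map (X 1)) := Measure.isProbabilityMeasure_map (hX.1 1).aemeasurable
  rw [uFun, if_pos hx, ren, (summable_real_abs_le h (Or.inr rfl) x).tsum_eq_zero_add]
  congr 1
  · simp [lad, Measure.real, Measure.dirac_apply' _ (measurableSet_abs_le x), hx]
  · refine tsum_congr fun k => ?_
    rw [lad_real_eq hX measurableSet_Iio _ _ (measurableSet_abs_le x)]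
    congr 2
    ext ω
    simp only [mem_ofPred_eq, mem_inter_iff, mem_preimage, Mwalk_neg_iff]
    refine and_congr_left fun hω => ?_
    rw [abs_of_neg (walk_mem_of_mem_staySet hω), zero_add]

lemma vFun_eq_tsum (hX : IIDseq μ X) {t : ℝ} (ht : 0 ≤ t) : vFun μ X (-t) =
    1 + ∑' k, (lad (μ.map (X 1)) (Ici 0) (Measure.dirac 0) (k + 1)).real {x | |x| < t} := by
  rw [vFun, if_pos (by linarith)]
  congr 1
  refine tsum_congr fun k => ?_
  rw [lad_real_eq hX measurableSet_Ici _ _ (measurableSet_lt (by fun_prop) measurable_const)]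
  congr 2
  ext ω
  simp only [mem_ofPred_eq, mem_inter_iff, mem_preimage, Lwalk_nonneg_iff]
  refine and_congr_left fun hω => ?_
  rw [abs_of_nonneg (by simpa using walk_mem_of_mem_staySet hω), zero_add]
  exact neg_lt_neg_iff

lemma ren_Ici_eq (h : IsStep (μ.map (X 1)) σ) (hX : IIDseq μ X) {t : ℝ} (ht : 0 ≤ t) :
    ren (μ.map (X 1)) (Ici 0) t = 1 +
      ∑' k, (lad (μ.map (X 1)) (Ici 0) (Measure.dirac 0) (k + 1)).real {x | |x| ≤ t} := by
  have : IsProbabilityMeasure (μ.map (X 1)) := Measure.isProbabilityMeasure_map (hX.1 1).aemeasurable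
  rw [ren, (summable_real_abs_le h (Or.inl rfl) t).tsum_eq_zero_add]
  congr 1
  simp [lad, Measure.real, Measure.dirac_apply' _ (measurableSet_abs_le t), ht]

lemma summable_real_abs_lt (hX : IIDseq μ X) (h : IsStep (μ.map (X 1)) σ) (t : ℝ) : Summable fun k =>
    (lad (μ.map (X 1)) (Ici 0) (Measure.dirac 0) (k + 1)).real {x | |x| < t} := by
  have : IsProbabilityMeasure (μ.map (X 1)) := Measure.isProbabilityMeasure_map (hX.1 1).aemeasurable
  exact Summable.of_nonneg_of_le (fun _ => measureReal_nonneg)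
    (fun _ => measureReal_mono fun x (hx : |x| < t) => hx.le)
    ((summable_real_abs_le h (Or.inl rfl) t).comp_injective (add_left_injective 1))

lemma vFun_neg_le_ren (hX : IIDseq μ X) (h : IsStep (μ.map (X 1)) σ) {t : ℝ} (ht : 0 ≤ t) :
    vFun μ X (-t) ≤ ren (μ.map (X 1)) (Ici 0) t := by
  have : IsProbabilityMeasure (μ.map (X 1)) := Measure.isProbabilityMeasure_map (hX.1 1).aemeasurable
  rw [vFun_eq_tsum hX ht, ren_Ici_eq h hX ht]
  gcongr 1 + ?_
  exact (summable_real_abs_lt hX h t).tsum_le_tsum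
    (fun _ => measureReal_mono fun x (hx : |x| < t) => hx.le)
    ((summable_real_abs_le h (Or.inl rfl) t).comp_injective (add_left_injective 1))

lemma ae_vFun_neg_eq (hX : IIDseq μ X) (h : IsStep (μ.map (X 1)) σ) :
    ∀ᵐ t : ℝ, 0 ≤ t → vFun μ X (-t) = ren (μ.map (X 1)) (Ici 0) t := by
  have : IsProbabilityMeasure (μ.map (X 1)) := Measure.isProbabilityMeasure_map (hX.1 1).aemeasurable
  have hk : ∀ k, ∀ᵐ t : ℝ,
      lad (μ.map (X 1)) (Ici 0) (Measure.dirac 0) (k + 1) {x | |x| = t} = 0 := fun k => by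
    filter_upwards [(Measure.countable_meas_level_set_pos
      (μ := lad (μ.map (X 1)) (Ici 0) (Measure.dirac 0) (k + 1))
      (g := fun x : ℝ => |x|) (by fun_prop)).ae_notMem volume] with t ht
    simpa using ht
  filter_upwards [ae_all_iff.2 hk] with t ht h0
  rw [vFun_eq_tsum hX h0, ren_Ici_eq h hX h0]
  congr 1
  refine tsum_congr fun k => measureReal_congr ?_
  have hu : {x : ℝ | |x| ≤ t} = {x | |x| < t} ∪ {x | |x| = t} := by
    ext x; exact le_iff_lt_or_eq (a := |x|)
  rw [hu]
  exact (union_ae_eq_left_of_ae_eq_empty (ae_eq_empty.2 (ht k))).symm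

lemma monotone_uFun (hX : IIDseq μ X) (h : IsStep (μ.map (X 1)) σ) : Monotone (uFun μ X) := by
  have : IsProbabilityMeasure (μ.map (X 1)) := Measure.isProbabilityMeasure_map (hX.1 1).aemeasurable
  intro x y hxy
  by_cases hx : 0 ≤ x
  · rw [uFun_eq_ren hX h hx, uFun_eq_ren hX h (hx.trans hxy)]
    exact monotone_ren h (Or.inr rfl) hxy
  · rw [uFun, if_neg hx]
    exact uFun_nonneg y

lemma antitone_vFun (hX : IIDseq μ X) (h : IsStep (μ.map (X 1)) σ) : Antitone (vFun μ X) := by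
  have : IsProbabilityMeasure (μ.map (X 1)) := Measure.isProbabilityMeasure_map (hX.1 1).aemeasurable
  intro x y hxy
  by_cases hy : y ≤ 0
  · rw [← neg_neg x, ← neg_neg y, vFun_eq_tsum hX (by linarith), vFun_eq_tsum hX (by linarith)]
    gcongr 1 + ?_
    exact (summable_real_abs_lt hX h _).tsum_le_tsum
      (fun _ => measureReal_mono fun z (hz : |z| < -y) => by
        rw [mem_ofPred_eq]; linarith) (summable_real_abs_lt hX h _)
  · rw [vFun, if_neg hy]
    exact vFun_nonneg x

lemma exists_uFun_le (hX : IIDseq μ X) (h : IsStep (μ.map (X 1)) σ) {s : ℝ} (hs : 0 < s) :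
    ∃ C, 0 < C ∧ ∀ x, uFun μ X x ≤ C * Real.exp (s * x) := by
  have : IsProbabilityMeasure (μ.map (X 1)) := Measure.isProbabilityMeasure_map (hX.1 1).aemeasurable
  refine ⟨∑' k, lap (lad (μ.map (X 1)) (Iio 0) (Measure.dirac 0) k) s + 1, ?_, fun x => ?_⟩
  · exact add_pos_of_nonneg_of_pos (tsum_nonneg fun _ => lap_nonneg _ _) one_pos
  by_cases hx : 0 ≤ x
  · rw [uFun_eq_ren hX h hx]
    have := ren_le h (Or.inr rfl : IsHalf (Iio 0)) x hs
    nlinarith [Real.exp_pos (s * x)]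
  · rw [uFun, if_neg hx]
    exact mul_nonneg (add_nonneg (tsum_nonneg fun _ => lap_nonneg _ _) zero_le_one)
      (Real.exp_pos _).le

lemma exists_vFun_le (hX : IIDseq μ X) (h : IsStep (μ.map (X 1)) σ) {s : ℝ} (hs : 0 < s) :
    ∃ C, 0 < C ∧ ∀ x, vFun μ X x ≤ C * Real.exp (-(s * x)) := by
  have : IsProbabilityMeasure (μ.map (X 1)) := Measure.isProbabilityMeasure_map (hX.1 1).aemeasurable
  refine ⟨∑' k, lap (lad (μ.map (X 1)) (Ici 0) (Measure.dirac 0) k) s + 1, ?_, fun x => ?_⟩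
  · exact add_pos_of_nonneg_of_pos (tsum_nonneg fun _ => lap_nonneg _ _) one_pos
  by_cases hx : x ≤ 0
  · have h1 := vFun_neg_le_ren hX h (t := -x) (by linarith)
    rw [neg_neg] at h1
    have := ren_le h (Or.inl rfl : IsHalf (Ici 0)) (-x) hs
    rw [mul_neg] at this
    nlinarith [Real.exp_pos (-(s * x))]
  · rw [vFun, if_neg hx]
    exact mul_nonneg (add_nonneg (tsum_nonneg fun _ => lap_nonneg _ _) zero_le_one)
      (Real.exp_pos _).le

end Harmonic

/-! ### Dominated convergence with varying bounds -/

theorem tendsto_integral_of_tendsto_bound {E : Type*} [MeasurableSpace E] {m : Measure E}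
    {f g : ℕ → E → ℝ} {f₀ g₀ : E → ℝ} (hfm : ∀ n, AEStronglyMeasurable (f n) m)
    (hg : ∀ n, Integrable (g n) m) (hg₀ : Integrable g₀ m)
    (hfg : ∀ n, ∀ᵐ x ∂m, |f n x| ≤ g n x)
    (hflim : ∀ᵐ x ∂m, Tendsto (fun n => f n x) atTop (𝓝 (f₀ x)))
    (hglim : ∀ᵐ x ∂m, Tendsto (fun n => g n x) atTop (𝓝 (g₀ x)))
    (hint : Tendsto (fun n => ∫ x, g n x ∂m) atTop (𝓝 (∫ x, g₀ x ∂m))) :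
    Tendsto (fun n => ∫ x, f n x ∂m) atTop (𝓝 (∫ x, f₀ x ∂m)) := by
  have hfg' := ae_all_iff.2 hfg
  have h1 : Tendsto (fun n => ∫ x, max (g₀ x - g n x) 0 ∂m) atTop (𝓝 0) := by
    suffices h : Tendsto (fun n => ∫ x, max (g₀ x - g n x) 0 ∂m) atTop (𝓝 (∫ _, (0 : ℝ) ∂m)) by
      simpa using h
    refine tendsto_integral_of_dominated_convergence (fun x => |g₀ x|)
      (fun n => ((hg₀.sub (hg n)).pos_part).aestronglyMeasurable) hg₀.abs (fun n => ?_) ?_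
    · filter_upwards [hfg n] with x hx
      rw [Real.norm_of_nonneg (le_max_right _ _)]
      exact max_le (by linarith [le_abs_self (g₀ x), abs_nonneg (f n x)]) (abs_nonneg _)
    · filter_upwards [hglim] with x hx
      have := (hx.const_sub (g₀ x)).max (tendsto_const_nhds (x := (0 : ℝ)))
      simpa using this
  have h2 : Tendsto (fun n => ∫ x, |g n x - g₀ x| ∂m) atTop (𝓝 0) := by
    have h3 : ∀ n, ∫ x, |g n x - g₀ x| ∂m =
        ((∫ x, g n x ∂m) - ∫ x, g₀ x ∂m) + 2 * ∫ x, max (g₀ x - g n x) 0 ∂m := fun n => by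
      have hi : Integrable (fun x => 2 * max (g₀ x - g n x) 0) m :=
        (hg₀.sub (hg n)).pos_part.const_mul 2
      have hi' : Integrable (fun x => g n x - g₀ x) m := (hg n).sub hg₀
      rw [← integral_sub (hg n) hg₀, ← integral_const_mul, ← integral_add hi' hi]
      congr 1 with x
      rcases le_total (g₀ x) (g n x) with h | h
      · rw [abs_of_nonneg (by linarith), max_eq_right (by linarith)]; ring
      · rw [abs_of_nonpos (by linarith), max_eq_left (by linarith)]; ring
    simp_rw [h3]
    simpa using (hint.sub_const (∫ x, g₀ x ∂m)).add (h1.const_mul 2)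
  have h4 : Tendsto (fun n => ∫ x, max (-g₀ x) (min (f n x) (g₀ x)) ∂m) atTop
      (𝓝 (∫ x, f₀ x ∂m)) := by
    refine tendsto_integral_of_dominated_convergence (fun x => |g₀ x|)
      (fun n => hg₀.neg.aestronglyMeasurable.sup ((hfm n).inf hg₀.aestronglyMeasurable))
      hg₀.abs (fun n => Eventually.of_forall fun x => ?_) ?_
    · rw [Real.norm_eq_abs, abs_le]
      exact ⟨(neg_le_neg (le_abs_self _)).trans (le_max_left _ _),
        max_le (neg_le_abs _) ((min_le_right _ _).trans (le_abs_self _))⟩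
    · filter_upwards [hflim, hglim, hfg'] with x hf hgx hx
      have hle : |f₀ x| ≤ g₀ x := le_of_tendsto_of_tendsto' hf.abs hgx hx
      have := (tendsto_const_nhds (x := -g₀ x)).max (hf.min (tendsto_const_nhds (x := g₀ x)))
      rwa [min_eq_left (abs_le.1 hle).2, max_eq_right (abs_le.1 hle).1] at this
  have hfi : ∀ n, Integrable (f n) m := fun n =>
    (hg n).mono' (hfm n) (by simpa only [Real.norm_eq_abs] using hfg n)
  have h5 : Tendsto (fun n => ∫ x, f n x - max (-g₀ x) (min (f n x) (g₀ x)) ∂m) atTop (𝓝 0) := by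
    refine squeeze_zero_norm (fun n => ?_) h2
    refine norm_integral_le_of_norm_le ((hg n).sub hg₀).abs ?_
    filter_upwards [hfg', hglim] with x hx hgx
    have h0 : 0 ≤ g₀ x := ge_of_tendsto' hgx fun n => (abs_nonneg _).trans (hx n)
    have := abs_le.1 (hx n)
    rw [Real.norm_eq_abs, abs_le]
    have h6 := le_abs_self (g n x - g₀ x)
    have h7 := abs_nonneg (g n x - g₀ x)
    rcases le_total (f n x) (g₀ x) with h | h
    · rw [min_eq_left h]
      rcases le_total (-g₀ x) (f n x) with h' | h'
      · rw [max_eq_right h']; constructor <;> linarith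
      · rw [max_eq_left h']; constructor <;> linarith
    · rw [min_eq_right h, max_eq_right (by linarith)]; constructor <;> linarith
  have h6 := h5.add h4
  rw [zero_add] at h6
  refine h6.congr fun n => ?_
  have hi : Integrable (fun x => max (-g₀ x) (min (f n x) (g₀ x))) m :=
    hg₀.neg.sup ((hfi n).inf hg₀)
  rw [integral_sub (hfi n) hi, sub_add_cancel]

/-! ### Splitting an i.i.d. sequence into independent blocks -/

section Glue

variable {E : Type*}

open Classical in
/-- The sequence whose entries with index in `T` are taken from `p.1` and whose other entries are
taken from `p.2`, after reindexing by `f`. -/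
def glue (T : Set ℕ) (f : ℕ → ℕ) (p : (ℕ → E) × (ℕ → E)) (i : ℕ) : E :=
  if i ∈ T then p.1 (f i) else p.2 (f i)

lemma glue_of_mem {T : Set ℕ} {f : ℕ → ℕ} (a b : ℕ → E) {i : ℕ} (h : i ∈ T) :
    glue T f (a, b) i = a (f i) := if_pos h

lemma glue_of_notMem {T : Set ℕ} {f : ℕ → ℕ} (a b : ℕ → E) {i : ℕ} (h : i ∉ T) :
    glue T f (a, b) i = b (f i) := if_neg h

variable [MeasurableSpace E]

lemma measurable_glue (T : Set ℕ) (f : ℕ → ℕ) : Measurable (glue (E := E) T f) := by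
  classical
  refine measurable_pi_iff.2 fun i => ?_
  by_cases h : i ∈ T
  · simp only [glue, if_pos h]; fun_prop
  · simp only [glue, if_neg h]; fun_prop

lemma infinitePi_forall_mem {ρ : Measure E} [IsProbabilityMeasure ρ] {f : ℕ → ℕ} {s : Finset ℕ}
    (hf : InjOn f s) {t : ℕ → Set E} (ht : ∀ i, MeasurableSet (t i)) :
    Measure.infinitePi (fun _ : ℕ => ρ) {a | ∀ i ∈ s, a (f i) ∈ t i} = ∏ i ∈ s, ρ (t i) := by
  classical
  set t' : ℕ → Set E := fun j => ⋂ i ∈ s, {x | f i = j → x ∈ t i}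
  have h1 : {a : ℕ → E | ∀ i ∈ s, a (f i) ∈ t i} = Set.pi (s.image f) t' := by
    ext a
    simp only [mem_ofPred_eq, Set.mem_pi, Finset.coe_image, mem_image, t', mem_iInter]
    constructor
    · rintro h _ - i hi rfl
      exact h i hi
    · intro h i hi
      exact h _ ⟨i, hi, rfl⟩ i hi rfl
  have h2 : ∀ i ∈ s, t' (f i) = t i := fun i hi => by
    ext x
    simp only [t', mem_iInter, mem_ofPred_eq]
    constructor
    · intro h
      exact h i hi rfl
    · intro h j hj hji
      rwa [hf hj hi hji]
  have h3 : ∀ j, MeasurableSet (t' j) := fun j =>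
    Finset.measurableSet_biInter _ fun i _ => by
      by_cases hij : f i = j
      · simpa [hij] using ht i
      · simp [hij]
  rw [h1, Measure.infinitePi_pi _ fun _ _ => h3 _, Finset.prod_image hf]
  exact Finset.prod_congr rfl fun i hi => by rw [h2 i hi]

theorem measurePreserving_glue (ρ : Measure E) [IsProbabilityMeasure ρ] {T : Set ℕ} {f : ℕ → ℕ}
    (h1 : InjOn f T) (h2 : InjOn f Tᶜ) :
    MeasurePreserving (glue (E := E) T f)
      ((Measure.infinitePi fun _ : ℕ => ρ).prod (Measure.infinitePi fun _ : ℕ => ρ))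
      (Measure.infinitePi fun _ : ℕ => ρ) := by
  classical
  refine ⟨measurable_glue T f, Measure.eq_infinitePi _ fun s t ht => ?_⟩
  have h3 : glue T f ⁻¹' Set.pi s t =
      {a : ℕ → E | ∀ i ∈ s.filter (· ∈ T), a (f i) ∈ t i} ×ˢ
        {a | ∀ i ∈ s.filter (· ∉ T), a (f i) ∈ t i} := by
    ext p
    simp only [mem_preimage, Set.mem_pi, glue, mem_prod, mem_ofPred_eq, Finset.mem_filter,
      SetLike.mem_coe]
    constructor
    · intro h
      exact ⟨fun i hi => by simpa [hi.2] using h i hi.1, fun i hi => by simpa [hi.2] using h i hi.1⟩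
    · rintro ⟨ha, hb⟩ i hi
      by_cases hT : i ∈ T
      · simpa [hT] using ha i ⟨hi, hT⟩
      · simpa [hT] using hb i ⟨hi, hT⟩
  rw [Measure.map_apply (measurable_glue T f) (MeasurableSet.pi s.countable_toSet fun i _ => ht i),
    h3, Measure.prod_prod, infinitePi_forall_mem (h1.mono fun i hi => by simp_all) ht,
    infinitePi_forall_mem (h2.mono fun i hi => by simp_all) ht,
    Finset.prod_filter_mul_prod_filter_not]

end Glue

/-! ### Path functionals of the environment -/

section Path

/-- The increment `X_i` of an environment path `(X_i, η_i)_i`. -/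
def cX (i : ℕ) (y : ℕ → ℝ × ℝ) : ℝ := (y i).1

/-- `∑_{i < n} η_{i+1} e^{-S_i}`. -/
def pB (n : ℕ) (y : ℕ → ℝ × ℝ) : ℝ :=
  ∑ i ∈ Finset.range n, (y (i + 1)).2 * Real.exp (-walk cX i y)

/-- `∑_{i < n} η_{i+1} e^{S_{i+1}}`. -/
def pC (n : ℕ) (y : ℕ → ℝ × ℝ) : ℝ :=
  ∑ i ∈ Finset.range n, (y (i + 1)).2 * Real.exp (walk cX (i + 1) y)

/-- The functional `pC K` of the path reversed from time `n`. -/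
def rC (K n : ℕ) (y : ℕ → ℝ × ℝ) : ℝ :=
  ∑ j ∈ Finset.range K, (y (n - j)).2 * Real.exp (walk cX n y - walk cX (n - j - 1) y)

/-- `max (S 0, ..., S K)`. -/
def pMax (K : ℕ) (y : ℕ → ℝ × ℝ) : ℝ :=
  (Finset.range (K + 1)).sup' (by simp) fun i => walk cX i y

lemma measurable_cX (i : ℕ) : Measurable (cX i) := by unfold cX; fun_prop

@[fun_prop]
lemma measurable_walk_cX (i : ℕ) : Measurable (walk cX i) :=
  measurable_walk_of fun j _ => measurable_cX j

@[fun_prop]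
lemma measurable_pB (n : ℕ) : Measurable (pB n) := by unfold pB; fun_prop

@[fun_prop]
lemma measurable_pC (n : ℕ) : Measurable (pC n) := by unfold pC; fun_prop

@[fun_prop]
lemma measurable_rC (K n : ℕ) : Measurable (rC K n) := by unfold rC; fun_prop

@[fun_prop]
lemma measurable_pMax (K : ℕ) : Measurable (pMax K) := by
  unfold pMax
  exact Finset.measurable_range_sup'' (f := fun i y => walk cX i y) fun i _ => measurable_walk_cX i

lemma measurableSet_staySet_cX {A : Set ℝ} (hA : MeasurableSet A) (x : ℝ) (n : ℕ) :
    MeasurableSet (staySet cX A x n) :=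
  measurableSet_staySet_of (fun i _ => measurable_cX i) hA x

/-- Path consisting of the first `K₁` steps of `p.1.1`, then the first `N` steps of `p.2`, then the
first `K₂` steps of `p.1.2` in reversed order. -/
def splice (K₁ N K₂ : ℕ) (p : ((ℕ → ℝ × ℝ) × (ℕ → ℝ × ℝ)) × (ℕ → ℝ × ℝ)) : ℕ → ℝ × ℝ :=
  glue (Icc 1 K₁) (fun i => if i ≤ K₁ then i else i - K₁)
    (p.1.1, glue (Icc (N + 1) (N + K₂))
      (fun i => if i ∈ Icc (N + 1) (N + K₂) then N + K₂ + 1 - i else i) (p.1.2, p.2))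

theorem measurePreserving_splice (ρ : Measure (ℝ × ℝ)) [IsProbabilityMeasure ρ] (K₁ N K₂ : ℕ) :
    MeasurePreserving (splice K₁ N K₂)
      (((Measure.infinitePi fun _ : ℕ => ρ).prod (Measure.infinitePi fun _ : ℕ => ρ)).prod
        (Measure.infinitePi fun _ : ℕ => ρ)) (Measure.infinitePi fun _ : ℕ => ρ) := by
  have h1 := measurePreserving_glue ρ (T := Icc 1 K₁) (f := fun i => if i ≤ K₁ then i else i - K₁)
    (fun i hi j hj h => by simp only [mem_Icc] at *; split_ifs at h <;> omega)
    (fun i hi j hj h => by simp only [mem_compl_iff, mem_Icc] at *; split_ifs at h <;> omega)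
  have h2 := measurePreserving_glue ρ (T := Icc (N + 1) (N + K₂))
    (f := fun i => if i ∈ Icc (N + 1) (N + K₂) then N + K₂ + 1 - i else i)
    (fun i hi j hj h => by simp only [mem_Icc] at *; split_ifs at h; omega)
    (fun i hi j hj h => by
      simp only [mem_compl_iff] at hi hj; simpa only [if_neg hi, if_neg hj] using h)
  exact h1.comp (((MeasurePreserving.id _).prod h2).comp
    (measurePreserving_prodAssoc _ _ _))

section Splice

variable {K₁ N K₂ : ℕ} {p : ((ℕ → ℝ × ℝ) × (ℕ → ℝ × ℝ)) × (ℕ → ℝ × ℝ)}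

lemma splice_left {i : ℕ} (h1 : 1 ≤ i) (h2 : i ≤ K₁) : splice K₁ N K₂ p i = p.1.1 i := by
  rw [splice, glue_of_mem _ _ (show i ∈ Icc 1 K₁ from ⟨h1, h2⟩), if_pos h2]

lemma splice_mid {i : ℕ} (h1 : 1 ≤ i) (h2 : i ≤ N) : splice K₁ N K₂ p (K₁ + i) = p.2 i := by
  have h3 : K₁ + i ∉ Icc 1 K₁ := fun h => by have := h.2; omega
  have h4 : i ∉ Icc (N + 1) (N + K₂) := fun h => by have := h.1; omega
  rw [splice, glue_of_notMem _ _ h3, if_neg (by omega), Nat.add_sub_cancel_left,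
    glue_of_notMem _ _ h4, if_neg h4]

lemma splice_right {j : ℕ} (h1 : 1 ≤ j) (h2 : j ≤ K₂) :
    splice K₁ N K₂ p (K₁ + N + j) = p.1.2 (K₂ + 1 - j) := by
  have h3 : K₁ + N + j ∉ Icc 1 K₁ := fun h => by have := h.2; omega
  have h4 : N + j ∈ Icc (N + 1) (N + K₂) := ⟨by omega, by omega⟩
  rw [splice, glue_of_notMem _ _ h3, if_neg (by omega),
    show K₁ + N + j - K₁ = N + j by omega, glue_of_mem _ _ h4, if_pos h4]
  show p.1.2 _ = _
  rw [show N + K₂ + 1 - (N + j) = K₂ + 1 - j by omega]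

lemma walk_splice_left {i : ℕ} (h : i ≤ K₁) :
    walk cX i (splice K₁ N K₂ p) = walk cX i p.1.1 := by
  refine Finset.sum_congr rfl fun j hj => ?_
  rw [Finset.mem_Icc] at hj
  rw [cX, splice_left hj.1 (hj.2.trans h), cX]

lemma walk_splice_mid {i : ℕ} (h : i ≤ N) :
    walk cX (K₁ + i) (splice K₁ N K₂ p) = walk cX K₁ p.1.1 + walk cX i p.2 := by
  induction i with
  | zero => simp [walk_splice_left, walk_zero]
  | succ i ih =>
    rw [← add_assoc, walk_succ, walk_succ, ih (by omega), cX, add_assoc K₁,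
      splice_mid (by omega) h, cX, add_assoc]

lemma walk_splice_right {j : ℕ} (h : j ≤ K₂) :
    walk cX (K₁ + N + j) (splice K₁ N K₂ p) = walk cX K₁ p.1.1 + walk cX N p.2 +
      (walk cX K₂ p.1.2 - walk cX (K₂ - j) p.1.2) := by
  induction j with
  | zero => simp [walk_splice_mid]
  | succ j ih =>
    have h1 : K₂ - j = (K₂ - (j + 1)) + 1 := by omega
    have h2 : K₂ + 1 - (j + 1) = K₂ - (j + 1) + 1 := by omega
    rw [← add_assoc (K₁ + N), walk_succ, ih (by omega), h1, walk_succ _ (K₂ - (j + 1)), cX, cX,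
      add_assoc (K₁ + N), splice_right (by omega) h, h2]
    ring

lemma pB_splice : pB K₁ (splice K₁ N K₂ p) = pB K₁ p.1.1 := by
  refine Finset.sum_congr rfl fun i hi => ?_
  rw [Finset.mem_range] at hi
  rw [splice_left (by omega) (by omega), walk_splice_left (by omega)]

lemma rC_splice : rC K₂ (K₁ + N + K₂) (splice K₁ N K₂ p) = pC K₂ p.1.2 := by
  refine Finset.sum_congr rfl fun j hj => ?_
  rw [Finset.mem_range] at hj
  rw [show K₁ + N + K₂ - j - 1 = K₁ + N + (K₂ - j - 1) by omega,
    show K₁ + N + K₂ - j = K₁ + N + (K₂ - j) by omega, splice_right (by omega) (by omega),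
    walk_splice_right le_rfl, walk_splice_right (by omega),
    show K₂ + 1 - (K₂ - j) = j + 1 by omega, show K₂ - (K₂ - j - 1) = j + 1 by omega,
    Nat.sub_self, walk_zero]
  congr 2
  ring

lemma walk_splice : walk cX (K₁ + N + K₂) (splice K₁ N K₂ p) =
    walk cX K₁ p.1.1 + walk cX N p.2 + walk cX K₂ p.1.2 := by
  rw [walk_splice_right le_rfl, Nat.sub_self, walk_zero, sub_zero]

lemma splice_mem_staySet (hN : 1 ≤ N) :
    splice K₁ N K₂ p ∈ staySet cX (Ici 0) 0 (K₁ + N + K₂) ↔ p.1.1 ∈ staySet cX (Ici 0) 0 K₁ ∧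
      p.2 ∈ staySet cX (Ici 0) (walk cX K₁ p.1.1) N ∧
      pMax K₂ p.1.2 - walk cX K₂ p.1.2 ≤ walk cX K₁ p.1.1 + walk cX N p.2 := by
  simp only [staySet, mem_ofPred_eq, Finset.mem_Icc, mem_Ici, zero_add]
  rw [pMax, sub_le_iff_le_add, Finset.sup'_le_iff]
  constructor
  · intro h
    refine ⟨fun i hi => ?_, fun i hi => ?_, fun i hi => ?_⟩
    · rw [← walk_splice_left (N := N) (K₂ := K₂) (p := p) hi.2]
      exact h i ⟨hi.1, by omega⟩
    · rw [← walk_splice_mid (K₂ := K₂) hi.2]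
      exact h _ ⟨by omega, by omega⟩
    · rw [Finset.mem_range] at hi
      have := h (K₁ + N + (K₂ - i)) ⟨by omega, by omega⟩
      rw [walk_splice_right (by omega), show K₂ - (K₂ - i) = i by omega] at this
      linarith
  · rintro ⟨h1, h2, h3⟩ i hi
    rcases le_or_gt i K₁ with hK | hK
    · rw [walk_splice_left hK]
      exact h1 i ⟨hi.1, hK⟩
    · obtain ⟨j, rfl⟩ := Nat.exists_eq_add_of_lt hK
      rcases le_or_gt (j + 1) N with hj | hj
      · rw [add_assoc, walk_splice_mid hj]
        exact h2 _ ⟨by omega, hj⟩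
      · obtain ⟨l, hl⟩ := Nat.exists_eq_add_of_lt hj
        obtain rfl : j = N + l := by omega
        rw [show K₁ + (N + l) + 1 = K₁ + N + (l + 1) by omega, walk_splice_right (by omega)]
        have := h3 (K₂ - (l + 1)) (Finset.mem_range.2 (by omega))
        linarith

end Splice

end Path

/-! ### Block decomposition of expectations over non-negative walks -/

section Block

/-- The law of an i.i.d. environment path. -/
abbrev pathLaw (ρ : Measure (ℝ × ℝ)) [IsProbabilityMeasure ρ] : Measure (ℕ → ℝ × ℝ) :=
  Measure.infinitePi fun _ : ℕ => ρ

variable {ρ : Measure (ℝ × ℝ)} [IsProbabilityMeasure ρ]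

lemma map_cX (i : ℕ) : (pathLaw ρ).map (cX i) = ρ.map Prod.fst := by
  have h := congrArg (Measure.map Prod.fst) (Measure.infinitePi_map_eval (fun _ : ℕ => ρ) i)
  rwa [Measure.map_map measurable_fst (by fun_prop)] at h

variable (ρ) in
lemma iid_cX : IIDseq (pathLaw ρ) cX :=
  ⟨measurable_cX, iIndepFun_infinitePi (X := fun _ => Prod.fst) fun _ => measurable_fst,
    fun i => ⟨(measurable_cX i).aemeasurable, (measurable_cX 1).aemeasurable, by
      rw [map_cX, map_cX]⟩⟩

/-- Integral over the middle block of the path, the outer blocks being given by `q`. -/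
def blockInt (F : ℝ → ℝ → ℝ → ℝ) (ν : Measure ℝ) (K₁ N K₂ : ℕ)
    (q : (ℕ → ℝ × ℝ) × (ℕ → ℝ × ℝ)) : ℝ :=
  (staySet cX (Ici 0) 0 K₁).indicator 1 q.1 * (Real.exp (-walk cX K₂ q.2) *
    ∫ w in {w | pMax K₂ q.2 - walk cX K₂ q.2 ≤ |w|}, Real.exp (-|w|) *
      F (pB K₁ q.1) (pC K₂ q.2) (Real.exp (-walk cX K₂ q.2) * Real.exp (-|w|))
        ∂lad ν (Ici 0) (Measure.dirac (walk cX K₁ q.1)) N)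

variable {F : ℝ → ℝ → ℝ → ℝ} {M : ℝ}

lemma integral_splice (hF : Continuous fun x : ℝ × ℝ × ℝ => F x.1 x.2.1 x.2.2) (K₁ K₂ : ℕ) {N : ℕ}
    (hN : 1 ≤ N) (q : (ℕ → ℝ × ℝ) × (ℕ → ℝ × ℝ)) :
    ∫ c, (staySet cX (Ici 0) 0 (K₁ + N + K₂)).indicator (fun y =>
      F (pB K₁ y) (rC K₂ (K₁ + N + K₂) y) (Real.exp (-walk cX (K₁ + N + K₂) y)) *
        Real.exp (-walk cX (K₁ + N + K₂) y)) (splice K₁ N K₂ (q, c)) ∂pathLaw ρ =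
      blockInt F (ρ.map Prod.fst) K₁ N K₂ q := by
  have hF3 : Measurable fun s => F (pB K₁ q.1) (pC K₂ q.2) s :=
    (hF.comp (by fun_prop : Continuous fun s : ℝ => (pB K₁ q.1, pC K₂ q.2, s))).measurable
  have hm : MeasurableSet {w : ℝ | pMax K₂ q.2 - walk cX K₂ q.2 ≤ |w|} :=
    measurableSet_le measurable_const (by fun_prop)
  have hs := measurableSet_staySet_cX (measurableSet_Ici (a := (0 : ℝ))) (walk cX K₁ q.1) N
  rw [blockInt, ← integral_const_mul, ← integral_indicator hm, ← map_cX (ρ := ρ) 1,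
    integral_lad (iid_cX ρ) measurableSet_Ici _ _ (by
      refine Measurable.indicator ?_ hm
      fun_prop), ← integral_const_mul, ← integral_indicator hs]
  congr 1 with c
  have hmem := splice_mem_staySet (K₁ := K₁) (K₂ := K₂) (p := (q, c)) hN
  by_cases h1 : q.1 ∈ staySet cX (Ici 0) 0 K₁
  swap
  · rw [indicator_of_notMem (fun h => h1 (hmem.1 h).1), indicator_of_notMem h1, indicator]
    simp
  by_cases h2 : c ∈ staySet cX (Ici 0) (walk cX K₁ q.1) N
  swap
  · rw [indicator_of_notMem (fun h => h2 (hmem.1 h).2.1), indicator_of_notMem h2]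
  obtain ⟨n, rfl⟩ := Nat.exists_eq_add_of_le' hN
  have hw : 0 ≤ walk cX K₁ q.1 + walk cX (n + 1) c := walk_mem_of_mem_staySet h2
  rw [indicator_of_mem h1, indicator_of_mem h2, Pi.one_apply, one_mul]
  by_cases h3 : pMax K₂ q.2 - walk cX K₂ q.2 ≤ walk cX K₁ q.1 + walk cX (n + 1) c
  · rw [indicator_of_mem (hmem.2 ⟨h1, h2, h3⟩), indicator_of_mem
      (by rwa [mem_ofPred_eq, abs_of_nonneg hw]), pB_splice, rC_splice, walk_splice,
      abs_of_nonneg hw, ← mul_assoc, ← Real.exp_add, mul_comm]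
    ring_nf
  · rw [indicator_of_notMem (fun h => h3 (hmem.1 h).2.2), indicator_of_notMem
      (by rwa [mem_ofPred_eq, abs_of_nonneg hw])]

lemma exp_neg_walk_le_one {Ω : Type*} {X : ℕ → Ω → ℝ} {n : ℕ} {ω : Ω}
    (h : ω ∈ staySet X (Ici 0) 0 n) : Real.exp (-walk X n ω) ≤ 1 := by
  rw [Real.exp_le_one_iff, neg_nonpos]
  rcases n with - | n
  · rw [walk_zero]
  · simpa using walk_mem_of_mem_staySet h

lemma integrable_indicator_mul_exp {H : (ℕ → ℝ × ℝ) → ℝ} (hH : Measurable H)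
    (hM : ∀ y, |H y| ≤ M) (n : ℕ) : Integrable ((staySet cX (Ici 0) 0 n).indicator fun y =>
      H y * Real.exp (-walk cX n y)) (pathLaw ρ) := by
  refine Integrable.of_bound (Measurable.aestronglyMeasurable
    (Measurable.indicator (by fun_prop) (measurableSet_staySet_cX measurableSet_Ici 0 n))) M
    (Eventually.of_forall fun y => ?_)
  by_cases hy : y ∈ staySet cX (Ici 0) 0 n
  · rw [indicator_of_mem hy, norm_mul, Real.norm_eq_abs, Real.norm_of_nonneg (Real.exp_pos _).le]
    have h1 := exp_neg_walk_le_one hy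
    have h2 := Real.exp_pos (-walk cX n y)
    nlinarith [hM y, abs_nonneg (H y)]
  · rw [indicator_of_notMem hy, norm_zero]
    exact (abs_nonneg _).trans (hM y)

variable (hF : Continuous fun x : ℝ × ℝ × ℝ => F x.1 x.2.1 x.2.2) (hM : ∀ b c s, |F b c s| ≤ M)
include hF hM

lemma integrable_splice (K₁ K₂ N : ℕ) : Integrable (fun p =>
    (staySet cX (Ici 0) 0 (K₁ + N + K₂)).indicator (fun y =>
      F (pB K₁ y) (rC K₂ (K₁ + N + K₂) y) (Real.exp (-walk cX (K₁ + N + K₂) y)) *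
        Real.exp (-walk cX (K₁ + N + K₂) y)) (splice K₁ N K₂ p))
    (((pathLaw ρ).prod (pathLaw ρ)).prod (pathLaw ρ)) := by
  refine (measurePreserving_splice ρ K₁ N K₂).integrable_comp_of_integrable
    (integrable_indicator_mul_exp (M := M) ?_ (fun y => hM _ _ _) _)
  have := hF.measurable
  exact this.comp (by fun_prop : Measurable fun y : ℕ → ℝ × ℝ => (pB K₁ y, rC K₂ (K₁ + N + K₂) y,
    Real.exp (-walk cX (K₁ + N + K₂) y)))

theorem setIntegral_staySet_eq (K₁ K₂ : ℕ) {N : ℕ} (hN : 1 ≤ N) :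
    ∫ y in staySet cX (Ici 0) 0 (K₁ + N + K₂),
      F (pB K₁ y) (rC K₂ (K₁ + N + K₂) y) (Real.exp (-walk cX (K₁ + N + K₂) y)) *
        Real.exp (-walk cX (K₁ + N + K₂) y) ∂pathLaw ρ =
      ∫ q, blockInt F (ρ.map Prod.fst) K₁ N K₂ q ∂(pathLaw ρ).prod (pathLaw ρ) := by
  rw [← integral_indicator (measurableSet_staySet_cX measurableSet_Ici _ _)]
  have hmap : Measure.map (splice K₁ N K₂) _ = pathLaw ρ :=
    (measurePreserving_splice ρ K₁ N K₂).map_eq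
  conv_lhs => rw [← hmap]
  rw [integral_map (measurePreserving_splice ρ K₁ N K₂).measurable.aemeasurable,
    integral_prod _ (integrable_splice hF hM K₁ K₂ N)]
  · simp_rw [integral_splice hF K₁ K₂ hN]
  · refine Measurable.aestronglyMeasurable (Measurable.indicator (Measurable.mul ?_ (by fun_prop))
      (measurableSet_staySet_cX measurableSet_Ici _ _))
    exact hF.measurable.comp (by fun_prop : Measurable fun y : ℕ → ℝ × ℝ =>
      (pB K₁ y, rC K₂ (K₁ + N + K₂) y, Real.exp (-walk cX (K₁ + N + K₂) y)))

lemma integrable_blockInt (K₁ K₂ : ℕ) {N : ℕ} (hN : 1 ≤ N) :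
    Integrable (blockInt F (ρ.map Prod.fst) K₁ N K₂) ((pathLaw ρ).prod (pathLaw ρ)) := by
  refine (integrable_splice hF hM K₁ K₂ N).integral_prod_left.congr
    (Eventually.of_forall fun q => ?_)
  exact integral_splice hF K₁ K₂ hN q

end Block

/-! ### Limit of the block integrals for blocks of fixed length -/

section BlockLim

variable {ρ : Measure (ℝ × ℝ)} [IsProbabilityMeasure ρ] {σ : ℝ} {F : ℝ → ℝ → ℝ → ℝ} {M κ : ℝ}

lemma IsStep.path (h : IsStep (ρ.map Prod.fst) σ) :
    IsStep ((pathLaw ρ).map (cX 1)) σ := by rwa [map_cX]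

lemma walk_le_pMax (K : ℕ) (y : ℕ → ℝ × ℝ) : walk cX K y ≤ pMax K y :=
  Finset.le_sup' (fun i => walk cX i y) (Finset.mem_range.2 (Nat.lt_succ_self K))

lemma lt_neg_pMax_iff {K : ℕ} {y : ℕ → ℝ × ℝ} {z : ℝ} :
    z < -pMax K y ↔ z < 0 ∧ y ∈ staySet cX (Iio 0) z K := by
  rw [lt_neg, pMax, Finset.sup'_lt_iff]
  constructor
  · intro h
    refine ⟨by simpa [walk_zero] using h 0 (by simp), fun i hi => ?_⟩
    have := h i (Finset.mem_range.2 (by have := Finset.mem_Icc.1 hi; omega))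
    exact show z + walk cX i y < 0 by linarith
  · rintro ⟨hz, h⟩ i hi
    rcases Nat.eq_zero_or_pos i with rfl | hi0
    · rw [walk_zero]; linarith
    · have : z + walk cX i y < 0 :=
        h i (Finset.mem_Icc.2 ⟨hi0, by have := Finset.mem_range.1 hi; omega⟩)
      linarith

/-- The limit of the rescaled block integrals. -/
def blockLim (F : ℝ → ℝ → ℝ → ℝ) (ρ : Measure (ℝ × ℝ)) [IsProbabilityMeasure ρ] (σ : ℝ) (K : ℕ)
    (q : (ℕ → ℝ × ℝ) × (ℕ → ℝ × ℝ)) : ℝ :=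
  llt σ * ((staySet cX (Ici 0) 0 K).indicator 1 q.1 * uFun (pathLaw ρ) cX (walk cX K q.1)) *
    ∫ z in Iio 0, (staySet cX (Iio 0) z K).indicator 1 q.2 * (Real.exp z *
      vFun (pathLaw ρ) cX (z + walk cX K q.2) * F (pB K q.1) (pC K q.2) (Real.exp z))

lemma setIntegral_reflect (h : IsStep (ρ.map Prod.fst) σ) (G : ℝ → ℝ) (K : ℕ)
    (y : ℕ → ℝ × ℝ) :
    Real.exp (-walk cX K y) * ∫ x in Ici (pMax K y - walk cX K y) ∩ Ioi 0,
      Real.exp (-x) * ren (ρ.map Prod.fst) (Ici 0) x * G (Real.exp (-walk cX K y) * Real.exp (-x)) =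
    ∫ z in Iio 0, (staySet cX (Iio 0) z K).indicator 1 y *
      (Real.exp z * vFun (pathLaw ρ) cX (z + walk cX K y) * G (Real.exp z)) := by
  have ha : 0 ≤ pMax K y - walk cX K y := sub_nonneg.2 (walk_le_pMax K y)
  set a := pMax K y - walk cX K y with had
  have hset : (Ici a ∩ Ioi 0 : Set ℝ) =ᵐ[volume] Ioi a := by
    refine (Ioi_ae_eq_Ici.symm.inter (ae_eq_refl _)).trans (Eventually.of_forall fun x => ?_)
    exact propext ⟨fun hx => hx.1, fun hx => ⟨hx, ha.trans_lt hx⟩⟩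
  rw [setIntegral_congr_set hset, ← integral_const_mul]
  have hv := ae_vFun_neg_eq (iid_cX ρ) h.path
  rw [map_cX] at hv
  rw [setIntegral_congr_ae (g := fun x => Real.exp (-walk cX K y - x) *
      vFun (pathLaw ρ) cX (-x) * G (Real.exp (-walk cX K y - x))) measurableSet_Ioi (by
    filter_upwards [hv] with x hx hxa
    rw [hx (ha.trans (le_of_lt hxa)), sub_eq_add_neg, Real.exp_add]
    ring), ← integral_indicator measurableSet_Ioi, ← integral_indicator measurableSet_Iio,
    ← integral_sub_left_eq_self _ volume (-walk cX K y)]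
  congr 1 with z
  have hz : -walk cX K y - z ∈ Ioi a ↔ z < -pMax K y := by
    rw [mem_Ioi, had]
    constructor <;> intro h <;> linarith
  by_cases h1 : z < -pMax K y
  · obtain ⟨h2, h3⟩ := lt_neg_pMax_iff.1 h1
    rw [indicator_of_mem (hz.2 h1), indicator_of_mem (mem_Iio.2 h2), indicator_of_mem h3,
      Pi.one_apply, one_mul]
    ring_nf
  · rw [indicator_of_notMem (fun h => h1 (hz.1 h))]
    by_cases h2 : z < 0
    · rw [indicator_of_mem (mem_Iio.2 h2), indicator_of_notMem fun h3 =>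
        h1 (lt_neg_pMax_iff.2 ⟨h2, h3⟩), zero_mul]
    · rw [indicator_of_notMem (s := Iio 0) (fun h => h2 h)]

lemma walk_nonneg_of_mem {Ω : Type*} {X : ℕ → Ω → ℝ} {n : ℕ} {ω : Ω}
    (h : ω ∈ staySet X (Ici 0) 0 n) : 0 ≤ walk X n ω := by
  rcases n with - | n
  · rw [walk_zero]
  · simpa using walk_mem_of_mem_staySet h

lemma tendsto_blockInt (h : IsStep (ρ.map Prod.fst) σ)
    (hF : Continuous fun x : ℝ × ℝ × ℝ => F x.1 x.2.1 x.2.2) (K : ℕ)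
    (q : (ℕ → ℝ × ℝ) × (ℕ → ℝ × ℝ)) :
    Tendsto (fun N : ℕ => (N : ℝ) ^ (3 / 2 : ℝ) * blockInt F (ρ.map Prod.fst) K N K q) atTop
      (𝓝 (blockLim F ρ σ K q)) := by
  have : IsProbabilityMeasure (ρ.map Prod.fst) :=
    Measure.isProbabilityMeasure_map measurable_fst.aemeasurable
  by_cases h1 : q.1 ∈ staySet cX (Ici 0) 0 K
  swap
  · simp [blockInt, blockLim, indicator_of_notMem h1]
  have hw := walk_nonneg_of_mem h1
  have h2 := tendsto_setIntegral_lad h hw (pMax K q.2 - walk cX K q.2)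
    (G := fun s => F (pB K q.1) (pC K q.2) (Real.exp (-walk cX K q.2) * s))
    (hF.comp (by fun_prop : Continuous fun s : ℝ =>
      (pB K q.1, pC K q.2, Real.exp (-walk cX K q.2) * s)))
  have h3 := h2.const_mul (Real.exp (-walk cX K q.2))
  have h4 := uFun_eq_ren (iid_cX ρ) h.path hw
  rw [map_cX] at h4
  rw [blockLim, indicator_of_mem h1, Pi.one_apply, one_mul,
    ← setIntegral_reflect h (F (pB K q.1) (pC K q.2)), h4]
  convert h3 using 1
  · ext N
    rw [blockInt, indicator_of_mem h1, Pi.one_apply, one_mul]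
    ring
  · congr 1
    ring

lemma blockInt_one (K N : ℕ) (q : (ℕ → ℝ × ℝ) × (ℕ → ℝ × ℝ)) {ν : Measure ℝ} :
    blockInt (fun _ _ _ => 1) ν K N 0 q = (staySet cX (Ici 0) 0 K).indicator 1 q.1 *
      lap (lad ν (Ici 0) (Measure.dirac (walk cX K q.1)) N) 1 := by
  have h1 : {w : ℝ | pMax 0 q.2 - walk cX 0 q.2 ≤ |w|} = univ := by
    ext w
    simp [pMax, walk_zero]
  rw [blockInt, h1, walk_zero, neg_zero, Real.exp_zero, one_mul, lap]
  simp

lemma setIntegral_exp_eq_lap (n : ℕ) : ∫ y in staySet cX (Ici 0) 0 n,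
    Real.exp (-walk cX n y) ∂pathLaw ρ =
      lap (lad (ρ.map Prod.fst) (Ici 0) (Measure.dirac 0) n) 1 := by
  rw [lap, ← map_cX (ρ := ρ) 1, integral_lad (iid_cX ρ) measurableSet_Ici _ _ (by fun_prop)]
  refine setIntegral_congr_fun (measurableSet_staySet_cX measurableSet_Ici _ _) fun y hy => ?_
  simp [abs_of_nonneg (walk_nonneg_of_mem hy)]

lemma integral_blockInt_one (K : ℕ) {N : ℕ} (hN : 1 ≤ N) :
    ∫ q, blockInt (fun _ _ _ => 1) (ρ.map Prod.fst) K N 0 q ∂(pathLaw ρ).prod (pathLaw ρ) =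
      lap (lad (ρ.map Prod.fst) (Ici 0) (Measure.dirac 0) (K + N)) 1 := by
  rw [← setIntegral_staySet_eq (M := 1) (by fun_prop) (by simp) K 0 hN, ← setIntegral_exp_eq_lap]
  simp

/-- The Laplace transform of the renewal measure of the non-negative walk, at `1`. -/
def renLap (ρ : Measure (ℝ × ℝ)) : ℝ :=
  ∑' k, lap (lad (ρ.map Prod.fst) (Ici 0) (Measure.dirac 0) k) 1

lemma tendsto_lap_lad_add (h : IsStep (ρ.map Prod.fst) σ) (K : ℕ) :
    Tendsto (fun N : ℕ => (N : ℝ) ^ (3 / 2 : ℝ) *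
      lap (lad (ρ.map Prod.fst) (Ici 0) (Measure.dirac 0) (K + N)) 1) atTop
        (𝓝 (llt σ * renLap ρ)) := by
  have : IsProbabilityMeasure (ρ.map Prod.fst) :=
    Measure.isProbabilityMeasure_map measurable_fst.aemeasurable
  have h1 := (tendsto_lap_lad_tsum h (Or.inl rfl : IsHalf (Ici 0)) one_pos).comp
    (tendsto_add_atTop_nat K)
  have h2 : Tendsto (fun N : ℕ => ((N : ℝ) / (N + K : ℝ)) ^ (3 / 2 : ℝ)) atTop (𝓝 1) := by
    have h3 : Tendsto (fun N : ℕ => (N : ℝ) / (N + K : ℝ)) atTop (𝓝 1) :=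
      tendsto_natCast_div_add_atTop (K : ℝ)
    simpa using h3.rpow_const (p := 3 / 2) (Or.inl one_ne_zero)
  have h3 := h2.mul h1
  rw [renLap, mul_comm (llt σ)]
  simp only [one_mul, div_one, Function.comp_def] at h3
  refine h3.congr' ?_
  filter_upwards [eventually_ge_atTop 1] with N hN
  have hN' : (0 : ℝ) < N := by exact_mod_cast hN
  rw [Real.div_rpow hN'.le (by positivity), ← mul_assoc, add_comm N K]
  push_cast
  rw [add_comm (N : ℝ), div_mul_cancel₀]
  positivity

end BlockLim

/-! ### Convergence of the block expectations -/

section BlockConv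

variable {ρ : Measure (ℝ × ℝ)} [IsProbabilityMeasure ρ] {σ : ℝ} {F : ℝ → ℝ → ℝ → ℝ} {M κ : ℝ}
  {Pp : Measure (ℕ → ℝ × ℝ)}

/-- The filtration generated by the coordinates of a path. -/
abbrev pathFil (n : ℕ) : MeasurableSpace (ℕ → ℝ × ℝ) :=
  envFiltration (fun i (y : ℕ → ℝ × ℝ) => y i) n

lemma exp_neg_walk_le_pow {y : ℕ → ℝ × ℝ} (hy : ∀ i, Real.exp (-cX i y) ≤ κ) (n : ℕ) :
    Real.exp (-walk cX n y) ≤ κ ^ n := by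
  induction n with
  | zero => simp [walk_zero]
  | succ n ih =>
    rw [walk_succ, neg_add, Real.exp_add, pow_succ]
    exact mul_le_mul ih (hy _) (Real.exp_pos _).le ((Real.exp_pos _).le.trans ih)

lemma integral_uFun_weight (hPp : IsPplus (pathLaw ρ) cX pathFil 0 Pp) (K : ℕ)
    {g : (ℕ → ℝ × ℝ) → ℝ} (hg : Measurable[pathFil K] g) (hb : ∃ C, ∀ y, |g y| ≤ C) :
    ∫ y, ((staySet cX (Ici 0) 0 K).indicator 1 y * uFun (pathLaw ρ) cX (walk cX K y)) * g y
      ∂pathLaw ρ = ∫ y, g y ∂Pp := by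
  rw [hPp.2 K g hg hb, uFun_zero, inv_one, one_mul]
  change _ = ∫ y in staySet cX (Ici 0) 0 K, _ ∂_
  rw [← integral_indicator (measurableSet_staySet_cX measurableSet_Ici _ _)]
  congr 1 with y
  by_cases hy : y ∈ staySet cX (Ici 0) 0 K
  · simp [indicator_of_mem hy, mul_comm]
  · simp [indicator_of_notMem hy]

lemma integral_uFun_weight_one (hPp : IsPplus (pathLaw ρ) cX pathFil 0 Pp) (K : ℕ) :
    ∫ y, (staySet cX (Ici 0) 0 K).indicator 1 y * uFun (pathLaw ρ) cX (walk cX K y) ∂pathLaw ρ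
      = 1 := by
  have := hPp.1
  simpa using integral_uFun_weight hPp K (g := fun _ => 1) measurable_const ⟨1, by simp⟩

lemma integrable_uFun_weight (hPp : IsPplus (pathLaw ρ) cX pathFil 0 Pp) (K : ℕ) :
    Integrable (fun y => (staySet cX (Ici 0) 0 K).indicator 1 y *
      uFun (pathLaw ρ) cX (walk cX K y)) (pathLaw ρ) := by
  by_contra hn
  exact zero_ne_one ((integral_undef hn).symm.trans (integral_uFun_weight_one hPp K))

lemma abs_blockInt_le (hM : ∀ b c s, |F b c s| ≤ M) {ν : Measure ℝ} [IsProbabilityMeasure ν]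
    (K N : ℕ) {q : (ℕ → ℝ × ℝ) × (ℕ → ℝ × ℝ)} (hq : ∀ i, Real.exp (-cX i q.2) ≤ κ) :
    |blockInt F ν K N K q| ≤ M * κ ^ K * blockInt (fun _ _ _ => 1) ν K N 0 q := by
  have hM0 : 0 ≤ M := (abs_nonneg _).trans (hM 0 0 0)
  by_cases h1 : q.1 ∈ staySet cX (Ici 0) 0 K
  swap
  · simp [blockInt, indicator_of_notMem h1]
  rw [blockInt_one, blockInt, indicator_of_mem h1, Pi.one_apply, one_mul, one_mul, abs_mul,
    abs_of_pos (Real.exp_pos _), mul_comm M, mul_assoc]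
  set m := lad ν (Ici 0) (Measure.dirac (walk cX K q.1)) N
  have hi : Integrable (fun w : ℝ => M * Real.exp (-(1 * |w|))) m :=
    (integrable_exp_abs zero_le_one).const_mul M
  refine mul_le_mul (exp_neg_walk_le_pow hq K) ?_ (abs_nonneg _) (by
    have := exp_neg_walk_le_pow hq K
    exact (Real.exp_pos _).le.trans this)
  rw [lap, ← integral_const_mul, ← Real.norm_eq_abs]
  refine (norm_integral_le_of_norm_le hi.integrableOn (Eventually.of_forall fun w => ?_)).trans
    (setIntegral_le_integral hi (Eventually.of_forall fun w => by positivity))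
  rw [norm_mul, Real.norm_of_nonneg (Real.exp_pos _).le, one_mul, mul_comm M]
  exact mul_le_mul_of_nonneg_left (hM _ _ _) (Real.exp_pos _).le

theorem tendsto_integral_blockInt (h : IsStep (ρ.map Prod.fst) σ)
    (hPp : IsPplus (pathLaw ρ) cX pathFil 0 Pp)
    (hκ : ∀ᵐ y ∂pathLaw ρ, ∀ i, Real.exp (-cX i y) ≤ κ)
    (hF : Continuous fun x : ℝ × ℝ × ℝ => F x.1 x.2.1 x.2.2) (hM : ∀ b c s, |F b c s| ≤ M)
    (K : ℕ) :
    Tendsto (fun N : ℕ => (N : ℝ) ^ (3 / 2 : ℝ) *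
      ∫ q, blockInt F (ρ.map Prod.fst) K N K q ∂(pathLaw ρ).prod (pathLaw ρ)) atTop
        (𝓝 (∫ q, blockLim F ρ σ K q ∂(pathLaw ρ).prod (pathLaw ρ))) := by
  have : IsProbabilityMeasure (ρ.map Prod.fst) :=
    Measure.isProbabilityMeasure_map measurable_fst.aemeasurable
  rw [← tendsto_add_atTop_iff_nat 1]
  simp_rw [← integral_const_mul]
  have h1 : ∀ b c s : ℝ, |(fun _ _ _ => 1 : ℝ → ℝ → ℝ → ℝ) b c s| ≤ 1 := by simp
  have hint : ∀ N : ℕ, Integrable (blockInt (fun _ _ _ => 1) (ρ.map Prod.fst) K (N + 1) 0)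
      ((pathLaw ρ).prod (pathLaw ρ)) := fun N =>
    integrable_blockInt (by fun_prop) h1 K 0 (Nat.succ_pos N)
  have hw := integrable_uFun_weight hPp K
  refine tendsto_integral_of_tendsto_bound
    (g := fun N q => ((N + 1 : ℕ) : ℝ) ^ (3 / 2 : ℝ) *
      (M * κ ^ K * blockInt (fun _ _ _ => 1) (ρ.map Prod.fst) K (N + 1) 0 q))
    (g₀ := fun q => M * κ ^ K * (llt σ * renLap ρ) * ((staySet cX (Ici 0) 0 K).indicator 1 q.1 *
      uFun (pathLaw ρ) cX (walk cX K q.1)))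
    (fun N => ((integrable_blockInt hF hM K K (Nat.succ_pos N)).const_mul _).aestronglyMeasurable)
    (fun N => ((hint N).const_mul _).const_mul _) ((hw.comp_fst _).const_mul _) (fun N => ?_)
    (Eventually.of_forall fun q => (tendsto_add_atTop_iff_nat 1).2 (tendsto_blockInt h hF K q))
    (Eventually.of_forall fun q => ?_) ?_
  · filter_upwards [Measure.quasiMeasurePreserving_snd.ae hκ] with q hq
    rw [abs_mul, abs_of_nonneg (by positivity)]
    exact mul_le_mul_of_nonneg_left (abs_blockInt_le hM K _ hq) (by positivity)
  · simp_rw [blockInt_one]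
    by_cases hq : q.1 ∈ staySet cX (Ici 0) 0 K
    swap
    · simp [indicator_of_notMem hq]
    have h2 := (tendsto_add_atTop_iff_nat 1).2 (tendsto_lap_lad_dirac h (walk_nonneg_of_mem hq)
      one_pos)
    have h3 := uFun_eq_ren (iid_cX ρ) h.path (walk_nonneg_of_mem hq)
    rw [map_cX] at h3
    simp only [indicator_of_mem hq, Pi.one_apply, one_mul, h3]
    convert h2.const_mul (M * κ ^ K) using 2
    · ring
    · rw [renLap]; ring
  · simp_rw [integral_const_mul, integral_blockInt_one K (Nat.succ_pos _)]
    rw [integral_fun_fst (μ := pathLaw ρ) (ν := pathLaw ρ) (f := fun y =>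
      (staySet cX (Ici 0) 0 K).indicator 1 y * uFun (pathLaw ρ) cX (walk cX K y)),
      integral_uFun_weight_one hPp]
    convert ((tendsto_add_atTop_iff_nat 1).2 (tendsto_lap_lad_add h K)).const_mul (M * κ ^ K)
      using 2
    · ring
    · simp

end BlockConv

/-! ### The limit as a mixture of the conditioned environments -/

section BlockMix

variable {ρ : Measure (ℝ × ℝ)} [IsProbabilityMeasure ρ] {σ : ℝ} {F : ℝ → ℝ → ℝ → ℝ} {M κ : ℝ}
  {Pp : Measure (ℕ → ℝ × ℝ)} {Pm : ℝ → Measure (ℕ → ℝ × ℝ)}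

lemma measurable_walk_pathFil {i n : ℕ} (hi : i ≤ n) : Measurable[pathFil n] (walk cX i) :=
  measurable_walk_of fun _ hj => measurable_fst.comp (measurable_envFiltration _
    (Finset.mem_Icc.2 ⟨(Finset.mem_Icc.1 hj).1, (Finset.mem_Icc.1 hj).2.trans hi⟩))

lemma measurable_eta_pathFil {i n : ℕ} (hi : i < n) :
    Measurable[pathFil n] fun y : ℕ → ℝ × ℝ => (y (i + 1)).2 :=
  measurable_snd.comp (measurable_envFiltration (fun i (y : ℕ → ℝ × ℝ) => y i)
    (Finset.mem_Icc.2 ⟨by omega, hi⟩))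

lemma measurable_pB_pathFil (n : ℕ) : Measurable[pathFil n] (pB n) :=
  Finset.measurable_fun_sum _ fun _ hi => (measurable_eta_pathFil (Finset.mem_range.1 hi)).mul
    (measurable_walk_pathFil (Finset.mem_range.1 hi).le).neg.exp

lemma measurable_pC_pathFil (n : ℕ) : Measurable[pathFil n] (pC n) :=
  Finset.measurable_fun_sum _ fun _ hi => (measurable_eta_pathFil (Finset.mem_range.1 hi)).mul
    (measurable_walk_pathFil (Finset.mem_range.1 hi)).exp

lemma integral_vFun_weight {z : ℝ} (hz : z ≤ 0) (hPm : IsPminus (pathLaw ρ) cX pathFil z (Pm z))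
    (K : ℕ) {g : (ℕ → ℝ × ℝ) → ℝ} (hg : Measurable[pathFil K] g) (hb : ∃ C, ∀ y, |g y| ≤ C) :
    ∫ y, (staySet cX (Iio 0) z K).indicator 1 y * (vFun (pathLaw ρ) cX (z + walk cX K y) * g y)
      ∂pathLaw ρ = vFun (pathLaw ρ) cX z * ∫ y, g y ∂Pm z := by
  rw [hPm.2 K g hg hb, mul_inv_cancel_left₀ (zero_lt_one.trans_le (one_le_vFun hz)).ne']
  change _ = ∫ y in staySet cX (Iio 0) z K, _ ∂_
  rw [← integral_indicator (measurableSet_staySet_cX measurableSet_Iio _ _)]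
  congr 1 with y
  by_cases hy : y ∈ staySet cX (Iio 0) z K
  · simp [indicator_of_mem hy, mul_comm]
  · simp [indicator_of_notMem hy]

/-- Mixture of the conditioned environments, evaluated through the functionals `B` and `C`. -/
def mixInt (F : ℝ → ℝ → ℝ → ℝ) (ρ : Measure (ℝ × ℝ)) [IsProbabilityMeasure ρ]
    (Pp : Measure (ℕ → ℝ × ℝ)) (Pm : ℝ → Measure (ℕ → ℝ × ℝ)) (B C : (ℕ → ℝ × ℝ) → ℝ) : ℝ :=
  ∫ z in Iio (0 : ℝ), Real.exp z * vFun (pathLaw ρ) cX z *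
    ∫ y₁, (∫ y₂, F (B y₁) (C y₂) (Real.exp z) ∂Pm z) ∂Pp

lemma measurable_triple {E : Type*} [MeasurableSpace E] {f g k : E → ℝ}
    (hF : Continuous fun x : ℝ × ℝ × ℝ => F x.1 x.2.1 x.2.2) (hf : Measurable f)
    (hg : Measurable g) (hk : Measurable k) : Measurable fun x => F (f x) (g x) (k x) :=
  hF.measurable.comp (hf.prodMk (hg.prodMk hk))

lemma integral_mix_eq (hPp : IsPplus (pathLaw ρ) cX pathFil 0 Pp) {z : ℝ} (hz : z ≤ 0)
    (hPm : IsPminus (pathLaw ρ) cX pathFil z (Pm z))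
    (hF : Continuous fun x : ℝ × ℝ × ℝ => F x.1 x.2.1 x.2.2) (hM : ∀ b c s, |F b c s| ≤ M)
    (K : ℕ) :
    ∫ y₁, (∫ y₂, (staySet cX (Ici 0) 0 K).indicator 1 y₁ * uFun (pathLaw ρ) cX (walk cX K y₁) *
      ((staySet cX (Iio 0) z K).indicator 1 y₂ * (Real.exp z *
        vFun (pathLaw ρ) cX (z + walk cX K y₂) * F (pB K y₁) (pC K y₂) (Real.exp z)))
          ∂pathLaw ρ) ∂pathLaw ρ =
      Real.exp z * vFun (pathLaw ρ) cX z *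
        ∫ y₁, (∫ y₂, F (pB K y₁) (pC K y₂) (Real.exp z) ∂Pm z) ∂Pp := by
  have := hPm.1
  have h1 : ∀ b, ∫ y₂, (staySet cX (Iio 0) z K).indicator 1 y₂ * (Real.exp z *
      vFun (pathLaw ρ) cX (z + walk cX K y₂) * F b (pC K y₂) (Real.exp z)) ∂pathLaw ρ =
        Real.exp z * vFun (pathLaw ρ) cX z * ∫ y₂, F b (pC K y₂) (Real.exp z) ∂Pm z := fun b => by
    rw [mul_assoc, ← integral_vFun_weight hz hPm K (g := fun y => F b (pC K y) (Real.exp z))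
      (hF.measurable.comp (measurable_const.prodMk
        ((measurable_pC_pathFil K).prodMk measurable_const))) ⟨M, fun y => hM _ _ _⟩,
      ← integral_const_mul]
    congr 1 with y
    ring
  simp_rw [integral_const_mul, h1]
  have h2 : Measurable fun b => ∫ y₂, F b (pC K y₂) (Real.exp z) ∂Pm z :=
    (StronglyMeasurable.integral_prod_right' (f := fun p : ℝ × (ℕ → ℝ × ℝ) =>
      F p.1 (pC K p.2) (Real.exp z)) (measurable_triple hF (by fun_prop) (by fun_prop)
        (by fun_prop)).stronglyMeasurable).measurable
  rw [← integral_uFun_weight hPp K (g := fun y₁ => ∫ y₂, F (pB K y₁) (pC K y₂) (Real.exp z) ∂Pm z)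
    (h2.comp (measurable_pB_pathFil K)) ⟨M, fun y => ?_⟩, ← integral_const_mul]
  · congr 1 with y
    ring
  · rw [← Real.norm_eq_abs]
    refine (norm_integral_le_of_norm_le_const (C := M)
      (Eventually.of_forall fun y₂ => ?_)).trans (by simp)
    exact hM _ _ _

lemma integrableOn_exp_half : IntegrableOn (fun z : ℝ => Real.exp (z / 2)) (Iio 0) := by
  simpa [div_eq_inv_mul] using
    (integrableOn_exp_mul_Iic (a := (1 / 2 : ℝ)) (by norm_num) 0).mono_set Iio_subset_Iic_self

theorem integral_blockLim (h : IsStep (ρ.map Prod.fst) σ)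
    (hPp : IsPplus (pathLaw ρ) cX pathFil 0 Pp)
    (hPm : ∀ z ≤ 0, IsPminus (pathLaw ρ) cX pathFil z (Pm z))
    (hκ : ∀ᵐ y ∂pathLaw ρ, ∀ i, Real.exp (-cX i y) ≤ κ)
    (hF : Continuous fun x : ℝ × ℝ × ℝ => F x.1 x.2.1 x.2.2) (hM : ∀ b c s, |F b c s| ≤ M)
    (K : ℕ) : IntegrableOn (fun z => Real.exp z * vFun (pathLaw ρ) cX z *
        ∫ y₁, (∫ y₂, F (pB K y₁) (pC K y₂) (Real.exp z) ∂Pm z) ∂Pp) (Iio 0) ∧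
      ∫ q, blockLim F ρ σ K q ∂(pathLaw ρ).prod (pathLaw ρ) =
        llt σ * mixInt F ρ Pp Pm (pB K) (pC K) := by
  obtain ⟨C, hC, hv⟩ := exists_vFun_le (iid_cX ρ) h.path (s := 1 / 2) (by norm_num)
  have hM0 : 0 ≤ M := (abs_nonneg _).trans (hM 0 0 0)
  have hmv : Measurable (vFun (pathLaw ρ) cX) := (antitone_vFun (iid_cX ρ) h.path).measurable
  have hmu : Measurable (uFun (pathLaw ρ) cX) := (monotone_uFun (iid_cX ρ) h.path).measurable
  have hms : MeasurableSet {p : (ℕ → ℝ × ℝ) × ℝ | p.1 ∈ staySet cX (Iio 0) p.2 K} := by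
    have : {p : (ℕ → ℝ × ℝ) × ℝ | p.1 ∈ staySet cX (Iio 0) p.2 K} =
        ⋂ i ∈ Finset.Icc 1 K, {p | p.2 + walk cX i p.1 < 0} := by ext; simp [staySet]
    rw [this]
    exact Finset.measurableSet_biInter _ fun i _ => measurableSet_lt (by fun_prop) (by fun_prop)
  have hmi : Measurable fun p : (ℕ → ℝ × ℝ) × ℝ =>
      (staySet cX (Iio 0) p.2 K).indicator (1 : (ℕ → ℝ × ℝ) → ℝ) p.1 :=
    (measurable_const (a := (1 : ℝ))).indicator hms
  have hmi' : Measurable ((staySet cX (Ici 0) 0 K).indicator (1 : (ℕ → ℝ × ℝ) → ℝ)) :=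
    measurable_const.indicator (measurableSet_staySet_cX measurableSet_Ici _ _)
  set Φ : (ℕ → ℝ × ℝ) × (ℕ → ℝ × ℝ) → ℝ → ℝ := fun q z =>
    (staySet cX (Ici 0) 0 K).indicator 1 q.1 * uFun (pathLaw ρ) cX (walk cX K q.1) *
      ((staySet cX (Iio 0) z K).indicator 1 q.2 * (Real.exp z *
        vFun (pathLaw ρ) cX (z + walk cX K q.2) * F (pB K q.1) (pC K q.2) (Real.exp z))) with hΦ
  have hmΦ : Measurable (Function.uncurry Φ) := by
    simp only [hΦ, Function.uncurry_def]
    have hmF := measurable_triple (E := ((ℕ → ℝ × ℝ) × (ℕ → ℝ × ℝ)) × ℝ) hF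
      (f := fun p => pB K p.1.1) (g := fun p => pC K p.1.2) (k := fun p => Real.exp p.2)
      (by fun_prop) (by fun_prop) (by fun_prop)
    have hmi2 : Measurable fun p : ((ℕ → ℝ × ℝ) × (ℕ → ℝ × ℝ)) × ℝ =>
      (staySet cX (Iio 0) p.2 K).indicator (1 : (ℕ → ℝ × ℝ) → ℝ) p.1.2 :=
      hmi.comp (by fun_prop : Measurable fun p : ((ℕ → ℝ × ℝ) × (ℕ → ℝ × ℝ)) × ℝ => (p.1.2, p.2))
    fun_prop
  have hw := integrable_uFun_weight hPp K
  have hwq := hw.comp_fst (pathLaw ρ)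
  have hint : Integrable (Function.uncurry Φ)
      (((pathLaw ρ).prod (pathLaw ρ)).prod (volume.restrict (Iio 0))) := by
    refine ((hwq.mul_prod (integrableOn_exp_half.const_mul (C * (1 + κ ^ K) * M)))).mono'
      hmΦ.aestronglyMeasurable ?_
    have := (Measure.quasiMeasurePreserving_snd (μ := pathLaw ρ) (ν := pathLaw ρ)).ae hκ
    filter_upwards [(Measure.quasiMeasurePreserving_fst (μ := (pathLaw ρ).prod (pathLaw ρ))
      (ν := volume.restrict (Iio (0 : ℝ)))).ae this] with p hp
    obtain ⟨⟨y₁, y₂⟩, z⟩ := p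
    simp only [Function.uncurry_apply_pair, hΦ]
    have hu : 0 ≤ (staySet cX (Ici 0) 0 K).indicator 1 y₁ * uFun (pathLaw ρ) cX (walk cX K y₁) :=
      mul_nonneg (indicator_nonneg (fun _ _ => zero_le_one) _) (uFun_nonneg _)
    rw [norm_mul, Real.norm_of_nonneg hu]
    refine mul_le_mul_of_nonneg_left ?_ hu
    have hi0 : 0 ≤ (staySet cX (Iio 0) z K).indicator (1 : (ℕ → ℝ × ℝ) → ℝ) y₂ :=
      indicator_nonneg (fun _ _ => zero_le_one) _
    have hi1 : (staySet cX (Iio 0) z K).indicator (1 : (ℕ → ℝ × ℝ) → ℝ) y₂ ≤ 1 :=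
      indicator_le_self' (fun _ _ => zero_le_one) _
    have hS := exp_neg_walk_le_pow hp K
    have hS' : Real.exp (-(1 / 2 * (z + walk cX K y₂))) ≤ Real.exp (-z / 2) * (1 + κ ^ K) := by
      have h3 : Real.exp (-(1 / 2 * (z + walk cX K y₂))) =
          Real.exp (-z / 2) * Real.exp (-walk cX K y₂ / 2) := by rw [← Real.exp_add]; ring_nf
      have h4 : Real.exp (-walk cX K y₂ / 2) ^ 2 = Real.exp (-walk cX K y₂) := by
        rw [← Real.exp_nat_mul]; push_cast; ring_nf
      rw [h3]
      refine mul_le_mul_of_nonneg_left ?_ (Real.exp_pos _).le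
      nlinarith [sq_nonneg (Real.exp (-walk cX K y₂ / 2) - 1)]
    rw [norm_mul, Real.norm_of_nonneg hi0, norm_mul, Real.norm_of_nonneg
      (mul_nonneg (Real.exp_pos _).le (vFun_nonneg _))]
    calc _ ≤ 1 * (Real.exp z * (C * (Real.exp (-z / 2) * (1 + κ ^ K))) * M) := by
          refine mul_le_mul hi1 (mul_le_mul ?_ (hM _ _ _) (abs_nonneg _) ?_) (by
            have := vFun_nonneg (μ := pathLaw ρ) (X := cX) (z + walk cX K y₂)
            positivity) zero_le_one
          · exact mul_le_mul_of_nonneg_left ((hv _).trans (mul_le_mul_of_nonneg_left hS' hC.le))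
              (Real.exp_pos _).le
          · have := (Real.exp_pos _).le.trans hS
            positivity
      _ = _ := by
          rw [show Real.exp z = Real.exp (z / 2) * Real.exp (z / 2) by
            rw [← Real.exp_add]; ring_nf, show Real.exp (-z / 2) = (Real.exp (z / 2))⁻¹ by
            rw [← Real.exp_neg]; ring_nf]
          have := (Real.exp_pos (z / 2)).ne'
          field_simp
  have h1 : ∀ q, blockLim F ρ σ K q = llt σ * ∫ z in Iio 0, Φ q z := fun q => by
    rw [blockLim, mul_assoc, ← integral_const_mul]
  have h2 := hint.swap.prod_right_ae
  have h3 : (fun z => ∫ q, Φ q z ∂(pathLaw ρ).prod (pathLaw ρ)) =ᵐ[volume.restrict (Iio 0)]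
      fun z => Real.exp z * vFun (pathLaw ρ) cX z *
        ∫ y₁, (∫ y₂, F (pB K y₁) (pC K y₂) (Real.exp z) ∂Pm z) ∂Pp := by
    filter_upwards [h2, ae_restrict_mem measurableSet_Iio] with z hz hz0
    rw [← integral_mix_eq hPp hz0.le (hPm z hz0.le) hF hM K]
    exact integral_prod (fun q => Φ q z) hz
  refine ⟨hint.integral_prod_right.congr h3, ?_⟩
  simp_rw [h1]
  rw [integral_const_mul, integral_integral_swap hint, mixInt, integral_congr_ae h3]

end BlockMix

/-! ### Letting the block length tend to infinity -/

section BlockLong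

lemma ae_summable_of_integral_min {E : Type*} [MeasurableSpace E] {m : Measure E}
    [IsFiniteMeasure m] {g : ℕ → E → ℝ} (hg : ∀ i, Measurable (g i)) (hg0 : ∀ i x, 0 ≤ g i x)
    (hs : Summable fun i => ∫ x, min 1 (g i x) ∂m) : ∀ᵐ x ∂m, Summable fun i => g i x := by
  have h0 : ∀ i x, 0 ≤ min 1 (g i x) := fun i x => le_min zero_le_one (hg0 i x)
  have hi : ∀ i, Integrable (fun x => min 1 (g i x)) m := fun i =>
    Integrable.of_bound (by fun_prop) 1 (Eventually.of_forall fun x => by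
      rw [Real.norm_of_nonneg (h0 i x)]; exact min_le_left _ _)
  have h1 : ∫⁻ x, ∑' i, ENNReal.ofReal (min 1 (g i x)) ∂m ≠ ⊤ := by
    rw [lintegral_tsum fun i => by fun_prop]
    simp_rw [← ofReal_integral_eq_lintegral_ofReal (hi _) (Eventually.of_forall (h0 _))]
    exact hs.tsum_ofReal_ne_top
  filter_upwards [ae_lt_top' (by fun_prop) h1] with x hx
  have h2 : Summable fun i => min 1 (g i x) :=
    (ENNReal.summable_toReal hx.ne).congr fun i => ENNReal.toReal_ofReal (h0 i x)
  refine h2.congr_cofinite ?_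
  rw [Nat.cofinite_eq_atTop]
  filter_upwards [h2.tendsto_atTop_zero.eventually (gt_mem_nhds one_pos)] with i hi
  exact min_eq_right ((min_lt_iff.1 hi).resolve_left (lt_irrefl _)).le

variable {ρ : Measure (ℝ × ℝ)} [IsProbabilityMeasure ρ] {σ : ℝ} {F : ℝ → ℝ → ℝ → ℝ} {M κ : ℝ}
  {Pp : Measure (ℕ → ℝ × ℝ)} {Pm : ℝ → Measure (ℕ → ℝ × ℝ)}

/-- `∑_i η_{i+1} e^{-S_i}`. -/
def pBinf (y : ℕ → ℝ × ℝ) : ℝ := ∑' i, (y (i + 1)).2 * Real.exp (-walk cX i y)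

/-- `∑_i η_{i+1} e^{S_{i+1}}`. -/
def pCinf (y : ℕ → ℝ × ℝ) : ℝ := ∑' i, (y (i + 1)).2 * Real.exp (walk cX (i + 1) y)

lemma ae_of_integral_indicator {m : Measure (ℕ → ℝ × ℝ)} [IsFiniteMeasure m] {i : ℕ}
    (h : ∀ g : (ℕ → ℝ × ℝ) → ℝ, Measurable[pathFil (i + 1)] g → (∀ y, |g y| ≤ 1) →
      g =ᵐ[pathLaw ρ] 0 → ∫ y, g y ∂m = 0)
    (hη : ∀ᵐ y ∂pathLaw ρ, (y (i + 1)).2 ∈ Icc 0 κ) : ∀ᵐ y ∂m, (y (i + 1)).2 ∈ Icc 0 κ := by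
  have hs : MeasurableSet[pathFil (i + 1)] {y : ℕ → ℝ × ℝ | (y (i + 1)).2 ∉ Icc 0 κ} :=
    (measurable_eta_pathFil (Nat.lt_succ_self i)) measurableSet_Icc.compl
  have hs' : MeasurableSet {y : ℕ → ℝ × ℝ | (y (i + 1)).2 ∉ Icc 0 κ} :=
    envFiltration_le (fun i => measurable_pi_apply i) _ _ hs
  have h1 := h (indicator {y | (y (i + 1)).2 ∉ Icc 0 κ} 1) (measurable_const.indicator hs)
    (fun y => by
      by_cases hy : y ∈ {y : ℕ → ℝ × ℝ | (y (i + 1)).2 ∉ Icc 0 κ}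
      · rw [indicator_of_mem hy]; simp
      · rw [indicator_of_notMem hy]; simp) (by
      filter_upwards [hη] with y hy
      exact indicator_of_notMem
        (s := {y : ℕ → ℝ × ℝ | (y (i + 1)).2 ∉ Icc 0 κ}) (fun hy' => hy' hy) _)
  rw [integral_indicator_one hs', measureReal_eq_zero_iff] at h1
  rw [ae_iff]
  exact h1

lemma ae_eta_mem_of_isPplus (hPp : IsPplus (pathLaw ρ) cX pathFil 0 Pp)
    (hη : ∀ᵐ y ∂pathLaw ρ, ∀ i, (y i).2 ∈ Icc 0 κ) : ∀ᵐ y ∂Pp, ∀ i, (y (i + 1)).2 ∈ Icc 0 κ := by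
  have := hPp.1
  refine ae_all_iff.2 fun i => ae_of_integral_indicator (ρ := ρ) (fun g hg hb h0 => ?_)
    (hη.mono fun y hy => hy _)
  rw [← integral_uFun_weight hPp (i + 1) hg ⟨1, hb⟩]
  refine integral_eq_zero_of_ae (h0.mono fun y hy => ?_)
  simp only [hy, Pi.zero_apply, mul_zero]

lemma ae_eta_mem_of_isPminus {z : ℝ} (hz : z ≤ 0)
    (hPm : IsPminus (pathLaw ρ) cX pathFil z (Pm z))
    (hη : ∀ᵐ y ∂pathLaw ρ, ∀ i, (y i).2 ∈ Icc 0 κ) :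
    ∀ᵐ y ∂Pm z, ∀ i, (y (i + 1)).2 ∈ Icc 0 κ := by
  have := hPm.1
  refine ae_all_iff.2 fun i => ae_of_integral_indicator (ρ := ρ) (fun g hg hb h0 => ?_)
    (hη.mono fun y hy => hy _)
  have hv : vFun (pathLaw ρ) cX z ≠ 0 := (zero_lt_one.trans_le (one_le_vFun hz)).ne'
  refine (mul_eq_zero.1 ?_).resolve_left hv
  rw [← integral_vFun_weight hz hPm (i + 1) hg ⟨1, hb⟩]
  refine integral_eq_zero_of_ae (h0.mono fun y hy => ?_)
  simp only [hy, Pi.zero_apply, mul_zero]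

lemma abs_min_one_exp_le (x : ℝ) : |min 1 (Real.exp x)| ≤ 1 := by
  rw [abs_of_nonneg (le_min zero_le_one (Real.exp_pos _).le)]
  exact min_le_left _ _

lemma ae_tendsto_pB (h : IsStep (ρ.map Prod.fst) σ) (hPp : IsPplus (pathLaw ρ) cX pathFil 0 Pp)
    (hη : ∀ᵐ y ∂pathLaw ρ, ∀ i, (y i).2 ∈ Icc 0 κ) :
    ∀ᵐ y ∂Pp, Tendsto (fun n => pB n y) atTop (𝓝 (pBinf y)) := by
  have : IsProbabilityMeasure (ρ.map Prod.fst) :=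
    Measure.isProbabilityMeasure_map measurable_fst.aemeasurable
  have := hPp.1
  obtain ⟨C, hC, hu⟩ := exists_uFun_le (iid_cX ρ) h.path (s := 1 / 2) (by norm_num)
  have h1 : ∀ i, ∫ y, min 1 (Real.exp (-walk cX i y)) ∂Pp ≤
      C * lap (lad (ρ.map Prod.fst) (Ici 0) (Measure.dirac 0) i) (1 / 2) := fun i => by
    rw [← integral_uFun_weight hPp i (g := fun y => min 1 (Real.exp (-walk cX i y)))
      (measurable_const.min (measurable_walk_pathFil le_rfl).neg.exp)
      ⟨1, fun y => abs_min_one_exp_le _⟩, lap, ← map_cX (ρ := ρ) 1,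
      integral_lad (iid_cX ρ) measurableSet_Ici _ _ (by fun_prop), ← integral_const_mul,
      ← integral_indicator (measurableSet_staySet_cX measurableSet_Ici _ _)]
    refine integral_mono_of_nonneg (Eventually.of_forall fun y => ?_) ?_
      (Eventually.of_forall fun y => ?_)
    · exact mul_nonneg (mul_nonneg (indicator_nonneg (fun _ _ => zero_le_one) _) (uFun_nonneg _))
        (le_min zero_le_one (Real.exp_pos _).le)
    · refine Integrable.indicator (Integrable.of_bound (by fun_prop) C
        (Eventually.of_forall fun y => ?_))
        (measurableSet_staySet_cX measurableSet_Ici _ _)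
      rw [Real.norm_of_nonneg (by positivity)]
      exact mul_le_of_le_one_right hC.le (exp_neg_abs_le (by norm_num) _)
    · by_cases hy : y ∈ staySet cX (Ici 0) 0 i
      · simp only [indicator_of_mem hy, Pi.one_apply, one_mul, zero_add]
        rw [abs_of_nonneg (walk_nonneg_of_mem hy)]
        calc _ ≤ C * Real.exp (1 / 2 * walk cX i y) * Real.exp (-walk cX i y) :=
              mul_le_mul (hu _) (min_le_right _ _) (le_min zero_le_one (Real.exp_pos _).le)
                (by positivity)
          _ = _ := by rw [mul_assoc, ← Real.exp_add]; ring_nf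
      · simp [indicator_of_notMem hy]
  have hs : Summable fun i => ∫ y, min 1 (Real.exp (-walk cX i y)) ∂Pp :=
    Summable.of_nonneg_of_le (fun i => integral_nonneg fun y =>
      le_min zero_le_one (Real.exp_pos _).le) h1
      ((summable_lap_lad h (Or.inl rfl) (by norm_num)).mul_left C)
  filter_upwards [ae_summable_of_integral_min (fun i => by fun_prop)
    (fun i y => (Real.exp_pos _).le) hs, ae_eta_mem_of_isPplus hPp hη] with y hy hy'
  exact (Summable.of_nonneg_of_le (fun i => mul_nonneg (hy' i).1 (Real.exp_pos _).le)
    (fun i => mul_le_mul_of_nonneg_right (hy' i).2 (Real.exp_pos _).le)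
    (hy.mul_left κ)).hasSum.tendsto_sum_nat

lemma ae_tendsto_pC (h : IsStep (ρ.map Prod.fst) σ) {z : ℝ} (hz : z < 0)
    (hPm : IsPminus (pathLaw ρ) cX pathFil z (Pm z))
    (hη : ∀ᵐ y ∂pathLaw ρ, ∀ i, (y i).2 ∈ Icc 0 κ) :
    ∀ᵐ y ∂Pm z, Tendsto (fun n => pC n y) atTop (𝓝 (pCinf y)) := by
  have : IsProbabilityMeasure (ρ.map Prod.fst) :=
    Measure.isProbabilityMeasure_map measurable_fst.aemeasurable
  have := hPm.1
  have hv0 : 0 < vFun (pathLaw ρ) cX z := zero_lt_one.trans_le (one_le_vFun hz.le)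
  obtain ⟨C, hC, hv⟩ := exists_vFun_le (iid_cX ρ) h.path (s := 1 / 2) (by norm_num)
  have h1 : ∀ i, ∫ y, min 1 (Real.exp (walk cX (i + 1) y)) ∂Pm z ≤
      (vFun (pathLaw ρ) cX z)⁻¹ * (C * Real.exp (-z) *
        lap (lad (ρ.map Prod.fst) (Iio 0) (Measure.dirac z) (i + 1)) (1 / 2)) := fun i => by
    rw [← div_eq_inv_mul, le_div_iff₀ hv0, mul_comm,
      ← integral_vFun_weight hz.le hPm (i + 1) (g := fun y => min 1 (Real.exp (walk cX (i + 1) y)))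
      (measurable_const.min (measurable_walk_pathFil le_rfl).exp)
      ⟨1, fun y => abs_min_one_exp_le _⟩, lap, ← map_cX (ρ := ρ) 1,
      integral_lad (iid_cX ρ) measurableSet_Iio _ _ (by fun_prop), ← integral_const_mul,
      ← integral_indicator (measurableSet_staySet_cX measurableSet_Iio _ _)]
    refine integral_mono_of_nonneg (Eventually.of_forall fun y => ?_) ?_
      (Eventually.of_forall fun y => ?_)
    · exact mul_nonneg (indicator_nonneg (fun _ _ => zero_le_one) _) (mul_nonneg (vFun_nonneg _)
        (le_min zero_le_one (Real.exp_pos _).le))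
    · refine Integrable.indicator (Integrable.of_bound (by fun_prop) (C * Real.exp (-z))
        (Eventually.of_forall fun y => ?_))
        (measurableSet_staySet_cX measurableSet_Iio _ _)
      rw [Real.norm_of_nonneg (by positivity)]
      exact mul_le_of_le_one_right (by positivity) (exp_neg_abs_le (by norm_num) _)
    · by_cases hy : y ∈ staySet cX (Iio 0) z (i + 1)
      · have hw : z + walk cX (i + 1) y < 0 := walk_mem_of_mem_staySet hy
        simp only [indicator_of_mem hy, Pi.one_apply, one_mul]
        rw [abs_of_neg hw]
        calc _ ≤ C * Real.exp (-(1 / 2 * (z + walk cX (i + 1) y))) *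
                Real.exp (walk cX (i + 1) y) :=
              mul_le_mul (hv _) (min_le_right _ _) (le_min zero_le_one (Real.exp_pos _).le)
                (by positivity)
          _ = _ := by rw [mul_assoc, mul_assoc, ← Real.exp_add, ← Real.exp_add]; ring_nf
      · simp [indicator_of_notMem hy]
  have h2 : Summable fun i => lap (lad (ρ.map Prod.fst) (Iio 0) (Measure.dirac z) i) (1 / 2) := by
    obtain ⟨D, -, hD⟩ := exists_lap_lad_dirac_le h (Or.inr rfl : IsHalf (Iio 0))
      (lam := 1 / 2) (by norm_num) one_pos
    exact summable_of_rpow_bound (fun _ => lap_nonneg _ _) (by norm_num) fun n _ => hD z hz n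
  have hs : Summable fun i => ∫ y, min 1 (Real.exp (walk cX (i + 1) y)) ∂Pm z :=
    Summable.of_nonneg_of_le (fun i => integral_nonneg fun y =>
      le_min zero_le_one (Real.exp_pos _).le) h1
      ((((summable_nat_add_iff 1).2 h2).mul_left _).mul_left _)
  filter_upwards [ae_summable_of_integral_min (fun i => by fun_prop)
    (fun i y => (Real.exp_pos _).le) hs, ae_eta_mem_of_isPminus hz.le hPm hη] with y hy hy'
  exact (Summable.of_nonneg_of_le (fun i => mul_nonneg (hy' i).1 (Real.exp_pos _).le)
    (fun i => mul_le_mul_of_nonneg_right (hy' i).2 (Real.exp_pos _).le)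
    (hy.mul_left κ)).hasSum.tendsto_sum_nat

theorem tendsto_mixInt (h : IsStep (ρ.map Prod.fst) σ)
    (hPp : IsPplus (pathLaw ρ) cX pathFil 0 Pp)
    (hPm : ∀ z ≤ 0, IsPminus (pathLaw ρ) cX pathFil z (Pm z))
    (hκ : ∀ᵐ y ∂pathLaw ρ, ∀ i, Real.exp (-cX i y) ≤ κ)
    (hη : ∀ᵐ y ∂pathLaw ρ, ∀ i, (y i).2 ∈ Icc 0 κ)
    (hF : Continuous fun x : ℝ × ℝ × ℝ => F x.1 x.2.1 x.2.2) (hM : ∀ b c s, |F b c s| ≤ M) :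
    Tendsto (fun K => mixInt F ρ Pp Pm (pB K) (pC K)) atTop
      (𝓝 (mixInt F ρ Pp Pm pBinf pCinf)) := by
  have := hPp.1
  obtain ⟨C, hC, hv⟩ := exists_vFun_le (iid_cX ρ) h.path (s := 1 / 2) (by norm_num)
  have hM0 : 0 ≤ M := (abs_nonneg _).trans (hM 0 0 0)
  refine tendsto_integral_of_dominated_convergence (fun z => C * M * Real.exp (z / 2))
    (fun K => (integral_blockLim h hPp hPm hκ hF hM K).1.aestronglyMeasurable)
    (integrableOn_exp_half.const_mul _) (fun K => ?_) ?_
  · filter_upwards [ae_restrict_mem measurableSet_Iio] with z hz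
    have := (hPm z hz.le).1
    have h1 : ∀ b, ‖∫ y₂, F b (pC K y₂) (Real.exp z) ∂Pm z‖ ≤ M := fun b =>
      (norm_integral_le_of_norm_le_const (C := M) (Eventually.of_forall fun y₂ =>
        hM _ _ _)).trans (by simp)
    have h2 : ‖∫ y₁, (∫ y₂, F (pB K y₁) (pC K y₂) (Real.exp z) ∂Pm z) ∂Pp‖ ≤ M :=
      (norm_integral_le_of_norm_le_const (C := M) (Eventually.of_forall fun y₁ =>
        h1 _)).trans (by simp)
    rw [norm_mul, Real.norm_of_nonneg (mul_nonneg (Real.exp_pos _).le (vFun_nonneg _))]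
    calc _ ≤ Real.exp z * (C * Real.exp (-(1 / 2 * z))) * M :=
          mul_le_mul (mul_le_mul_of_nonneg_left (hv z) (Real.exp_pos _).le) h2 (norm_nonneg _)
            (by positivity)
      _ = C * M * (Real.exp z * Real.exp (-(1 / 2 * z))) := by ring
      _ = _ := by rw [← Real.exp_add]; ring_nf
  · filter_upwards [ae_restrict_mem measurableSet_Iio] with z hz
    have := (hPm z hz.le).1
    refine Tendsto.const_mul _ ?_
    refine tendsto_integral_of_dominated_convergence (fun _ => M) (fun K => ?_)
      (integrable_const M) (fun K => Eventually.of_forall fun y₁ =>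
        (norm_integral_le_of_norm_le_const (C := M) (Eventually.of_forall fun y₂ =>
          hM _ _ _)).trans (by simp)) ?_
    · exact (StronglyMeasurable.integral_prod_right'
        (f := fun p : (ℕ → ℝ × ℝ) × (ℕ → ℝ × ℝ) => F (pB K p.1) (pC K p.2) (Real.exp z))
        (measurable_triple hF (by fun_prop) (by fun_prop)
          (by fun_prop)).stronglyMeasurable).aestronglyMeasurable
    · filter_upwards [ae_tendsto_pB h hPp hη] with y₁ hy₁
      refine tendsto_integral_of_dominated_convergence (fun _ => M) (fun K =>
        (measurable_triple hF (by fun_prop) (by fun_prop) (by fun_prop)).aestronglyMeasurable)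
        (integrable_const M) (fun K => Eventually.of_forall fun y₂ => hM _ _ _) ?_
      filter_upwards [ae_tendsto_pC h hz (hPm z hz.le) hη] with y₂ hy₂
      exact (hF.tendsto (pBinf y₁, pCinf y₂, Real.exp z)).comp
        (hy₁.prodMk_nhds (hy₂.prodMk_nhds tendsto_const_nhds))

end BlockLong

/-! ### The middle part of a convolution -/

lemma tendsto_rpow_shift {x : ℕ → ℝ} {A : ℝ} (d : ℕ)
    (h : Tendsto (fun n : ℕ => (n : ℝ) ^ (3 / 2 : ℝ) * x (n + d)) atTop (𝓝 A)) :
    Tendsto (fun n : ℕ => (n : ℝ) ^ (3 / 2 : ℝ) * x n) atTop (𝓝 A) := by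
  rw [← tendsto_add_atTop_iff_nat d]
  have h1 : Tendsto (fun n : ℕ => ((n : ℝ) / (n + d : ℝ)) ^ (-(3 / 2) : ℝ)) atTop (𝓝 1) := by
    simpa using (tendsto_natCast_div_add_atTop (d : ℝ)).rpow_const (p := -(3 / 2))
      (Or.inl one_ne_zero)
  have h2 := h1.mul h
  rw [one_mul] at h2
  refine h2.congr' ?_
  filter_upwards [eventually_ge_atTop 1] with n hn
  have hn' : (0 : ℝ) < n := by exact_mod_cast hn
  rw [Real.rpow_neg (by positivity), Real.div_rpow hn'.le (by positivity), inv_div, ← mul_assoc,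
    div_mul_cancel₀ _ (by positivity)]
  push_cast
  rfl

lemma tendsto_rpow_mul_sub {b : ℕ → ℝ} {B : ℝ}
    (hb : Tendsto (fun n : ℕ => (n : ℝ) ^ (3 / 2 : ℝ) * b n) atTop (𝓝 B)) (j : ℕ) :
    Tendsto (fun n : ℕ => (n : ℝ) ^ (3 / 2 : ℝ) * b (n - j)) atTop (𝓝 B) := by
  refine tendsto_rpow_shift j (x := fun n => b (n - j)) ?_
  simpa using hb

lemma tendsto_conv_middle {a b : ℕ → ℝ} (ha0 : ∀ n, 0 ≤ a n) (hb0 : ∀ n, 0 ≤ b n) {A B : ℝ}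
    (ha : Tendsto (fun n : ℕ => (n : ℝ) ^ (3 / 2 : ℝ) * a n) atTop (𝓝 A))
    (hb : Tendsto (fun n : ℕ => (n : ℝ) ^ (3 / 2 : ℝ) * b n) atTop (𝓝 B)) (K : ℕ) :
    Tendsto (fun n : ℕ => (n : ℝ) ^ (3 / 2 : ℝ) * ∑ j ∈ Finset.Ico K (n - K), a j * b (n - j))
      atTop (𝓝 ((∑' j, a (j + K)) * B + (∑' j, b (j + (K + 1))) * A)) := by
  have h1 : Tendsto (fun n : ℕ => (n : ℝ) ^ (3 / 2 : ℝ) * ∑ j ∈ Finset.range K, a j * b (n - j))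
      atTop (𝓝 ((∑ j ∈ Finset.range K, a j) * B)) := by
    rw [Finset.sum_mul]
    refine (tendsto_finsetSum (Finset.range K) fun j _ =>
      (tendsto_rpow_mul_sub hb j).const_mul (a j)).congr fun n => ?_
    rw [Finset.mul_sum]
    exact Finset.sum_congr rfl fun j _ => by ring
  have h2 : Tendsto (fun n : ℕ => (n : ℝ) ^ (3 / 2 : ℝ) *
      ∑ j ∈ Finset.range (K + 1), b j * a (n - j)) atTop
      (𝓝 ((∑ j ∈ Finset.range (K + 1), b j) * A)) := by
    rw [Finset.sum_mul]
    refine (tendsto_finsetSum (Finset.range (K + 1)) fun j _ =>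
      (tendsto_rpow_mul_sub ha j).const_mul (b j)).congr fun n => ?_
    rw [Finset.mul_sum]
    exact Finset.sum_congr rfl fun j _ => by ring
  have h3 := ((tendsto_conv ha0 hb0 ha hb).sub h1).sub h2
  rw [← (summable_of_tendsto_rpow ha0 ha).sum_add_tsum_nat_add K,
    ← (summable_of_tendsto_rpow hb0 hb).sum_add_tsum_nat_add (K + 1)] at h3
  convert h3.congr' ?_ using 2
  · ring
  · filter_upwards [eventually_ge_atTop (2 * K)] with n hn
    rw [← mul_sub, ← mul_sub]
    congr 1
    have h4 : ∑ j ∈ Finset.range (K + 1), b j * a (n - j) =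
        ∑ j ∈ Finset.Ico (n - K) (n + 1), a j * b (n - j) := by
      have h5 := Finset.sum_Ico_reflect (fun j => a j * b (n - j)) 0 (by omega : K + 1 ≤ n + 1)
      rw [show n + 1 - (K + 1) = n - K by omega, Nat.sub_zero] at h5
      rw [← h5, Finset.range_eq_Ico]
      refine Finset.sum_congr rfl fun j hj => ?_
      rw [Finset.mem_Ico] at hj
      rw [show n - (n - j) = j by omega, mul_comm]
    rw [h4, Finset.range_eq_Ico, Finset.range_eq_Ico,
      ← Finset.sum_Ico_consecutive _ (Nat.zero_le K) (by omega : K ≤ n + 1),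
      ← Finset.sum_Ico_consecutive _ (by omega : K ≤ n - K) (by omega : n - K ≤ n + 1)]
    ring

lemma tendsto_conv_middle_const (a b : ℕ → ℝ) (A B : ℝ) :
    Tendsto (fun K : ℕ => (∑' j, a (j + K)) * B + (∑' j, b (j + (K + 1))) * A) atTop (𝓝 0) := by
  have h1 := (tendsto_sum_nat_add a).mul_const B
  have h2 := ((tendsto_sum_nat_add b).comp (tendsto_add_atTop_nat 1)).mul_const A
  simpa using h1.add h2

lemma tendsto_of_approx {x : ℕ → ℝ} {y e : ℕ → ℕ → ℝ} {l δ : ℕ → ℝ} {L : ℝ}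
    (hy : ∀ K, Tendsto (y K) atTop (𝓝 (l K))) (hl : Tendsto l atTop (𝓝 L))
    (he : ∀ K, Tendsto (e K) atTop (𝓝 (δ K))) (hδ : Tendsto δ atTop (𝓝 0))
    (h : ∀ K, ∀ᶠ n in atTop, |x n - y K n| ≤ e K n) : Tendsto x atTop (𝓝 L) := by
  rw [Metric.tendsto_atTop']
  intro ε hε
  obtain ⟨K, hK1, hK2⟩ := ((hl.eventually (Metric.ball_mem_nhds L (by positivity : 0 < ε / 4))).and
    (hδ.eventually (gt_mem_nhds (by positivity : 0 < ε / 4)))).exists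
  obtain ⟨n₀, hn₀⟩ := eventually_atTop.1 (((hy K).eventually (Metric.ball_mem_nhds (l K)
    (by positivity : 0 < ε / 4))).and (((he K).eventually (gt_mem_nhds (hK2.trans
      (by linarith : ε / 4 < ε / 2)))).and (h K)))
  refine ⟨n₀, fun n hn => ?_⟩
  obtain ⟨h1, h2, h3⟩ := hn₀ n hn.le
  rw [Real.dist_eq] at hK1 h1
  rw [Real.dist_eq]
  rw [abs_le] at h3
  rw [abs_lt] at *
  constructor <;> linarith [h3.1, h3.2, h1.1, h1.2, hK1.1, hK1.2]

/-! ### The contribution of the middle of the path -/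

section Middle

variable {ρ : Measure (ℝ × ℝ)} [IsProbabilityMeasure ρ] {σ : ℝ}

lemma integrableOn_staySet_exp_mul_exp {i n : ℕ} (hi : i ≤ n) :
    IntegrableOn (fun y => Real.exp (-walk cX i y) * Real.exp (-walk cX n y))
      (staySet cX (Ici 0) 0 n) (pathLaw ρ) := by
  refine Measure.integrableOn_of_bounded (M := 1) (measure_ne_top _ _) (by fun_prop) ?_
  refine (ae_restrict_iff' (measurableSet_staySet_cX measurableSet_Ici _ _)).2
    (Eventually.of_forall fun y hy => ?_)
  rw [Real.norm_of_nonneg (by positivity)]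
  exact mul_le_one₀ (exp_neg_walk_le_one fun j hj => hy j
    (Finset.Icc_subset_Icc_right hi hj)) (Real.exp_pos _).le (exp_neg_walk_le_one hy)

lemma exists_setIntegral_exp_mul_exp_le (h : IsStep (ρ.map Prod.fst) σ) :
    ∃ C, 0 < C ∧ ∀ i N : ℕ, 1 ≤ N → ∫ y in staySet cX (Ici 0) 0 (i + N),
      Real.exp (-walk cX i y) * Real.exp (-walk cX (i + N) y) ∂pathLaw ρ ≤
        C * (lap (lad (ρ.map Prod.fst) (Ici 0) (Measure.dirac 0) i) (1 / 2) *
          (N : ℝ) ^ (-(3 / 2) : ℝ)) := by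
  have : IsProbabilityMeasure (ρ.map Prod.fst) :=
    Measure.isProbabilityMeasure_map measurable_fst.aemeasurable
  obtain ⟨C, hC, hD⟩ := exists_lap_lad_dirac_le h (Or.inl rfl : IsHalf (Ici 0))
      (lam := 1) (s := 1 / 2) one_pos (by norm_num)
  refine ⟨C, hC, fun i N hN => ?_⟩
  have hN' : (0 : ℝ) < (N : ℝ) ^ (3 / 2 : ℝ) := by positivity
  have hint := integrableOn_staySet_exp_mul_exp (ρ := ρ) (Nat.le_add_right i N)
  rw [← integrable_indicator_iff (measurableSet_staySet_cX measurableSet_Ici _ _)] at hint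
  have hp := measurePreserving_splice ρ i N 0
  have hint' := hp.integrable_comp_of_integrable hint
  rw [Function.comp_def] at hint'
  rw [← integral_indicator (measurableSet_staySet_cX measurableSet_Ici _ _)]
  have hmap : Measure.map (splice i N 0) _ = pathLaw ρ := hp.map_eq
  conv_lhs => rw [← hmap]
  rw [integral_map hp.measurable.aemeasurable
    (by rw [hmap]; exact hint.aestronglyMeasurable)]
  have hinner : ∀ q : (ℕ → ℝ × ℝ) × (ℕ → ℝ × ℝ), ∫ c, (staySet cX (Ici 0) 0 (i + N)).indicator
      (fun y => Real.exp (-walk cX i y) * Real.exp (-walk cX (i + N) y)) (splice i N 0 (q, c))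
        ∂pathLaw ρ = (staySet cX (Ici 0) 0 i).indicator (fun y => Real.exp (-walk cX i y) *
          lap (lad (ρ.map Prod.fst) (Ici 0) (Measure.dirac (walk cX i y)) N) 1) q.1 := by
    intro q
    have hmem := fun c => splice_mem_staySet (K₂ := 0) (p := (q, c)) (K₁ := i) hN
    by_cases hq : q.1 ∈ staySet cX (Ici 0) 0 i
    · rw [indicator_of_mem hq, lap, ← map_cX (ρ := ρ) 1,
        integral_lad (iid_cX ρ) measurableSet_Ici _ _ (by fun_prop), ← integral_const_mul,
        ← integral_indicator (measurableSet_staySet_cX measurableSet_Ici _ _)]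
      refine integral_congr_ae (Eventually.of_forall fun c => ?_)
      by_cases hc : c ∈ staySet cX (Ici 0) (walk cX i q.1) N
      · have hw : 0 ≤ walk cX i q.1 + walk cX N c := by
          obtain ⟨m, rfl⟩ := Nat.exists_eq_add_of_le' hN
          exact walk_mem_of_mem_staySet hc
        have hs : splice i N 0 (q, c) ∈ staySet cX (Ici 0) 0 (i + N) :=
          (hmem c).2 ⟨hq, hc, by simpa [pMax, walk_zero] using hw⟩
        simp only [indicator_of_mem hs, indicator_of_mem hc, walk_splice_left le_rfl,
          walk_splice_mid le_rfl, abs_of_nonneg hw, one_mul]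
      · have hs : splice i N 0 (q, c) ∉ staySet cX (Ici 0) 0 (i + N) :=
          fun hs => hc ((hmem c).1 hs).2.1
        simp only [indicator_of_notMem hs, indicator_of_notMem hc]
    · rw [indicator_of_notMem hq]
      refine integral_eq_zero_of_ae (Eventually.of_forall fun c => ?_)
      exact indicator_of_notMem (fun hs => hq ((hmem c).1 hs).1) _
  rw [integral_prod _ hint']
  simp_rw [hinner]
  have hprod := hint'.integral_prod_left
  simp_rw [hinner] at hprod
  calc _ ≤ ∫ q, (staySet cX (Ici 0) 0 i).indicator (fun y => C * (N : ℝ) ^ (-(3 / 2) : ℝ) *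
        Real.exp (-(1 / 2 * |walk cX i y|))) q.1 ∂(pathLaw ρ).prod (pathLaw ρ) := by
        refine integral_mono hprod ?_ fun q => ?_
        · refine Integrable.comp_fst (f := (staySet cX (Ici 0) 0 i).indicator fun y =>
            C * (N : ℝ) ^ (-(3 / 2) : ℝ) * Real.exp (-(1 / 2 * |walk cX i y|))) ?_ _
          refine Integrable.indicator (Integrable.const_mul (Integrable.of_bound (by fun_prop) 1
            (Eventually.of_forall fun y => ?_)) _)
            (measurableSet_staySet_cX measurableSet_Ici _ _)
          rw [Real.norm_of_nonneg (Real.exp_pos _).le]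
          exact exp_neg_abs_le (by norm_num) _
        · refine indicator_le_indicator' fun hq => ?_
          have hw := walk_nonneg_of_mem hq
          have h1 := hD _ hw N
          rw [abs_of_nonneg hw] at h1 ⊢
          calc _ ≤ Real.exp (-walk cX i q.1) * ((N : ℝ) ^ (-(3 / 2) : ℝ) *
                (C * Real.exp (1 / 2 * walk cX i q.1))) := by
                refine mul_le_mul_of_nonneg_left ?_ (Real.exp_pos _).le
                rw [Real.rpow_neg (by positivity), ← div_eq_inv_mul, le_div_iff₀ hN', mul_comm]
                exact h1
            _ = C * (N : ℝ) ^ (-(3 / 2) : ℝ) *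
                (Real.exp (-walk cX i q.1) * Real.exp (1 / 2 * walk cX i q.1)) := by ring
            _ = _ := by rw [← Real.exp_add]; ring_nf
    _ = _ := by
        rw [integral_fun_fst (fun y => (staySet cX (Ici 0) 0 i).indicator (fun y =>
          C * (N : ℝ) ^ (-(3 / 2) : ℝ) * Real.exp (-(1 / 2 * |walk cX i y|))) y),
          integral_indicator (measurableSet_staySet_cX measurableSet_Ici _ _), integral_const_mul,
          lap, ← map_cX (ρ := ρ) 1, integral_lad (iid_cX ρ) measurableSet_Ici _ _ (by fun_prop)]
        simp only [probReal_univ, one_smul, zero_add]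
        ring

end Middle

/-! ### The limit theorem on the path space -/

section PathLimit

lemma abs_pB_sub_le {y : ℕ → ℝ × ℝ} {κ : ℝ} (hy : ∀ i, (y i).2 ∈ Icc 0 κ) {K m : ℕ} (hK : K ≤ m) :
    |pB m y - pB K y| ≤ κ * ∑ i ∈ Finset.Ico K m, Real.exp (-walk cX i y) := by
  rw [pB, pB, ← Finset.sum_Ico_eq_sub _ hK, Finset.mul_sum]
  rw [abs_of_nonneg (Finset.sum_nonneg fun i _ => mul_nonneg (hy _).1 (Real.exp_pos _).le)]
  exact Finset.sum_le_sum fun i _ => mul_le_mul_of_nonneg_right (hy _).2 (Real.exp_pos _).le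

lemma exp_mul_abs_rC_sub_le {y : ℕ → ℝ × ℝ} {κ : ℝ} (hy : ∀ i, (y i).2 ∈ Icc 0 κ) {K m n : ℕ}
    (hn : 1 ≤ n) (hK : K ≤ n - m) : Real.exp (-walk cX n y) * |rC (n - m) n y - rC K n y| ≤
      κ * ∑ i ∈ Finset.Ico m (n - K), Real.exp (-walk cX i y) := by
  rcases le_or_gt m n with hm | hm
  · have h1 := Finset.sum_Ico_reflect (fun i => Real.exp (-walk cX i y)) K
      (by omega : n - m ≤ n - 1 + 1)
    rw [show n - 1 + 1 - (n - m) = m by omega, Nat.sub_add_cancel hn] at h1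
    rw [rC, rC, ← Finset.sum_Ico_eq_sub _ hK, ← h1, abs_of_nonneg (Finset.sum_nonneg fun i _ =>
      mul_nonneg (hy _).1 (Real.exp_pos _).le), Finset.mul_sum, Finset.mul_sum]
    refine Finset.sum_le_sum fun j _ => ?_
    rw [mul_left_comm, ← Real.exp_add, show n - 1 - j = n - j - 1 by omega]
    refine mul_le_mul (hy _).2 (le_of_eq ?_) (Real.exp_pos _).le ((hy 0).1.trans (hy 0).2)
    ring_nf
  · obtain rfl : K = 0 := by omega
    rw [show n - m = 0 by omega, sub_self, abs_zero, mul_zero]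
    exact mul_nonneg ((hy 0).1.trans (hy 0).2) (Finset.sum_nonneg fun _ _ => (Real.exp_pos _).le)

variable {ρ : Measure (ℝ × ℝ)} [IsProbabilityMeasure ρ] {σ : ℝ} {F : ℝ → ℝ → ℝ → ℝ} {M κ L D : ℝ}
  {Pp : Measure (ℕ → ℝ × ℝ)} {Pm : ℝ → Measure (ℕ → ℝ × ℝ)}

lemma abs_sub_block_le (hL : ∀ b c b' c' s, 0 ≤ s → |F b c s - F b' c' s| ≤
      L * (|b - b'| + s * |c - c'|)) (hL0 : 0 ≤ L) (hD : 0 ≤ D) {y : ℕ → ℝ × ℝ}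
    (hy : ∀ i, (y i).2 ∈ Icc 0 κ) {K m n : ℕ} (hK : K ≤ m) (hmn : m < n - K) {x : ℝ}
    (hx : |x - F (pB m y) (rC (n - m) n y) (Real.exp (-walk cX n y))| ≤
      D * Real.exp (-walk cX m y)) :
    |x - F (pB K y) (rC K n y) (Real.exp (-walk cX n y))| ≤
      (D + L * κ) * ∑ i ∈ Finset.Ico K (n - K), Real.exp (-walk cX i y) := by
  have h1 := abs_pB_sub_le hy hK
  have h2 := exp_mul_abs_rC_sub_le hy (by omega : 1 ≤ n) (by omega : K ≤ n - m)
  have h3 := hL (pB m y) (rC (n - m) n y) (pB K y) (rC K n y) _ (Real.exp_pos (-walk cX n y)).le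
  have h4 : Real.exp (-walk cX m y) ≤ ∑ i ∈ Finset.Ico K (n - K), Real.exp (-walk cX i y) :=
    Finset.single_le_sum (f := fun i => Real.exp (-walk cX i y))
      (fun i _ => (Real.exp_pos _).le) (Finset.mem_Ico.2 ⟨hK, hmn⟩)
  rw [← Finset.sum_Ico_consecutive _ hK hmn.le] at h4 ⊢
  refine (abs_sub_le _ _ _).trans ((add_le_add hx (h3.trans
    (mul_le_mul_of_nonneg_left (add_le_add h1 h2) hL0))).trans ?_)
  nlinarith [mul_le_mul_of_nonneg_left h4 hD]

lemma tendsto_lap_lad_dirac_zero (h : IsStep (ρ.map Prod.fst) σ) {lam : ℝ} (hlam : 0 < lam) :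
    ∃ A, Tendsto (fun n : ℕ => (n : ℝ) ^ (3 / 2 : ℝ) *
      lap (lad (ρ.map Prod.fst) (Ici 0) (Measure.dirac 0) n) lam) atTop (𝓝 A) :=
  have : IsProbabilityMeasure (ρ.map Prod.fst) :=
    Measure.isProbabilityMeasure_map measurable_fst.aemeasurable
  ⟨_, tendsto_lap_lad_tsum h (Or.inl rfl : IsHalf (Ici 0)) hlam⟩

lemma one_le_renLap (h : IsStep (ρ.map Prod.fst) σ) : 1 ≤ renLap ρ := by
  have : IsProbabilityMeasure (ρ.map Prod.fst) :=
    Measure.isProbabilityMeasure_map measurable_fst.aemeasurable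
  have h1 := (summable_lap_lad h (Or.inl rfl : IsHalf (Ici 0)) one_pos).le_tsum 0
    fun _ _ => lap_nonneg _ _
  refine le_trans (le_of_eq ?_) h1
  simp [lad, lap]

theorem tendsto_ratio (h : IsStep (ρ.map Prod.fst) σ)
    (hPp : IsPplus (pathLaw ρ) cX pathFil 0 Pp)
    (hPm : ∀ z ≤ 0, IsPminus (pathLaw ρ) cX pathFil z (Pm z))
    (hκ : ∀ᵐ y ∂pathLaw ρ, ∀ i, Real.exp (-cX i y) ≤ κ)
    (hη : ∀ᵐ y ∂pathLaw ρ, ∀ i, (y i).2 ∈ Icc 0 κ)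
    (hF : Continuous fun x : ℝ × ℝ × ℝ => F x.1 x.2.1 x.2.2) (hM : ∀ b c s, |F b c s| ≤ M)
    (hL0 : 0 ≤ L) (hL : ∀ b c b' c' s, 0 ≤ s → |F b c s - F b' c' s| ≤
      L * (|b - b'| + s * |c - c'|)) {m : ℕ → ℕ} (hm : Tendsto m atTop atTop)
    (hm' : Tendsto (fun n => n - m n) atTop atTop) {H : ℕ → (ℕ → ℝ × ℝ) → ℝ}
    (hHm : ∀ n, Measurable (H n)) (hD : 0 ≤ D)
    (hH : ∀ n, ∀ᵐ y ∂pathLaw ρ, y ∈ staySet cX (Ici 0) 0 n →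
      |H n y - F (pB (m n) y) (rC (n - m n) n y) (Real.exp (-walk cX n y))| ≤
        D * Real.exp (-walk cX (m n) y)) :
    Tendsto (fun n : ℕ => (∫ y in staySet cX (Ici 0) 0 n, H n y * Real.exp (-walk cX n y)
        ∂pathLaw ρ) / ∫ y in staySet cX (Ici 0) 0 n, Real.exp (-walk cX n y) ∂pathLaw ρ)
      atTop (𝓝 (mixInt F ρ Pp Pm pBinf pCinf / renLap ρ)) := by
  have : IsProbabilityMeasure (ρ.map Prod.fst) :=
    Measure.isProbabilityMeasure_map measurable_fst.aemeasurable
  have hκ0 : 0 ≤ κ := by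
    obtain ⟨y, hy⟩ := hη.exists
    exact (hy 0).1.trans (hy 0).2
  have hS : ∀ n, MeasurableSet (staySet cX (Ici 0) 0 n) := measurableSet_staySet_cX measurableSet_Ici 0
  have hFm : ∀ K n, Measurable fun y : ℕ → ℝ × ℝ =>
      F (pB K y) (rC K n y) (Real.exp (-walk cX n y)) := fun K n =>
    measurable_triple hF (by fun_prop) (by fun_prop) (by fun_prop)
  have hFi : ∀ K n, IntegrableOn (fun y => F (pB K y) (rC K n y) (Real.exp (-walk cX n y)) *
      Real.exp (-walk cX n y)) (staySet cX (Ici 0) 0 n) (pathLaw ρ) := fun K n =>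
    (integrable_indicator_iff (hS n)).1
      (integrable_indicator_mul_exp (M := M) (hFm K n) (fun y => hM _ _ _) n)
  obtain ⟨C, hC, hCi⟩ := exists_setIntegral_exp_mul_exp_le (ρ := ρ) h
  obtain ⟨A, hA⟩ := tendsto_lap_lad_dirac_zero (ρ := ρ) h (lam := 1 / 2) (by norm_num)
  set a : ℕ → ℝ := fun i => lap (lad (ρ.map Prod.fst) (Ici 0) (Measure.dirac 0) i) (1 / 2) with ha
  set b : ℕ → ℝ := fun i => (i : ℝ) ^ (-(3 / 2) : ℝ) with hb
  have hbt : Tendsto (fun n : ℕ => (n : ℝ) ^ (3 / 2 : ℝ) * b n) atTop (𝓝 1) := by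
    refine tendsto_const_nhds.congr' ?_
    filter_upwards [eventually_ge_atTop 1] with n hn
    have hn' : (0 : ℝ) < n := by exact_mod_cast hn
    rw [hb, ← Real.rpow_add hn']
    norm_num
  have hnum : Tendsto (fun n : ℕ => (n : ℝ) ^ (3 / 2 : ℝ) * ∫ y in staySet cX (Ici 0) 0 n,
      H n y * Real.exp (-walk cX n y) ∂pathLaw ρ) atTop
      (𝓝 (llt σ * mixInt F ρ Pp Pm pBinf pCinf)) := by
    refine tendsto_of_approx (y := fun K n => (n : ℝ) ^ (3 / 2 : ℝ) *
      ∫ y in staySet cX (Ici 0) 0 n, F (pB K y) (rC K n y) (Real.exp (-walk cX n y)) *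
        Real.exp (-walk cX n y) ∂pathLaw ρ)
      (e := fun K n => (D + L * κ) * C * ((n : ℝ) ^ (3 / 2 : ℝ) *
        ∑ i ∈ Finset.Ico K (n - K), a i * b (n - i)))
      (l := fun K => llt σ * mixInt F ρ Pp Pm (pB K) (pC K)) (fun K => ?_)
      ((tendsto_mixInt h hPp hPm hκ hη hF hM).const_mul _)
      (fun K => (tendsto_conv_middle (fun _ => lap_nonneg _ _) (fun _ => by positivity)
        hA hbt K).const_mul _)
      (by
        have h0 := (tendsto_conv_middle_const a b A 1).const_mul ((D + L * κ) * C)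
        rwa [mul_zero] at h0)
      (fun K => ?_)
    · rw [← (integral_blockLim h hPp hPm hκ hF hM K).2]
      refine tendsto_rpow_shift (2 * K) (x := fun n => ∫ y in staySet cX (Ici 0) 0 n,
        F (pB K y) (rC K n y) (Real.exp (-walk cX n y)) * Real.exp (-walk cX n y) ∂pathLaw ρ)
        ((tendsto_integral_blockInt h hPp hκ hF hM K).congr' ?_)
      filter_upwards [eventually_ge_atTop 1] with N hN
      rw [← setIntegral_staySet_eq hF hM K K hN, show K + N + K = N + 2 * K by omega]
    · filter_upwards [hm.eventually_ge_atTop K, hm'.eventually_gt_atTop K] with n h1 h2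
      have hbd : ∀ᵐ y ∂(pathLaw ρ).restrict (staySet cX (Ici 0) 0 n),
          |H n y - F (pB K y) (rC K n y) (Real.exp (-walk cX n y))| ≤
            (D + L * κ) * ∑ i ∈ Finset.Ico K (n - K), Real.exp (-walk cX i y) := by
        rw [ae_restrict_iff' (hS n)]
        filter_upwards [hη, hH n] with y hy hy' hys
        exact abs_sub_block_le hL hL0 hD hy h1 (by omega) (hy' hys)
      have hsum : ∀ y, (D + L * κ) * (∑ i ∈ Finset.Ico K (n - K), Real.exp (-walk cX i y)) *
          Real.exp (-walk cX n y) = ∑ i ∈ Finset.Ico K (n - K), (D + L * κ) *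
            (Real.exp (-walk cX i y) * Real.exp (-walk cX n y)) := fun y => by
        rw [Finset.mul_sum, Finset.sum_mul]
        exact Finset.sum_congr rfl fun i _ => mul_assoc _ _ _
      have hI : ∀ i ∈ Finset.Ico K (n - K), IntegrableOn (fun y => (D + L * κ) *
          (Real.exp (-walk cX i y) * Real.exp (-walk cX n y)))
          (staySet cX (Ici 0) 0 n) (pathLaw ρ) := fun i hi =>
        (integrableOn_staySet_exp_mul_exp (by rw [Finset.mem_Ico] at hi; omega)).const_mul _
      have hsumI : IntegrableOn (fun y => (D + L * κ) * (∑ i ∈ Finset.Ico K (n - K),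
          Real.exp (-walk cX i y)) * Real.exp (-walk cX n y))
          (staySet cX (Ici 0) 0 n) (pathLaw ρ) := by
        simp_rw [hsum]
        exact integrable_finsetSum _ hI
      have hdiff : ∀ᵐ y ∂(pathLaw ρ).restrict (staySet cX (Ici 0) 0 n),
          ‖H n y * Real.exp (-walk cX n y) - F (pB K y) (rC K n y) (Real.exp (-walk cX n y)) *
            Real.exp (-walk cX n y)‖ ≤ (D + L * κ) * (∑ i ∈ Finset.Ico K (n - K),
              Real.exp (-walk cX i y)) * Real.exp (-walk cX n y) := by
        filter_upwards [hbd] with y hy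
        rw [← sub_mul, norm_mul, Real.norm_of_nonneg (Real.exp_pos _).le]
        exact mul_le_mul_of_nonneg_right hy (Real.exp_pos _).le
      have hHi : IntegrableOn (fun y => H n y * Real.exp (-walk cX n y))
          (staySet cX (Ici 0) 0 n) (pathLaw ρ) := by
        have hd : IntegrableOn (fun y => H n y * Real.exp (-walk cX n y) -
            F (pB K y) (rC K n y) (Real.exp (-walk cX n y)) * Real.exp (-walk cX n y))
            (staySet cX (Ici 0) 0 n) (pathLaw ρ) :=
          Integrable.mono' hsumI (Measurable.aestronglyMeasurable
            (((hHm n).mul (by fun_prop)).sub ((hFm K n).mul (by fun_prop)))) hdiff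
        refine (hd.add (hFi K n)).congr (Eventually.of_forall fun y => ?_)
        simp
      rw [← mul_sub, ← integral_sub hHi (hFi K n), abs_mul, abs_of_nonneg (by positivity),
        mul_left_comm]
      refine mul_le_mul_of_nonneg_left ?_ (by positivity)
      refine (norm_integral_le_of_norm_le hsumI hdiff).trans ?_
      simp_rw [hsum]
      rw [integral_finsetSum _ hI, mul_assoc, Finset.mul_sum, Finset.mul_sum]
      refine Finset.sum_le_sum fun i hi => ?_
      rw [integral_const_mul]
      refine mul_le_mul_of_nonneg_left ?_ (by positivity)
      rw [Finset.mem_Ico] at hi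
      obtain ⟨N, rfl⟩ := Nat.exists_eq_add_of_le (by omega : i ≤ n)
      rw [Nat.add_sub_cancel_left]
      exact hCi i N (by omega)
  have hden : Tendsto (fun n : ℕ => (n : ℝ) ^ (3 / 2 : ℝ) * ∫ y in staySet cX (Ici 0) 0 n,
      Real.exp (-walk cX n y) ∂pathLaw ρ) atTop (𝓝 (llt σ * renLap ρ)) := by
    simp_rw [setIntegral_exp_eq_lap]
    simpa using tendsto_lap_lad_add (ρ := ρ) h 0
  have hll := h.llt_pos
  have hren := zero_lt_one.trans_le (one_le_renLap h)
  have hq := hnum.div hden (mul_pos hll hren).ne'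
  rw [mul_div_mul_left _ _ hll.ne'] at hq
  refine hq.congr' ?_
  filter_upwards [eventually_ge_atTop 1] with n hn
  have hn' : (0 : ℝ) < n := by exact_mod_cast hn
  exact mul_div_mul_left _ _ (by positivity)

end PathLimit

/-! ### The functions `θ` and `θ*` -/

section Theta

variable {α β lam : ℝ}

/-- The function `θ` in the variables `1/v = w` and `e^{-x} = s`. -/
def thetaInv (α β lam u₁ u₂ b w s : ℝ) : ℝ :=
  (α * s * w + (lam * α * s * u₁ * w + u₂) * (β + α * b))⁻¹

lemma lfun_of_mem {y : ℝ} (hy : y ∈ Icc 0 1) : lfun y = y := by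
  rw [lfun, if_neg (not_lt.2 hy.1), if_pos hy.2]

lemma kappa_eq_max (y : ℝ) : kappa y = max y 0 := by
  rw [kappa]
  split_ifs with h
  · rw [max_eq_left h.le]
  · rw [max_eq_right (not_lt.1 h)]

lemma thetaFun_eq {u₁ u₂ b w x : ℝ} (h₁ : u₁ ∈ Icc 0 1) (h₂ : u₂ ∈ Icc 0 1) (hw : 1 ≤ w) :
    thetaFun α β lam (u₁, u₂, b) w⁻¹ x =
      thetaInv α β lam u₁ u₂ (max b 0) w (Real.exp (-x)) := by
  have hw0 : 0 < w := zero_lt_one.trans_le hw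
  simp only [thetaFun, thetaInv, lfun_of_mem h₁, lfun_of_mem h₂, kappa_eq_max,
    lfun_of_mem ⟨(inv_pos.2 hw0).le, inv_le_one_of_one_le₀ hw⟩]
  rw [inv_eq_one_div, div_div, inv_eq_one_div]
  congr 1
  field_simp

lemma thetaStar_eq {u w x : ℝ} (hw : 1 ≤ w) : thetaStar α β lam u w⁻¹ x =
    thetaInv α β lam 1 1 (max u 0) w (Real.exp (-x)) := by
  rw [← thetaFun_eq (right_mem_Icc.2 zero_le_one) (right_mem_Icc.2 zero_le_one) hw, thetaStar,
    thetaFun, lfun_of_mem (right_mem_Icc.2 zero_le_one)]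
  ring_nf

lemma abs_inv_sub_inv_le {x y E : ℝ} (hx : 0 < x) (hy : 0 < y) (h : |x - y| ≤ E * (x * y)) :
    |x⁻¹ - y⁻¹| ≤ E := by
  rw [inv_sub_inv hx.ne' hy.ne', abs_div, abs_of_pos (mul_pos hx hy), div_le_iff₀ (mul_pos hx hy),
    abs_sub_comm]
  exact h

variable (hα : 0 < α) (hβ : 0 < β) (hlam : 0 < lam)
include hα hβ hlam

lemma le_thetaInv_den {u₁ u₂ b w s : ℝ} (h₁ : 0 ≤ u₁) (h₂ : 0 ≤ u₂) (hb : 0 ≤ b) (hw : 0 ≤ w)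
    (hs : 0 ≤ s) : u₂ * β ≤ α * s * w + (lam * α * s * u₁ * w + u₂) * (β + α * b) := by
  have : α * s * w + (lam * α * s * u₁ * w + u₂) * (β + α * b) = u₂ * β +
      (α * s * w + lam * α * s * u₁ * w * (β + α * b) + u₂ * (α * b)) := by ring
  rw [this]
  exact le_add_of_nonneg_right (by positivity)

lemma thetaInv_mem_Icc {u₁ u₂ b w s e : ℝ} (h₁ : 0 ≤ u₁) (he : 0 < e) (h₂ : e ≤ u₂) (hb : 0 ≤ b)
    (hw : 0 ≤ w) (hs : 0 ≤ s) : thetaInv α β lam u₁ u₂ b w s ∈ Icc 0 (e * β)⁻¹ := by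
  have h := (mul_le_mul_of_nonneg_right h₂ hβ.le).trans
    (le_thetaInv_den hα hβ hlam h₁ (he.le.trans h₂) hb hw hs)
  have h0 : 0 < e * β := mul_pos he hβ
  exact ⟨inv_nonneg.2 (h0.le.trans h), inv_anti₀ h0 h⟩

lemma abs_thetaInv_one_sub_le {b w b' w' s : ℝ} (hb : 0 ≤ b) (hw : 0 ≤ w) (hb' : 0 ≤ b')
    (hw' : 0 ≤ w') (hs : 0 ≤ s) :
    |thetaInv α β lam 1 1 b w s - thetaInv α β lam 1 1 b' w' s| ≤
      (α / β ^ 2 + lam * α / β) * (|b - b'| + s * |w - w'|) := by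
  have h1 := le_thetaInv_den hα hβ hlam zero_le_one zero_le_one hb hw hs
  have h2 := le_thetaInv_den hα hβ hlam zero_le_one zero_le_one hb' hw' hs
  unfold thetaInv
  rw [one_mul] at h1 h2
  have h3 : (lam * α * s * 1 * w + 1) * β ≤
      α * s * w + (lam * α * s * 1 * w + 1) * (β + α * b) := by
    have : 0 ≤ α * s * w + (lam * α * s * 1 * w + 1) * (α * b) := by positivity
    linarith
  have h4 : β + α * b' ≤ α * s * w' + (lam * α * s * 1 * w' + 1) * (β + α * b') := by
    have : 0 ≤ α * s * w' + lam * α * s * 1 * w' * (β + α * b') := by positivity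
    linarith
  have hsub : α * s * w + (lam * α * s * 1 * w + 1) * (β + α * b) -
      (α * s * w' + (lam * α * s * 1 * w' + 1) * (β + α * b')) =
      α * (s * (w - w')) + lam * α * (s * (w - w')) * (β + α * b') +
        (lam * α * s * 1 * w + 1) * (α * (b - b')) := by ring
  set x := α * s * w + (lam * α * s * 1 * w + 1) * (β + α * b)
  set y := α * s * w' + (lam * α * s * 1 * w' + 1) * (β + α * b')
  have hx : 0 < x := hβ.trans_le h1
  have hy : 0 < y := hβ.trans_le h2
  refine abs_inv_sub_inv_le hx hy ?_
  have hd : 0 ≤ s * |w - w'| := by positivity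
  have e1 : |α * (s * (w - w'))| ≤ α / β ^ 2 * (s * |w - w'|) * (x * y) := by
    rw [abs_mul, abs_mul, abs_of_pos hα, abs_of_nonneg hs]
    calc _ = α / β ^ 2 * (s * |w - w'|) * (β * β) := by field_simp
      _ ≤ _ := by gcongr
  have e2 : |lam * α * (s * (w - w')) * (β + α * b')| ≤
      lam * α / β * (s * |w - w'|) * (x * y) := by
    rw [abs_mul, abs_mul, abs_mul s, abs_of_pos (mul_pos hlam hα), abs_of_nonneg hs,
      abs_of_nonneg (by positivity : 0 ≤ β + α * b')]
    calc _ = lam * α / β * (s * |w - w'|) * (β * (β + α * b')) := by field_simp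
      _ ≤ _ := by gcongr
  have e3 : |(lam * α * s * 1 * w + 1) * (α * (b - b'))| ≤ α / β ^ 2 * |b - b'| * (x * y) := by
    rw [abs_mul, abs_mul, abs_of_pos hα,
      abs_of_nonneg (by positivity : 0 ≤ lam * α * s * 1 * w + 1)]
    calc _ = α / β ^ 2 * |b - b'| * ((lam * α * s * 1 * w + 1) * β * β) := by field_simp
      _ ≤ _ := by gcongr
  have e4 : 0 ≤ lam * α / β * |b - b'| * (x * y) := by positivity
  rw [hsub]
  refine (abs_add_le _ _).trans ((add_le_add ((abs_add_le _ _).trans (add_le_add e1 e2)) e3).trans ?_)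
  linarith

lemma abs_thetaInv_sub_one_le {u₁ u₂ b w s e δ : ℝ} (h₁ : 0 ≤ u₁) (he : 0 < e) (h₂ : e ≤ u₂)
    (hδ₁ : 1 - u₁ ∈ Icc 0 δ) (hδ₂ : 1 - u₂ ∈ Icc 0 δ) (hb : 0 ≤ b) (hw : 0 ≤ w) (hs : 0 ≤ s) :
    |thetaInv α β lam u₁ u₂ b w s - thetaInv α β lam 1 1 b w s| ≤ (e * β)⁻¹ * δ := by
  have h1 := (mul_le_mul_of_nonneg_right h₂ hβ.le).trans
    (le_thetaInv_den hα hβ hlam h₁ (he.le.trans h₂) hb hw hs)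
  have h2 := le_thetaInv_den hα hβ hlam zero_le_one zero_le_one hb hw hs
  have heβ : 0 < e * β := mul_pos he hβ
  rw [one_mul] at h2
  have hδ : 0 ≤ δ := hδ₁.1.trans hδ₁.2
  refine abs_inv_sub_inv_le (heβ.trans_le h1) (hβ.trans_le h2) ?_
  have h3 : |α * s * w + (lam * α * s * u₁ * w + u₂) * (β + α * b) -
      (α * s * w + (lam * α * s * 1 * w + 1) * (β + α * b))| ≤
      δ * (α * s * w + (lam * α * s * 1 * w + 1) * (β + α * b)) := by
    rw [abs_sub_comm, show α * s * w + (lam * α * s * 1 * w + 1) * (β + α * b) -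
      (α * s * w + (lam * α * s * u₁ * w + u₂) * (β + α * b)) =
      lam * α * s * w * (β + α * b) * (1 - u₁) + (β + α * b) * (1 - u₂) by ring,
      abs_of_nonneg (add_nonneg (mul_nonneg (by positivity) hδ₁.1)
        (mul_nonneg (by positivity) hδ₂.1))]
    have h4 : lam * α * s * w * (β + α * b) * (1 - u₁) ≤ lam * α * s * w * (β + α * b) * δ :=
      mul_le_mul_of_nonneg_left hδ₁.2 (by positivity)
    have h5 : (β + α * b) * (1 - u₂) ≤ (β + α * b) * δ :=
      mul_le_mul_of_nonneg_left hδ₂.2 (by positivity)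
    have h6 : 0 ≤ δ * (α * s * w) := by positivity
    linarith
  refine h3.trans ?_
  set x := α * s * w + (lam * α * s * u₁ * w + u₂) * (β + α * b)
  set y := α * s * w + (lam * α * s * 1 * w + 1) * (β + α * b)
  calc δ * y = (e * β)⁻¹ * δ * ((e * β) * y) := by field_simp
    _ ≤ _ := by
      have := hβ.le.trans h2
      gcongr

end Theta

section ThetaPath

variable {α β lam w₁ w₂ : ℝ}

/-- The product of two functions `θ*` as a function of `B⁺`, `B⁻` and `e^{-S}`. -/
def thetaLim (α β lam w₁ w₂ b c s : ℝ) : ℝ :=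
  thetaInv α β lam 1 1 (max b 0) (max c 0 + w₁) (max s 0) *
    thetaInv α β lam 1 1 (max b 0) (max c 0 + w₂) (max s 0)

/-- The product of two functions `θ` along a path, at the times `m` and `n`. -/
def thetaPre (α β lam w₁ w₂ : ℝ) (m n : ℕ) (y : ℕ → ℝ × ℝ) : ℝ :=
  let x := lam * α * Real.exp (-walk cX m y)
  thetaInv α β lam ((1 - Real.exp (-x)) / x) (Real.exp (-x)) (max (pB m y) 0)
      (max (rC (n - m) n y) 0 + w₁) (Real.exp (-walk cX n y)) *
    thetaInv α β lam ((1 - Real.exp (-x)) / x) (Real.exp (-x)) (max (pB m y) 0)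
      (max (rC (n - m) n y) 0 + w₂) (Real.exp (-walk cX n y))

lemma measurable_thetaPre (m n : ℕ) : Measurable (thetaPre α β lam w₁ w₂ m n) := by
  unfold thetaPre thetaInv
  fun_prop

lemma abs_mul_sub_mul_le {a b c d M E : ℝ} (ha : a ∈ Icc 0 M) (hd : d ∈ Icc 0 M)
    (h₁ : |a - c| ≤ E) (h₂ : |b - d| ≤ E) : |a * b - c * d| ≤ 2 * M * E := by
  have hE : 0 ≤ E := (abs_nonneg _).trans h₁
  rw [show a * b - c * d = a * (b - d) + (a - c) * d by ring]
  refine (abs_add_le _ _).trans ?_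
  rw [abs_mul, abs_mul, abs_of_nonneg ha.1, abs_of_nonneg hd.1]
  have e1 := mul_le_mul ha.2 h₂ (abs_nonneg _) (ha.1.trans ha.2)
  have e2 := mul_le_mul h₁ hd.2 hd.1 hE
  linarith

lemma one_sub_exp_div_mem {x : ℝ} (hx : 0 < x) :
    (1 - Real.exp (-x)) / x ∈ Icc (Real.exp (-x)) 1 := by
  constructor
  · rw [le_div_iff₀ hx]
    have h1 := Real.add_one_le_exp x
    have h2 : Real.exp (-x) * Real.exp x = 1 := by rw [← Real.exp_add]; simp
    nlinarith [Real.exp_pos (-x)]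
  · rw [div_le_one hx]
    linarith [Real.add_one_le_exp (-x)]

variable (hα : 0 < α) (hβ : 0 < β) (hlam : 0 < lam) (hw₁ : 0 ≤ w₁) (hw₂ : 0 ≤ w₂)
include hα hβ hlam hw₁ hw₂

lemma continuous_thetaLim : Continuous fun x : ℝ × ℝ × ℝ =>
    thetaLim α β lam w₁ w₂ x.1 x.2.1 x.2.2 := by
  unfold thetaLim thetaInv
  refine Continuous.mul (Continuous.inv₀ (by fun_prop) fun x => ?_)
    (Continuous.inv₀ (by fun_prop) fun x => ?_)
  · have := le_thetaInv_den hα hβ hlam zero_le_one zero_le_one (le_max_right x.1 0)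
      (by positivity : 0 ≤ max x.2.1 0 + w₁) (le_max_right x.2.2 0)
    rw [one_mul] at this
    exact (hβ.trans_le this).ne'
  · have := le_thetaInv_den hα hβ hlam zero_le_one zero_le_one (le_max_right x.1 0)
      (by positivity : 0 ≤ max x.2.1 0 + w₂) (le_max_right x.2.2 0)
    rw [one_mul] at this
    exact (hβ.trans_le this).ne'

lemma abs_thetaLim_le (b c s : ℝ) : |thetaLim α β lam w₁ w₂ b c s| ≤ β⁻¹ * β⁻¹ := by
  have h1 := thetaInv_mem_Icc hα hβ hlam zero_le_one one_pos le_rfl (le_max_right b 0)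
    (by positivity : 0 ≤ max c 0 + w₁) (le_max_right s 0)
  have h2 := thetaInv_mem_Icc hα hβ hlam zero_le_one one_pos le_rfl (le_max_right b 0)
    (by positivity : 0 ≤ max c 0 + w₂) (le_max_right s 0)
  rw [one_mul] at h1 h2
  rw [thetaLim, abs_of_nonneg (mul_nonneg h1.1 h2.1)]
  exact mul_le_mul h1.2 h2.2 h2.1 (inv_nonneg.2 hβ.le)

lemma abs_thetaLim_sub_le (b c b' c' s : ℝ) (hs : 0 ≤ s) :
    |thetaLim α β lam w₁ w₂ b c s - thetaLim α β lam w₁ w₂ b' c' s| ≤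
      2 * β⁻¹ * (α / β ^ 2 + lam * α / β) * (|b - b'| + s * |c - c'|) := by
  have h1 := thetaInv_mem_Icc hα hβ hlam zero_le_one one_pos le_rfl (le_max_right b 0)
    (by positivity : 0 ≤ max c 0 + w₁) (le_max_right s 0)
  have h2 := thetaInv_mem_Icc hα hβ hlam zero_le_one one_pos le_rfl (le_max_right b' 0)
    (by positivity : 0 ≤ max c' 0 + w₂) (le_max_right s 0)
  rw [one_mul] at h1 h2
  have key : ∀ w, 0 ≤ w → |thetaInv α β lam 1 1 (max b 0) (max c 0 + w) (max s 0) -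
      thetaInv α β lam 1 1 (max b' 0) (max c' 0 + w) (max s 0)| ≤
        (α / β ^ 2 + lam * α / β) * (|b - b'| + s * |c - c'|) := fun w hw => by
    refine (abs_thetaInv_one_sub_le hα hβ hlam (le_max_right b 0)
      (by positivity : 0 ≤ max c 0 + w) (le_max_right b' 0)
      (by positivity : 0 ≤ max c' 0 + w) (le_max_right s 0)).trans ?_
    rw [max_eq_left hs, add_sub_add_right_eq_sub]
    have e1 := abs_max_sub_max_le_abs b b' 0
    have e2 := abs_max_sub_max_le_abs c c' 0
    gcongr
  exact (abs_mul_sub_mul_le h1 h2 (key _ hw₁) (key _ hw₂)).trans (le_of_eq (mul_assoc _ _ _).symm)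

lemma abs_thetaPre_sub_le {m n : ℕ} (hmn : m ≤ n) {y : ℕ → ℝ × ℝ}
    (hy : y ∈ staySet cX (Ici 0) 0 n) :
    |thetaPre α β lam w₁ w₂ m n y -
      thetaLim α β lam w₁ w₂ (pB m y) (rC (n - m) n y) (Real.exp (-walk cX n y))| ≤
      2 * (Real.exp (-(lam * α)) * β)⁻¹ * ((Real.exp (-(lam * α)) * β)⁻¹ * (lam * α)) *
        Real.exp (-walk cX m y) := by
  have hm1 : Real.exp (-walk cX m y) ≤ 1 := exp_neg_walk_le_one fun i hi =>
    hy i (Finset.Icc_subset_Icc_right hmn hi)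
  have hx : 0 < lam * α * Real.exp (-walk cX m y) := by positivity
  have hx1 : lam * α * Real.exp (-walk cX m y) ≤ lam * α :=
    mul_le_of_le_one_right (by positivity) hm1
  simp only [thetaPre, thetaLim, max_eq_left (Real.exp_pos (-walk cX n y)).le]
  set x := lam * α * Real.exp (-walk cX m y) with hxdef
  have hu := one_sub_exp_div_mem hx
  have he : Real.exp (-(lam * α)) ≤ Real.exp (-x) := Real.exp_le_exp.2 (neg_le_neg hx1)
  have he0 := Real.exp_pos (-(lam * α))
  have he1 : Real.exp (-(lam * α)) ≤ 1 := Real.exp_le_one_iff.2 (by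
    have : 0 < lam * α := by positivity
    linarith)
  have hu0 : 0 ≤ (1 - Real.exp (-x)) / x := (Real.exp_pos _).le.trans hu.1
  have hex : 1 - Real.exp (-x) ≤ x := by linarith [Real.add_one_le_exp (-x)]
  have hd2 : 1 - Real.exp (-x) ∈ Icc 0 x :=
    ⟨sub_nonneg.2 (Real.exp_le_one_iff.2 (neg_nonpos.2 hx.le)), hex⟩
  have hd1 : 1 - (1 - Real.exp (-x)) / x ∈ Icc 0 x :=
    ⟨sub_nonneg.2 hu.2, (sub_le_sub_left hu.1 1).trans hex⟩
  have hs := (Real.exp_pos (-walk cX n y)).le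
  have key := fun (w : ℝ) (hw : 0 ≤ w) =>
    abs_thetaInv_sub_one_le hα hβ hlam hu0 he0 he hd1 hd2 (le_max_right (pB m y) 0)
      (by positivity : 0 ≤ max (rC (n - m) n y) 0 + w) hs
  refine (abs_mul_sub_mul_le (M := (Real.exp (-(lam * α)) * β)⁻¹) ?_ ?_
    (key _ hw₁) (key _ hw₂)).trans (le_of_eq ?_)
  · exact thetaInv_mem_Icc hα hβ hlam hu0 he0 he (le_max_right _ 0) (by positivity) hs
  · exact thetaInv_mem_Icc hα hβ hlam zero_le_one he0 he1 (le_max_right _ 0) (by positivity) hs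
  · rw [hxdef]; ring

variable {ρ : Measure (ℝ × ℝ)} [IsProbabilityMeasure ρ] {σ κ : ℝ}
  {Pp : Measure (ℕ → ℝ × ℝ)} {Pm : ℝ → Measure (ℕ → ℝ × ℝ)}

theorem tendsto_ratio_thetaPre (h : IsStep (ρ.map Prod.fst) σ)
    (hPp : IsPplus (pathLaw ρ) cX pathFil 0 Pp)
    (hPm : ∀ z ≤ 0, IsPminus (pathLaw ρ) cX pathFil z (Pm z))
    (hκ : ∀ᵐ y ∂pathLaw ρ, ∀ i, Real.exp (-cX i y) ≤ κ)
    (hη : ∀ᵐ y ∂pathLaw ρ, ∀ i, (y i).2 ∈ Icc 0 κ) {m : ℕ → ℕ} (hm : Tendsto m atTop atTop)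
    (hm' : Tendsto (fun n => n - m n) atTop atTop) (hmn : ∀ n, m n ≤ n) :
    Tendsto (fun n : ℕ => (∫ y in staySet cX (Ici 0) 0 n, thetaPre α β lam w₁ w₂ (m n) n y *
        Real.exp (-walk cX n y) ∂pathLaw ρ) /
          ∫ y in staySet cX (Ici 0) 0 n, Real.exp (-walk cX n y) ∂pathLaw ρ)
      atTop (𝓝 (mixInt (thetaLim α β lam w₁ w₂) ρ Pp Pm pBinf pCinf / renLap ρ)) :=
  tendsto_ratio h hPp hPm hκ hη (continuous_thetaLim hα hβ hlam hw₁ hw₂)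
    (abs_thetaLim_le hα hβ hlam hw₁ hw₂) (by positivity)
    (abs_thetaLim_sub_le hα hβ hlam hw₁ hw₂) hm hm' (fun n => measurable_thetaPre _ _)
    (by positivity) fun n => Eventually.of_forall fun y hy =>
      abs_thetaPre_sub_le hα hβ hlam hw₁ hw₂ (hmn n) hy

end ThetaPath

lemma renLap_eq {ρ : Measure (ℝ × ℝ)} [IsProbabilityMeasure ρ] {σ : ℝ}
    (h : IsStep (ρ.map Prod.fst) σ) :
    renLap ρ = ∫ x in Ioi (0 : ℝ), Real.exp (-x) * vFun (pathLaw ρ) cX (-x) := by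
  have : IsProbabilityMeasure (ρ.map Prod.fst) :=
    Measure.isProbabilityMeasure_map measurable_fst.aemeasurable
  have h1 := integral_exp_mul_ren h (Or.inl rfl : IsHalf (Ici 0)) one_pos
  rw [div_one] at h1
  rw [renLap, ← h1]
  refine setIntegral_congr_ae measurableSet_Ioi ?_
  filter_upwards [ae_vFun_neg_eq (iid_cX ρ) h.path] with x hx hx0
  rw [hx (le_of_lt hx0), map_cX, one_mul]

/-! ### Transfer from the environment to the path space -/

section Transfer

variable {μ : Measure Ω}

lemma map_eq_pathLaw [IsProbabilityMeasure μ] {E : Type*} [MeasurableSpace E] {Q : ℕ → Ω → E}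
    (hQ : IIDseq μ Q) {g : E → ℝ × ℝ} (hg : Measurable g) {ρ : Measure (ℝ × ℝ)}
    [IsProbabilityMeasure ρ] (hρ : ρ = μ.map fun ω => g (Q 1 ω)) :
    μ.map (fun ω i => g (Q i ω)) = pathLaw ρ := by
  refine (iIndepFun.map_fun_eq_infinitePi_map (X := fun i ω => g (Q i ω))
    (fun i => hg.comp (hQ.1 i)) (hQ.2.1.comp (fun _ => g) fun _ => hg)).trans ?_
  congr 1
  ext1 i
  rw [hρ]
  exact ((hQ.2.2 i).comp hg).map_eq

lemma uFun_map {T : Ω → ℕ → ℝ × ℝ} (hT : Measurable T) :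
    uFun (μ.map T) cX = uFun μ fun i ω => cX i (T ω) := by
  ext x
  simp only [uFun]
  refine if_congr Iff.rfl (congrArg _ (tsum_congr fun k => congrArg _ ?_)) rfl
  have hM : MeasurableSet {y | Mwalk cX (k + 1) y < 0} := by
    simp only [Mwalk_neg_iff]
    exact measurableSet_staySet_cX measurableSet_Iio _ _
  have hS : MeasurableSet {y | -walk cX (k + 1) y ≤ x} :=
    measurableSet_le (by fun_prop) measurable_const
  exact Measure.map_apply hT (hS.inter hM)

lemma vFun_map {T : Ω → ℕ → ℝ × ℝ} (hT : Measurable T) :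
    vFun (μ.map T) cX = vFun μ fun i ω => cX i (T ω) := by
  ext x
  simp only [vFun]
  refine if_congr Iff.rfl (congrArg _ (tsum_congr fun k => congrArg _ ?_)) rfl
  have hL : MeasurableSet {y | 0 ≤ Lwalk cX (k + 1) y} := by
    simp only [Lwalk_nonneg_iff]
    exact measurableSet_staySet_cX measurableSet_Ici _ _
  have hS : MeasurableSet {y | x < -walk cX (k + 1) y} :=
    measurableSet_lt measurable_const (by fun_prop)
  exact Measure.map_apply hT (hS.inter hL)

lemma pathFil_le (n : ℕ) : pathFil n ≤ inferInstanceAs (MeasurableSpace (ℕ → ℝ × ℝ)) :=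
  envFiltration_le (fun i => measurable_pi_apply i) n

lemma measurable_pathFil_of {Ω : Type*} {E : Type*} [MeasurableSpace E] (Q : ℕ → Ω → E) {g : E → ℝ × ℝ}
    (hg : Measurable g) (n : ℕ) :
    Measurable[envFiltration Q n, pathFil n] fun ω i => g (Q i ω) := by
  refine Measurable.of_comap_le ?_
  rw [pathFil, envFiltration, MeasurableSpace.comap_iSup]
  refine iSup_le fun i => ?_
  rw [MeasurableSpace.comap_iSup]
  refine iSup_le fun hi => ?_
  rw [MeasurableSpace.comap_comp]
  exact (hg.comp (measurable_envFiltration Q hi)).comap_le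

variable {F : ℕ → MeasurableSpace Ω} {T : Ω → ℕ → ℝ × ℝ} {x : ℝ} {P : Measure Ω}

lemma IsPplus.map (hT : Measurable T) (hTF : ∀ n, Measurable[F n, pathFil n] T)
    (hu : Measurable (uFun (μ.map T) cX)) (hP : IsPplus μ (fun i ω => cX i (T ω)) F x P) :
    IsPplus (μ.map T) cX pathFil x (P.map T) := by
  have := hP.1
  refine ⟨Measure.isProbabilityMeasure_map hT.aemeasurable, fun n g hg hb => ?_⟩
  have hg' : Measurable g := hg.mono (pathFil_le n) le_rfl
  have hs : MeasurableSet (posSet cX x n) := measurableSet_staySet_cX measurableSet_Ici x n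
  rw [integral_map hT.aemeasurable hg'.aestronglyMeasurable,
    setIntegral_map (f := fun y => g y * uFun (μ.map T) cX (x + walk cX n y)) hs
      (hg'.mul (hu.comp (by fun_prop))).aestronglyMeasurable hT.aemeasurable,
    uFun_map hT]
  exact hP.2 n (g ∘ T) (hg.comp (hTF n)) (hb.imp fun C hC ω => hC (T ω))

lemma IsPminus.map (hT : Measurable T) (hTF : ∀ n, Measurable[F n, pathFil n] T)
    (hv : Measurable (vFun (μ.map T) cX)) (hP : IsPminus μ (fun i ω => cX i (T ω)) F x P) :
    IsPminus (μ.map T) cX pathFil x (P.map T) := by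
  have := hP.1
  refine ⟨Measure.isProbabilityMeasure_map hT.aemeasurable, fun n g hg hb => ?_⟩
  have hg' : Measurable g := hg.mono (pathFil_le n) le_rfl
  have hs : MeasurableSet (negSet cX x n) := measurableSet_staySet_cX measurableSet_Iio x n
  rw [integral_map hT.aemeasurable hg'.aestronglyMeasurable,
    setIntegral_map (f := fun y => g y * vFun (μ.map T) cX (x + walk cX n y)) hs
      (hg'.mul (hv.comp (by fun_prop))).aestronglyMeasurable hT.aemeasurable,
    vFun_map hT]
  exact hP.2 n (g ∘ T) (hg.comp (hTF n)) (hb.imp fun C hC ω => hC (T ω))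

end Transfer

/-! ### Fractional linear environments -/

section Environment

/-- The pair `(X, η)` of an offspring law. -/
def envStep (q : Measure ℕ) : ℝ × ℝ :=
  (Real.log (∑' i : ℕ, (i : ℝ) * (q {i}).toReal),
    (∑' i : ℕ, ((i : ℝ) * ((i : ℝ) - 1)) * (q {i}).toReal) /
      (2 * (∑' i : ℕ, (i : ℝ) * (q {i}).toReal) ^ 2))

lemma measurable_envStep : Measurable envStep := by
  have h : ∀ i : ℕ, Measurable fun q : Measure ℕ => (q {i}).toReal := fun i =>
    (Measure.measurable_coe (measurableSet_singleton i)).ennreal_toReal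
  have h1 : Measurable fun q : Measure ℕ => ∑' i : ℕ, (i : ℝ) * (q {i}).toReal :=
    Measurable.tsum fun i => (h i).const_mul _
  have h2 : Measurable fun q : Measure ℕ => ∑' i : ℕ, ((i : ℝ) * ((i : ℝ) - 1)) * (q {i}).toReal :=
    Measurable.tsum fun i => (h i).const_mul _
  exact (Real.measurable_log.comp h1).prodMk (h2.div ((h1.pow_const 2).const_mul 2))

/-- The path `(X_i, η_i)_i` of an environment. -/
def envPath {Ω : Type*} (Q : ℕ → Ω → Measure ℕ) (ω : Ω) (i : ℕ) : ℝ × ℝ := envStep (Q i ω)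

variable {Ω : Type*} {Q : ℕ → Ω → Measure ℕ} {m n : ℕ} {ω : Ω} {r : ℝ}

lemma measurable_envPath [MeasurableSpace Ω] (hQ : ∀ n, Measurable (Q n)) :
    Measurable (envPath Q) :=
  measurable_pi_lambda _ fun i => measurable_envStep.comp (hQ i)

lemma etaEnv_nonneg (n : ℕ) (ω : Ω) : 0 ≤ etaEnv Q n ω := by
  refine div_nonneg (tsum_nonneg fun i => mul_nonneg ?_ ENNReal.toReal_nonneg) (by positivity)
  rcases Nat.eq_zero_or_pos i with rfl | hi
  · simp
  · have : (1 : ℝ) ≤ i := by exact_mod_cast hi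
    exact mul_nonneg (by linarith) (by linarith)

lemma rC_envPath_nonneg (m n : ℕ) (ω : Ω) : 0 ≤ rC m n (envPath Q ω) :=
  Finset.sum_nonneg fun j _ => mul_nonneg (etaEnv_nonneg (n - j) ω) (Real.exp_pos _).le

lemma rC_succ (k n : ℕ) (y : ℕ → ℝ × ℝ) :
    rC (k + 1) (n + 1) y = Real.exp (cX (n + 1) y) * (rC k n y + (y (n + 1)).2) := by
  rw [rC, Finset.sum_range_succ', rC, mul_add, Finset.mul_sum]
  congr 1
  · refine Finset.sum_congr rfl fun j _ => ?_
    rw [Nat.add_sub_add_right, walk_succ, add_sub_right_comm, Real.exp_add]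
    ring
  · rw [Nat.sub_zero, Nat.add_sub_cancel, walk_succ, add_sub_cancel_left, mul_comm]

lemma pgf_mem_Ico (hQ : FracLinear Q) (hn : 1 ≤ n) (hr : r ∈ Ico 0 1) :
    pgf Q n ω r ∈ Ico 0 1 := by
  refine ⟨tsum_nonneg fun i => mul_nonneg ENNReal.toReal_nonneg (pow_nonneg hr.1 i), ?_⟩
  have h1 : 0 < (1 - pgf Q n ω r)⁻¹ := by
    rw [hQ n hn ω r hr.1 hr.2]
    exact add_pos_of_pos_of_nonneg (div_pos (Real.exp_pos _) (sub_pos.2 hr.2)) (etaEnv_nonneg n ω)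
  exact sub_pos.1 (inv_pos.1 h1)

lemma inv_one_sub_pgfComp (hQ : FracLinear Q) (m k : ℕ) (ω : Ω) {r : ℝ} (hr : r ∈ Ico 0 1) :
    (1 - pgfComp Q m (m + k) ω r)⁻¹ * Real.exp (Senv Q (m + k) ω - Senv Q m ω) =
      rC k (m + k) (envPath Q ω) + (1 - r)⁻¹ := by
  induction k generalizing r with
  | zero =>
    have : pgfComp Q m m ω r = r := by rcases m with - | m <;> simp [pgfComp]
    simp [this, rC]
  | succ k ih =>
    have hS : Senv Q (m + k + 1) ω = Senv Q (m + k) ω + cX (m + k + 1) (envPath Q ω) :=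
      walk_succ _ _ _
    have hp : pgfComp Q m (m + k + 1) ω r = pgfComp Q m (m + k) ω (pgf Q (m + k + 1) ω r) := by
      rw [pgfComp, if_neg (by omega)]
    have hf : (1 - pgf Q (m + k + 1) ω r)⁻¹ =
        Real.exp (-cX (m + k + 1) (envPath Q ω)) / (1 - r) + (envPath Q ω (m + k + 1)).2 :=
      hQ _ (by omega) ω r hr.1 hr.2
    rw [← add_assoc m k 1, hp, hS, add_sub_right_comm, Real.exp_add, ← mul_assoc,
      ih (pgf_mem_Ico hQ (by omega) hr), hf, rC_succ, Real.exp_neg]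
    field_simp
    ring

lemma Vtil_eq [MeasurableSpace Ω] (hQ : FracLinear Q) (hmn : m ≤ n) (hr : r ∈ Ico 0 1) :
    Vtil Q m n r ω = (max (rC (n - m) n (envPath Q ω)) 0 + (1 - r)⁻¹)⁻¹ := by
  obtain ⟨k, rfl⟩ := Nat.exists_eq_add_of_le hmn
  rw [max_eq_left (rC_envPath_nonneg _ _ _), Nat.add_sub_cancel_left,
    ← inv_one_sub_pgfComp hQ m k ω hr, mul_inv, inv_inv, ← Real.exp_neg, neg_sub, Vtil]

lemma Vinf_eq : Vinf Q r ω = (max (pCinf (envPath Q ω)) 0 + (1 - r)⁻¹)⁻¹ := by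
  have h : 0 ≤ pCinf (envPath Q ω) :=
    tsum_nonneg fun i => mul_nonneg (etaEnv_nonneg (i + 1) ω) (Real.exp_pos _).le
  rw [max_eq_left h]
  rfl

lemma one_le_max_add_inv (hr : r ∈ Ico 0 1) (x : ℝ) : 1 ≤ max x 0 + (1 - r)⁻¹ :=
  le_add_of_nonneg_of_le (le_max_right _ _)
    ((one_le_inv₀ (sub_pos.2 hr.2)).2 (sub_le_self 1 hr.1))

variable {α β lam r₁ r₂ : ℝ}

lemma thetaFun_mul_thetaFun_eq [MeasurableSpace Ω] (hQ : FracLinear Q) (hα : 0 < α)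
    (hlam : 0 < lam) (hmn : m ≤ n) (hr₁ : r₁ ∈ Ico 0 1) (hr₂ : r₂ ∈ Ico 0 1) :
    thetaFun α β lam (Uvec Q α lam m ω) (Vtil Q m n r₁ ω) (Senv Q n ω) *
      thetaFun α β lam (Uvec Q α lam m ω) (Vtil Q m n r₂ ω) (Senv Q n ω) =
        thetaPre α β lam (1 - r₁)⁻¹ (1 - r₂)⁻¹ m n (envPath Q ω) := by
  have hx : 0 < lam * α * Real.exp (-Senv Q m ω) := by positivity
  have h1 := one_sub_exp_div_mem hx
  have h2 : Real.exp (-(lam * α * Real.exp (-Senv Q m ω))) ∈ Icc 0 1 :=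
    ⟨(Real.exp_pos _).le, Real.exp_le_one_iff.2 (neg_nonpos.2 hx.le)⟩
  rw [Vtil_eq hQ hmn hr₁, Vtil_eq hQ hmn hr₂, Uvec,
    thetaFun_eq ⟨h2.1.trans h1.1, h1.2⟩ h2 (one_le_max_add_inv hr₁ _),
    thetaFun_eq ⟨h2.1.trans h1.1, h1.2⟩ h2 (one_le_max_add_inv hr₂ _)]
  rfl

lemma thetaStar_mul_thetaStar_eq {ω' : Ω} (hr₁ : r₁ ∈ Ico 0 1) (hr₂ : r₂ ∈ Ico 0 1) (z : ℝ) :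
    thetaStar α β lam (Bplus Q ω) (Vinf Q r₁ ω') (-z) *
      thetaStar α β lam (Bplus Q ω) (Vinf Q r₂ ω') (-z) =
        thetaLim α β lam (1 - r₁)⁻¹ (1 - r₂)⁻¹ (pBinf (envPath Q ω)) (pCinf (envPath Q ω'))
          (Real.exp z) := by
  rw [Vinf_eq, Vinf_eq, thetaStar_eq (one_le_max_add_inv hr₁ _),
    thetaStar_eq (one_le_max_add_inv hr₂ _), neg_neg, thetaLim, max_eq_left (Real.exp_pos z).le]
  rfl

end Environment

section Law

variable {μ : Measure Ω} {Q : ℕ → Ω → Measure ℕ}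

/-- The law of the pair `(X, η)` of a random environment. -/
def stepLaw (μ : Measure Ω) (Q : ℕ → Ω → Measure ℕ) : Measure (ℝ × ℝ) :=
  μ.map fun ω => envStep (Q 1 ω)

lemma isProbabilityMeasure_stepLaw [IsProbabilityMeasure μ] (hQ : IIDseq μ Q) : IsProbabilityMeasure (stepLaw μ Q) :=
  Measure.isProbabilityMeasure_map (measurable_envStep.comp (hQ.1 1)).aemeasurable

lemma map_fst_stepLaw (hQ : IIDseq μ Q) : (stepLaw μ Q).map Prod.fst = μ.map (Xenv Q 1) :=
  Measure.map_map measurable_fst (measurable_envStep.comp (hQ.1 1))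

lemma isStep_stepLaw (hQ : IIDseq μ Q) (h : AssumptionA2 μ Q) :
    IsStep ((stepLaw μ Q).map Prod.fst) (√(∫ ω, Xenv Q 1 ω ^ 2 ∂μ)) := by
  have hX : AEMeasurable (Xenv Q 1) μ :=
    (measurable_fst.comp (measurable_envStep.comp (hQ.1 1))).aemeasurable
  rw [map_fst_stepLaw hQ]
  refine ⟨Real.sqrt_pos.2 h.2.2.2.1, ?_, ?_, h.2.2.2.2⟩
  · rw [integral_map hX (by fun_prop)]
    exact h.2.1
  · rw [integral_map hX (by fun_prop), Real.sq_sqrt h.2.2.2.1.le]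

lemma ae_pathLaw_of_ae {ρ : Measure (ℝ × ℝ)} [IsProbabilityMeasure ρ] {p : ℝ × ℝ → Prop}
    (h : ∀ᵐ x ∂ρ, p x) : ∀ᵐ y ∂pathLaw ρ, ∀ i, p (y i) :=
  ae_all_iff.2 fun i => ae_of_ae_map (measurable_pi_apply i).aemeasurable
    (by rwa [Measure.infinitePi_map_eval])

lemma exists_ae_stepLaw_le (hQ : IIDseq μ Q) (hfrac : FracLinear Q) (h : AssumptionA1 μ Q) :
    ∃ κ, ∀ᵐ x ∂stepLaw μ Q, Real.exp (-x.1) ≤ κ ∧ x.2 ∈ Icc 0 κ := by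
  obtain ⟨χ, hχ, -, h⟩ := h
  have hms : MeasurableSet {x : ℝ × ℝ | Real.exp (-x.1) ≤ χ⁻¹ ∧ x.2 ∈ Icc 0 χ⁻¹} :=
    MeasurableSet.inter (s₁ := {x : ℝ × ℝ | Real.exp (-x.1) ≤ χ⁻¹})
      (measurableSet_le (by fun_prop) measurable_const) (measurable_snd measurableSet_Icc)
  refine ⟨χ⁻¹, (ae_map_iff (measurable_envStep.comp (hQ.1 1)).aemeasurable hms).2 ?_⟩
  filter_upwards [h 1 le_rfl] with ω hω
  have h1 := hfrac 1 le_rfl ω 0 le_rfl one_pos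
  rw [sub_zero, div_one] at h1
  have h2 : Real.exp (-Xenv Q 1 ω) + etaEnv Q 1 ω ≤ χ⁻¹ :=
    h1 ▸ inv_anti₀ hχ (by linarith [hω.2.1])
  have h3 := etaEnv_nonneg (Q := Q) 1 ω
  have h4 := Real.exp_pos (-Xenv Q 1 ω)
  exact ⟨(le_add_of_nonneg_right h3).trans h2, h3, (le_add_of_nonneg_left h4.le).trans h2⟩

end Law

lemma measurable_pBinf : Measurable pBinf :=
  Measurable.tsum fun i => (by fun_prop : Measurable fun y : ℕ → ℝ × ℝ =>
    (y (i + 1)).2 * Real.exp (-walk cX i y))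

lemma measurable_pCinf : Measurable pCinf :=
  Measurable.tsum fun i => (by fun_prop : Measurable fun y : ℕ → ℝ × ℝ =>
    (y (i + 1)).2 * Real.exp (walk cX (i + 1) y))

lemma tendsto_floor_mul_atTop {t : ℝ} (ht : 0 < t) :
    Tendsto (fun n : ℕ => ⌊(n : ℝ) * t⌋₊) atTop atTop :=
  tendsto_nat_floor_atTop.comp (tendsto_natCast_atTop_atTop.atTop_mul_const ht)

lemma floor_mul_le {t : ℝ} (ht : t ≤ 1) (n : ℕ) : ⌊(n : ℝ) * t⌋₊ ≤ n :=
  Nat.floor_le_of_le (mul_le_of_le_one_right n.cast_nonneg ht)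

lemma tendsto_sub_floor_mul_atTop {t : ℝ} (ht0 : 0 ≤ t) (ht : t < 1) :
    Tendsto (fun n : ℕ => n - ⌊(n : ℝ) * t⌋₊) atTop atTop := by
  refine tendsto_natCast_atTop_iff.1 (tendsto_atTop_mono (fun n => ?_)
    (tendsto_natCast_atTop_atTop.atTop_mul_const (sub_pos.2 ht)))
  rw [Nat.cast_sub (floor_mul_le ht.le n)]
  have := Nat.floor_le (mul_nonneg n.cast_nonneg ht0 : 0 ≤ (n : ℝ) * t)
  linarith

lemma integral_integral_map {E : Type*} [MeasurableSpace E] {P P' : Measure Ω} [SFinite P']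
    {T : Ω → E} (hT : Measurable T) {f : E → E → ℝ} (hf : Measurable fun p : E × E => f p.1 p.2) :
    ∫ y, (∫ y', f y y' ∂P'.map T) ∂P.map T = ∫ ω, (∫ ω', f (T ω) (T ω') ∂P') ∂P := by
  rw [integral_map hT.aemeasurable
    hf.stronglyMeasurable.integral_prod_right'.aestronglyMeasurable]
  congr 1 with ω
  exact integral_map hT.aemeasurable
    (hf.comp measurable_prodMk_left).aestronglyMeasurable

/-- **Lemma `LLleft`.** Under A1–A4, for `t ∈ (0,1)`, `0 ≤ r₂ < r₁ < 1` and positive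
`α, β, λ`:
`E[Θ(α,β,λ; U_{⌊nt⌋}, Ṽ_{⌊nt⌋}(r₁,r₂), S_n) e^{-S_n}; L_n ≥ 0] / E[e^{-S_n}; L_n ≥ 0]
  → ⨌ Θ*(α,β,λ; u, v, -z) P⁺(B⁺ ∈ du) P_z⁻(V_∞(r₁,r₂) ∈ dv) ν₁(dz)`. -/
theorem statement15
    {Ω : Type*} [MeasurableSpace Ω] (μ : Measure Ω) [IsProbabilityMeasure μ]
    (Q : ℕ → Ω → Measure ℕ) (hQprob : ∀ n ω, IsProbabilityMeasure (Q n ω))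
    (hiid : IIDseq μ Q) (hfrac : FracLinear Q)
    (hA1 : AssumptionA1 μ Q) (hA2 : AssumptionA2 μ Q) (hA3 : AssumptionA3 μ Q)
    (c : ℕ → ℝ) (hA4 : AssumptionA4 μ (Xenv Q) c)
    (Pp0 : Measure Ω) (hPp0 : IsPplus μ (Xenv Q) (envFiltration Q) 0 Pp0)
    (Pm : ℝ → Measure Ω)
    (hPm : ∀ x : ℝ, x ≤ 0 → IsPminus μ (Xenv Q) (envFiltration Q) x (Pm x))
    (t : ℝ) (ht0 : 0 < t) (ht1 : t < 1)
    (r₁ r₂ : ℝ) (hr2 : 0 ≤ r₂) (hr21 : r₂ < r₁) (hr1 : r₁ < 1)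
    (α β lam : ℝ) (hα : 0 < α) (hβ : 0 < β) (hlam : 0 < lam) :
    Tendsto (fun n : ℕ =>
        (∫ ω in posSet (Xenv Q) 0 n,
            (thetaFun α β lam (Uvec Q α lam ⌊(n : ℝ) * t⌋₊ ω)
                (Vtil Q ⌊(n : ℝ) * t⌋₊ n r₁ ω) (Senv Q n ω) *
              thetaFun α β lam (Uvec Q α lam ⌊(n : ℝ) * t⌋₊ ω)
                (Vtil Q ⌊(n : ℝ) * t⌋₊ n r₂ ω) (Senv Q n ω)) *
              Real.exp (-(Senv Q n ω)) ∂μ) /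
          ∫ ω in posSet (Xenv Q) 0 n, Real.exp (-(Senv Q n ω)) ∂μ)
      atTop (𝓝 (∫ z in Set.Iio (0 : ℝ),
        ((∫ z' in Set.Ioi (0 : ℝ), Real.exp (-z') * vFun μ (Xenv Q) (-z'))⁻¹ *
            Real.exp z * vFun μ (Xenv Q) z) *
          ∫ ω₁, (∫ ω₂,
              thetaStar α β lam (Bplus Q ω₁) (Vinf Q r₁ ω₂) (-z) *
                thetaStar α β lam (Bplus Q ω₁) (Vinf Q r₂ ω₂) (-z)
            ∂(Pm z)) ∂Pp0)) := by

  have hr₁ : r₁ ∈ Ico 0 1 := ⟨hr2.trans hr21.le, hr1⟩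
  have hr₂ : r₂ ∈ Ico 0 1 := ⟨hr2, hr21.trans hr1⟩
  have := isProbabilityMeasure_stepLaw hiid
  have hT : Measurable (envPath Q) := measurable_envPath hiid.1
  have hTF := measurable_pathFil_of Q measurable_envStep
  have hmap : μ.map (envPath Q) = pathLaw (stepLaw μ Q) := map_eq_pathLaw hiid measurable_envStep rfl
  have hstep := isStep_stepLaw hiid hA2
  have hv : vFun (pathLaw (stepLaw μ Q)) cX = vFun μ (Xenv Q) := hmap ▸ vFun_map hT
  obtain ⟨κ, hκ⟩ := exists_ae_stepLaw_le hiid hfrac hA1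
  have hκ := ae_pathLaw_of_ae hκ
  have hPp : IsPplus (pathLaw (stepLaw μ Q)) cX pathFil 0 (Pp0.map (envPath Q)) := by
    rw [← hmap]
    refine IsPplus.map hT hTF ?_ hPp0
    rw [hmap]
    exact (monotone_uFun (iid_cX _) hstep.path).measurable
  have hPm' : ∀ z ≤ 0, IsPminus (pathLaw (stepLaw μ Q)) cX pathFil z ((Pm z).map (envPath Q)) := by
    intro z hz
    rw [← hmap]
    refine IsPminus.map hT hTF ?_ (hPm z hz)
    rw [hmap]
    exact (antitone_vFun (iid_cX _) hstep.path).measurable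
  have hw : ∀ r ∈ Ico (0 : ℝ) 1, 0 ≤ (1 - r)⁻¹ := fun r hr => inv_nonneg.2 (sub_pos.2 hr.2).le
  have key := tendsto_ratio_thetaPre hα hβ hlam (hw _ hr₁) (hw _ hr₂) hstep hPp hPm'
    (hκ.mono fun y hy i => (hy i).1) (hκ.mono fun y hy i => (hy i).2)
    (tendsto_floor_mul_atTop ht0) (tendsto_sub_floor_mul_atTop ht0.le ht1) (floor_mul_le ht1.le)
  have hset := fun (f : (ℕ → ℝ × ℝ) → ℝ) (hf : Measurable f) (n : ℕ) =>
    setIntegral_map (μ := μ) (measurableSet_staySet_cX (measurableSet_Ici (a := (0 : ℝ))) 0 n)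
      hf.aestronglyMeasurable hT.aemeasurable
  rw [hmap] at hset
  convert key using 2 with n
  · rw [hset (fun y => _ * Real.exp (-walk cX n y)) ((measurable_thetaPre _ _).mul (by fun_prop)),
      hset _ (by fun_prop)]
    simp only [thetaFun_mul_thetaFun_eq hfrac hα hlam (floor_mul_le ht1.le n) hr₁ hr₂]
    rfl
  · rw [renLap_eq hstep, mixInt, hv, div_eq_inv_mul, ← integral_const_mul]
    refine setIntegral_congr_fun measurableSet_Iio fun z hz => ?_
    have := (hPm z (le_of_lt hz)).1
    have hI := integral_integral_map (P := Pp0) (P' := Pm z) hT (f := fun y₁ y₂ =>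
        thetaLim α β lam (1 - r₁)⁻¹ (1 - r₂)⁻¹ (pBinf y₁) (pCinf y₂) (Real.exp z))
      (measurable_triple (continuous_thetaLim hα hβ hlam (hw _ hr₁) (hw _ hr₂))
        (measurable_pBinf.comp measurable_fst) (measurable_pCinf.comp measurable_snd)
        measurable_const)
    simp only [thetaStar_mul_thetaStar_eq hr₁ hr₂, hI, mul_assoc]

end BPREpaper
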